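/- Let k ≥ 1 and let N_1, …, N_k be positive integers. Let X = U(N_1) × ⋯ × U(N_k) and let ν = μ_{N_1} × ⋯ × μ_{N_k} be the product of the Haar probability measures on X. Suppose L > 0 and f : X → ℝ satisfies |f(U_1,…,U_k) − f(V_1,…,V_k)| ≤ L · sqrt(Σ_{i=1}^k ‖U_i − V_i‖_F²) for all tuples of unitaries (i.e. f is L-Lipschitz with respect to the ℓ²-combined Frobenius metric on X). Then for every t > 0, ν({U ∈ X : f(U) ≥ E_{V∼ν}[f(V)] + t}) ≤ exp(−(N−2)·t² / (24·L²)), where N = min{N_1,…,N_k}. -/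

import Mathlib

open MeasureTheory

/-- The Frobenius norm `‖M‖_F = sqrt (∑_{i,j} |M i j|²)` of a complex matrix. -/
noncomputable def frobNorm {m n : Type*} [Fintype m] [Fintype n]
    (M : Matrix m n ℂ) : ℝ :=
  Real.sqrt (∑ i, ∑ j, ‖M i j‖ ^ 2)


section
namespace HaarConc

/-! ### Elementary inequalities -/

lemma exp_le_quad (x : ℝ) : Real.exp x ≤ 1 + x + x ^ 2 / 2 * Real.exp |x| := by
  rcases le_total 0 x with hx | hx
  · rw [abs_of_nonneg hx]
    have hmono : MonotoneOn (fun y : ℝ => 1 + y + y ^ 2 / 2 * Real.exp y - Real.exp y) (Set.Ici 0) := by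
      have hd : ∀ y : ℝ, HasDerivAt (fun y : ℝ => 1 + y + y ^ 2 / 2 * Real.exp y - Real.exp y)
          (1 + (y * Real.exp y + y ^ 2 / 2 * Real.exp y) - Real.exp y) y := by
        intro y
        have h1 : HasDerivAt (fun y : ℝ => y ^ 2 / 2) y y := by
          have := (hasDerivAt_pow 2 y).div_const 2
          refine this.congr_deriv ?_
          norm_num
        have := (((hasDerivAt_id y).const_add 1).add (h1.mul (Real.hasDerivAt_exp y))).sub
          (Real.hasDerivAt_exp y)
        exact this
      apply monotoneOn_of_deriv_nonneg (convex_Ici 0)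
      · exact fun y _ => (hd y).continuousAt.continuousWithinAt
      · exact fun y _ => (hd y).differentiableAt.differentiableWithinAt
      · intro y hy
        rw [interior_Ici] at hy
        have hy' : 0 < y := hy
        rw [(hd y).deriv]
        have h1 : (1 - y) ≤ Real.exp (-y) := by
          have := Real.add_one_le_exp (-y); linarith
        have h2 : (1 - y) * Real.exp y ≤ 1 := by
          calc (1 - y) * Real.exp y ≤ Real.exp (-y) * Real.exp y :=
                mul_le_mul_of_nonneg_right h1 (Real.exp_pos y).le
            _ = 1 := by rw [← Real.exp_add]; simp
        have h3 : 0 ≤ y ^ 2 / 2 * Real.exp y := by positivity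
        nlinarith
    have := hmono (Set.mem_Ici.2 le_rfl) (Set.mem_Ici.2 hx) hx
    simp at this
    linarith
  · have h0 : 0 ≤ -x := by linarith
    have h1 := Real.quadratic_le_exp_of_nonneg h0
    have h2 : Real.exp x * Real.exp (-x) = 1 := by rw [← Real.exp_add]; simp
    have h3 : Real.exp x * (1 + -x + (-x) ^ 2 / 2) ≤ 1 := by
      exact (mul_le_mul_of_nonneg_left h1 (Real.exp_pos x).le).trans h2.le
    have h4 : Real.exp x ≤ 1 + x + x ^ 2 / 2 := by
      have h5 : 0 < 1 + -x + (-x) ^ 2 / 2 := by nlinarith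
      have h6 : (1 + x + x ^ 2 / 2) * (1 + -x + (-x) ^ 2 / 2) = 1 + x ^ 4 / 4 := by ring
      have h7 : Real.exp x * (1 + -x + (-x) ^ 2 / 2) ≤
          (1 + x + x ^ 2 / 2) * (1 + -x + (-x) ^ 2 / 2) := by
        rw [h6]; have : 0 ≤ x ^ 4 := by positivity
        linarith
      exact le_of_mul_le_mul_right h7 h5
    have h8 : (1 : ℝ) ≤ Real.exp |x| := Real.one_le_exp (abs_nonneg x)
    nlinarith [sq_nonneg x]

lemma mgf_bound {Ω : Type*} [MeasurableSpace Ω] (μ : Measure Ω) [IsProbabilityMeasure μ]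
    (Y : Ω → ℝ) (hY : AEStronglyMeasurable Y μ) (b l v : ℝ) (hb : ∀ ω, |Y ω| ≤ b)
    (hv : ∫ ω, Y ω ^ 2 ∂μ ≤ v) :
    ∫ ω, Real.exp (l * Y ω) ∂μ ≤
      Real.exp (l * (∫ ω, Y ω ∂μ) + l ^ 2 / 2 * Real.exp (2 * |l| * b) * v) := by
  have bdd : ∀ (Z : Ω → ℝ) (C : ℝ), AEStronglyMeasurable Z μ → (∀ ω, |Z ω| ≤ C) → Integrable Z μ :=
    fun Z C hZ hC => Integrable.of_bound hZ C (Filter.Eventually.of_forall hC)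
  have iY : Integrable Y μ := bdd Y b hY hb
  set m := ∫ ω, Y ω ∂μ with hm
  have hb0 : 0 ≤ b := by
    have : Nonempty Ω := by
      by_contra h
      rw [not_nonempty_iff] at h
      have := measure_univ (μ := μ)
      rw [Set.univ_eq_empty_iff.2 h] at this
      simp at this
    obtain ⟨ω⟩ := this
    exact (abs_nonneg _).trans (hb ω)
  have hmb : |m| ≤ b := by
    have := norm_integral_le_of_norm_le_const (μ := μ) (f := Y) (C := b) (Filter.Eventually.of_forall hb)
    simpa using this
  have iY2 : Integrable (fun ω => Y ω ^ 2) μ := by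
    apply bdd _ (b ^ 2) (hY.pow 2)
    intro ω
    simp only [Pi.pow_apply, abs_pow]
    exact pow_le_pow_left₀ (abs_nonneg _) (hb ω) 2
  have hZ : ∀ ω, |Y ω - m| ≤ 2 * b := fun ω => by
    have := abs_sub (Y ω) m
    linarith [hb ω]
  have iE : Integrable (fun ω => Real.exp (l * Y ω)) μ := by
    apply bdd _ (Real.exp (|l| * b)) (Real.continuous_exp.comp_aestronglyMeasurable (hY.const_mul l))
    intro ω
    rw [abs_of_pos (Real.exp_pos _)]
    apply Real.exp_le_exp.2
    calc l * Y ω ≤ |l * Y ω| := le_abs_self _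
      _ = |l| * |Y ω| := abs_mul _ _
      _ ≤ _ := mul_le_mul_of_nonneg_left (hb ω) (abs_nonneg _)
  have key : ∀ ω, Real.exp (l * Y ω) ≤ Real.exp (l * m) *
      (1 + l * (Y ω - m) + l ^ 2 / 2 * Real.exp (2 * |l| * b) * (Y ω - m) ^ 2) := by
    intro ω
    have h1 : Real.exp (l * Y ω) = Real.exp (l * m) * Real.exp (l * (Y ω - m)) := by
      rw [← Real.exp_add]; congr 1; ring
    rw [h1]
    apply mul_le_mul_of_nonneg_left _ (Real.exp_pos _).le
    refine (exp_le_quad _).trans ?_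
    have h2 : Real.exp |l * (Y ω - m)| ≤ Real.exp (2 * |l| * b) := by
      apply Real.exp_le_exp.2
      rw [abs_mul]
      have := mul_le_mul_of_nonneg_left (hZ ω) (abs_nonneg l)
      linarith
    have h3 : (l * (Y ω - m)) ^ 2 / 2 * Real.exp |l * (Y ω - m)| ≤
        (l * (Y ω - m)) ^ 2 / 2 * Real.exp (2 * |l| * b) :=
      mul_le_mul_of_nonneg_left h2 (by positivity)
    have h4 : (l * (Y ω - m)) ^ 2 / 2 * Real.exp (2 * |l| * b) =
      l ^ 2 / 2 * Real.exp (2 * |l| * b) * (Y ω - m) ^ 2 := by ring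
    linarith
  have hZ2 : ∫ ω, (Y ω - m) ^ 2 ∂μ = ∫ ω, Y ω ^ 2 ∂μ - m ^ 2 := by
    have : ∀ ω, (Y ω - m) ^ 2 = Y ω ^ 2 - 2 * m * Y ω + m ^ 2 := fun ω => by ring
    simp_rw [this]
    have i1 : Integrable (fun ω => Y ω ^ 2 - 2 * m * Y ω) μ := iY2.sub (iY.const_mul _)
    rw [integral_add i1 (integrable_const _),
      integral_sub iY2 (iY.const_mul _), integral_const_mul]
    simp [← hm]; ring
  have iZ : Integrable (fun ω => Y ω - m) μ := iY.sub (integrable_const _)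
  have iZ2 : Integrable (fun ω => (Y ω - m) ^ 2) μ := by
    apply bdd _ ((2 * b) ^ 2) ((hY.sub aestronglyMeasurable_const).pow 2)
    intro ω
    simp only [Pi.pow_apply, abs_pow]
    exact pow_le_pow_left₀ (abs_nonneg _) (hZ ω) 2
  have hZ1 : ∫ ω, (Y ω - m) ∂μ = 0 := by
    rw [integral_sub iY (integrable_const _)]; simp [← hm]
  calc ∫ ω, Real.exp (l * Y ω) ∂μ ≤ ∫ ω, Real.exp (l * m) *
      (1 + l * (Y ω - m) + l ^ 2 / 2 * Real.exp (2 * |l| * b) * (Y ω - m) ^ 2) ∂μ := by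
        apply integral_mono iE _ key
        exact (((integrable_const _).add (iZ.const_mul l)).add (iZ2.const_mul _)).const_mul _
    _ = Real.exp (l * m) * (1 + l ^ 2 / 2 * Real.exp (2 * |l| * b) * ∫ ω, (Y ω - m) ^ 2 ∂μ) := by
        have i1 : Integrable (fun ω => 1 + l * (Y ω - m)) μ := (integrable_const _).add (iZ.const_mul l)
        rw [integral_const_mul, integral_add i1 (iZ2.const_mul _),
          integral_add (integrable_const _) (iZ.const_mul l), integral_const_mul, integral_const_mul, hZ1]
        simp
    _ ≤ Real.exp (l * m) * (1 + l ^ 2 / 2 * Real.exp (2 * |l| * b) * v) := by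
        apply mul_le_mul_of_nonneg_left _ (Real.exp_pos _).le
        have : ∫ ω, (Y ω - m) ^ 2 ∂μ ≤ v := by rw [hZ2]; nlinarith [sq_nonneg m]
        have := mul_le_mul_of_nonneg_left this (show 0 ≤ l ^ 2 / 2 * Real.exp (2 * |l| * b) by positivity)
        linarith
    _ ≤ Real.exp (l * m) * Real.exp (l ^ 2 / 2 * Real.exp (2 * |l| * b) * v) := by
        apply mul_le_mul_of_nonneg_left _ (Real.exp_pos _).le
        have := Real.add_one_le_exp (l ^ 2 / 2 * Real.exp (2 * |l| * b) * v)
        linarith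
    _ = _ := by rw [← Real.exp_add]

end HaarConc
end

section
set_option linter.unusedSectionVars false

namespace HaarConc

section Abstract

/-- The data used for the heat-flow type argument: a compact group `G` acting isometrically on an
ambient inner product algebra `E`. -/
structure Setup (E G : Type*) [NormedRing E] [InnerProductSpace ℝ E] [Group G]
    [TopologicalSpace G] where
  c : G →* E
  cont : Continuous c
  isoL : ∀ u V, ‖c u * V‖ = ‖V‖
  isoR : ∀ u V, ‖V * c u‖ = ‖V‖
  su : Submodule ℝ E
  conj : ∀ u, ∀ A ∈ su, c u * A * c u⁻¹ ∈ su
  oneParam : ∀ A ∈ su, ∃ γ : ℝ → G, γ 0 = 1 ∧ ∀ s, HasDerivAt (fun s => c (γ s)) (A * c (γ s)) s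
  K : E
  hK : K ∈ su
  D : ℝ → G
  D0 : D 0 = 1
  hD : ∀ s, HasDerivAt (fun s => c (D s)) (K * c (D s)) s

variable {E G : Type*} [NormedRing E] [InnerProductSpace ℝ E] [IsScalarTower ℝ E E]
  [SMulCommClass ℝ E E] [FiniteDimensional ℝ E]
  [Group G] [TopologicalSpace G] [IsTopologicalGroup G] [CompactSpace G]
  [SecondCountableTopology G] [MeasurableSpace G] [BorelSpace G]

namespace Setup

variable (S : Setup E G)

/-- smooth functions with derivative bounds -/
structure Cls (L M C : ℝ) (g : E → ℝ) (g' : E → E →L[ℝ] ℝ) : Prop where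
  der : ∀ x, HasFDerivAt g (g' x) x
  bd : ∀ x, ‖g' x‖ ≤ L
  lip : ∀ x y, ‖g' x - g' y‖ ≤ M * ‖x - y‖
  su : ∀ u : G, ∀ A ∈ S.su, |g' (S.c u) (A * S.c u)| ≤ C * ‖A‖

/-- the random group element -/
def h (s : ℝ) (w : G) : G := w * S.D s * w⁻¹

/-- conjugated generator -/
def H (w : G) : E := S.c w * S.K * S.c w⁻¹

lemma H_mem (w : G) : S.H w ∈ S.su := S.conj w _ S.hK

lemma norm_H (w : G) : ‖S.H w‖ = ‖S.K‖ := by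
  unfold H; rw [S.isoR, S.isoL]

lemma continuous_h (s : ℝ) : Continuous (S.h s) := by
  unfold h; fun_prop

lemma integrable_of_continuous {F : Type*} [NormedAddCommGroup F] (μ : Measure G)
    [IsFiniteMeasure μ] {f : G → F} (hf : Continuous f) : Integrable f μ :=
  hf.integrable_of_hasCompactSupport (HasCompactSupport.of_compactSpace f)

/-- left multiplication -/
noncomputable def lm (a : E) : E →L[ℝ] E := ContinuousLinearMap.mul ℝ E a
/-- right multiplication -/
noncomputable def rm (a : E) : E →L[ℝ] E := (ContinuousLinearMap.mul ℝ E).flip a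

@[simp] lemma lm_apply (a b : E) : lm a b = a * b := rfl
@[simp] lemma rm_apply (a b : E) : rm a b = b * a := rfl

lemma continuous_lm : Continuous (lm : E → E →L[ℝ] E) := (ContinuousLinearMap.mul ℝ E).continuous

lemma norm_lm_c (u : G) : ‖lm (S.c u)‖ ≤ 1 :=
  ContinuousLinearMap.opNorm_le_bound _ zero_le_one fun V => by simp [S.isoL]

variable {S}
lemma Cls.cont {L M C : ℝ} {g : E → ℝ} {g' : E → E →L[ℝ] ℝ} (hg : S.Cls L M C g g') :
    Continuous g := continuous_iff_continuousAt.2 fun x => (hg.der x).continuousAt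

lemma Cls.cont' {L M C : ℝ} {g : E → ℝ} {g' : E → E →L[ℝ] ℝ} (hg : S.Cls L M C g g') :
    Continuous g' := by
  have : LipschitzWith (Real.toNNReal M) g' := by
    apply LipschitzWith.of_dist_le_mul
    intro x y
    rw [dist_eq_norm, dist_eq_norm]
    refine (hg.lip x y).trans (mul_le_mul_of_nonneg_right ?_ (norm_nonneg _))
    exact Real.le_coe_toNNReal M
  exact this.continuous
variable (S)

/-- the averaging operator -/
noncomputable def P (ν : Measure G) (s : ℝ) (g : E → ℝ) (x : E) : ℝ :=
  ∫ w, g (S.c (S.h s w) * x) ∂ν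

noncomputable def P' (ν : Measure G) (s : ℝ) (g' : E → E →L[ℝ] ℝ) (x : E) : E →L[ℝ] ℝ :=
  ∫ w, (g' (S.c (S.h s w) * x)).comp (lm (S.c (S.h s w))) ∂ν

variable (ν : Measure G) [IsProbabilityMeasure ν]

lemma cont_c_h (s : ℝ) : Continuous fun w => S.c (S.h s w) := S.cont.comp (S.continuous_h s)

lemma cont_integrand {g' : E → E →L[ℝ] ℝ} (hg : Continuous g') (s : ℝ) (x : E) :
    Continuous fun w => (g' (S.c (S.h s w) * x)).comp (lm (S.c (S.h s w))) := by
  have h1 := S.cont_c_h s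
  exact (hg.comp (h1.mul continuous_const)).clm_comp (continuous_lm.comp h1)

lemma norm_integrand {g' : E → E →L[ℝ] ℝ} (L : ℝ) (hb : ∀ x, ‖g' x‖ ≤ L) (s : ℝ) (x : E) (w : G) :
    ‖(g' (S.c (S.h s w) * x)).comp (lm (S.c (S.h s w)))‖ ≤ L := by
  refine (ContinuousLinearMap.opNorm_comp_le _ _).trans ?_
  calc _ ≤ L * 1 := mul_le_mul (hb _) (S.norm_lm_c _) (norm_nonneg _) ((norm_nonneg _).trans (hb 0))
    _ = L := mul_one L

lemma hasFDerivAt_P {L M C : ℝ} {g : E → ℝ} {g' : E → E →L[ℝ] ℝ} (hg : S.Cls L M C g g')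
    (s : ℝ) (x : E) : HasFDerivAt (S.P ν s g) (S.P' ν s g' x) x := by
  unfold P P'
  apply hasFDerivAt_integral_of_dominated_of_fderiv_le (s := Set.univ) (bound := fun _ => L)
    (F' := fun x w => (g' (S.c (S.h s w) * x)).comp (lm (S.c (S.h s w)))) Filter.univ_mem
  · refine Filter.Eventually.of_forall fun y => ?_
    exact (integrable_of_continuous ν (hg.cont.comp ((S.cont_c_h s).mul continuous_const))).aestronglyMeasurable
  · exact (integrable_of_continuous ν (hg.cont.comp ((S.cont_c_h s).mul continuous_const)))
  · exact (integrable_of_continuous ν (S.cont_integrand hg.cont' s x)).aestronglyMeasurable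
  · exact Filter.Eventually.of_forall fun w y _ => S.norm_integrand L hg.bd s y w
  · exact integrable_const _
  · refine Filter.Eventually.of_forall fun w y _ => ?_
    exact (hg.der _).comp y (lm (S.c (S.h s w))).hasFDerivAt

lemma P'_apply {L M C : ℝ} {g : E → ℝ} {g' : E → E →L[ℝ] ℝ} (hg : S.Cls L M C g g')
    (s : ℝ) (x V : E) : S.P' ν s g' x V = ∫ w, g' (S.c (S.h s w) * x) (S.c (S.h s w) * V) ∂ν := by
  unfold P'
  rw [ContinuousLinearMap.integral_apply (integrable_of_continuous ν (S.cont_integrand hg.cont' s x))]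
  rfl

lemma P'_bd {L M C : ℝ} {g : E → ℝ} {g' : E → E →L[ℝ] ℝ} (hg : S.Cls L M C g g')
    (s : ℝ) (x : E) : ‖S.P' ν s g' x‖ ≤ L := by
  have := norm_integral_le_of_norm_le_const (μ := ν) (C := L)
    (Filter.Eventually.of_forall (S.norm_integrand L hg.bd s x))
  unfold P'
  simpa using this

lemma P'_lip {L M C : ℝ} {g : E → ℝ} {g' : E → E →L[ℝ] ℝ} (hg : S.Cls L M C g g')
    (s : ℝ) (x y : E) : ‖S.P' ν s g' x - S.P' ν s g' y‖ ≤ M * ‖x - y‖ := by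
  unfold P'
  rw [← integral_sub (integrable_of_continuous ν (S.cont_integrand hg.cont' s x))
    (integrable_of_continuous ν (S.cont_integrand hg.cont' s y))]
  have := norm_integral_le_of_norm_le_const (μ := ν) (C := M * ‖x - y‖)
    (f := fun w => (g' (S.c (S.h s w) * x)).comp (lm (S.c (S.h s w))) -
      (g' (S.c (S.h s w) * y)).comp (lm (S.c (S.h s w)))) ?_
  · simpa using this
  · refine Filter.Eventually.of_forall fun w => ?_
    rw [← ContinuousLinearMap.sub_comp]
    refine (ContinuousLinearMap.opNorm_comp_le _ _).trans ?_
    have h1 := hg.lip (S.c (S.h s w) * x) (S.c (S.h s w) * y)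
    rw [← mul_sub, S.isoL] at h1
    calc _ ≤ (M * ‖x - y‖) * 1 :=
          mul_le_mul h1 (S.norm_lm_c _) (norm_nonneg _) ((norm_nonneg _).trans h1)
      _ = _ := mul_one _

variable [ν.IsMulLeftInvariant]

/-- the key symmetrisation: derivative of `P g` along `A x` -/
lemma P'_sym {L M C : ℝ} {g : E → ℝ} {g' : E → E →L[ℝ] ℝ} (hg : S.Cls L M C g g')
    (s : ℝ) (u : G) (A : E) (hA : A ∈ S.su) :
    S.P' ν s g' (S.c u) (A * S.c u) =
      ∫ w, g' (S.c (S.h s w * u)) (A * S.c (S.h s w * u)) ∂ν := by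
  obtain ⟨γ, γ0, hγ⟩ := S.oneParam A hA
  -- both sides are the derivative at `0` of `t ↦ P g (γ t u)`
  have h1 : HasDerivAt (fun t => S.P ν s g (S.c (γ t) * S.c u)) (S.P' ν s g' (S.c u) (A * S.c u)) 0 := by
    have a1 : HasDerivAt (fun t => S.c (γ t) * S.c u) (A * S.c u) 0 := by
      have := (rm (S.c u)).hasFDerivAt.comp_hasDerivAt (0 : ℝ) (hγ 0)
      simpa [γ0, Function.comp_def] using this
    have a2 : HasFDerivAt (S.P ν s g) (S.P' ν s g' (S.c u)) (S.c (γ 0) * S.c u) := by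
      have := S.hasFDerivAt_P ν hg s (S.c u)
      simpa [γ0] using this
    exact a2.comp_hasDerivAt (0 : ℝ) a1
  have h2 : ∀ t, S.P ν s g (S.c (γ t) * S.c u) = ∫ w, g (S.c (γ t) * S.c (S.h s w * u)) ∂ν := by
    intro t
    unfold P
    rw [← integral_mul_left_eq_self _ (γ t)]
    refine integral_congr_ae (Filter.Eventually.of_forall fun w => ?_)
    simp only [h, ← map_mul]
    congr 2
    group
  have h3 : HasDerivAt (fun t => S.P ν s g (S.c (γ t) * S.c u))
      (∫ w, g' (S.c (S.h s w * u)) (A * S.c (S.h s w * u)) ∂ν) 0 := by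
    simp_rw [h2]
    have cw : Continuous fun w => S.c (S.h s w * u) :=
      S.cont.comp ((S.continuous_h s).mul continuous_const)
    have := (hasDerivAt_integral_of_dominated_loc_of_deriv_le (μ := ν) (x₀ := (0 : ℝ))
      (F := fun t w => g (S.c (γ t) * S.c (S.h s w * u)))
      (F' := fun t w => g' (S.c (γ t) * S.c (S.h s w * u)) (A * S.c (γ t) * S.c (S.h s w * u)))
      (s := Set.univ) (bound := fun _ => L * ‖A‖) Filter.univ_mem ?_ ?_ ?_ ?_ ?_ ?_).2
    · simpa [γ0] using this
    · exact Filter.Eventually.of_forall fun t =>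
        (integrable_of_continuous ν (hg.cont.comp (continuous_const.mul cw))).aestronglyMeasurable
    · exact integrable_of_continuous ν (hg.cont.comp (continuous_const.mul cw))
    · exact (integrable_of_continuous ν ((hg.cont'.comp (continuous_const.mul cw)).clm_apply
        (continuous_const.mul cw))).aestronglyMeasurable
    · refine Filter.Eventually.of_forall fun w t _ => ?_
      refine (ContinuousLinearMap.le_opNorm _ _).trans ?_
      rw [S.isoR, S.isoR]
      exact mul_le_mul_of_nonneg_right (hg.bd _) (norm_nonneg _)
    · exact integrable_const _
    · refine Filter.Eventually.of_forall fun w t _ => ?_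
      have a1 : HasDerivAt (fun t => S.c (γ t) * S.c (S.h s w * u))
          (A * S.c (γ t) * S.c (S.h s w * u)) t :=
        (rm (S.c (S.h s w * u))).hasFDerivAt.comp_hasDerivAt t (hγ t)
      exact (hg.der _).comp_hasDerivAt t a1
  exact h1.unique h3

/-- contraction of the `su`-gradient -/
lemma P_cls {L M C : ℝ} (hC : 0 ≤ C) {g : E → ℝ} {g' : E → E →L[ℝ] ℝ} (hg : S.Cls L M C g g')
    (s r : ℝ) (hr : 0 ≤ r)
    (hcontr : ∀ A ∈ S.su, ∫ w, ‖(2⁻¹ : ℝ) • (A + S.c (S.h s w) * A * S.c (S.h s w)⁻¹)‖ ^ 2 ∂ν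
      ≤ r ^ 2 * ‖A‖ ^ 2) :
    S.Cls L M (r * C) (S.P ν s g) (S.P' ν s g') where
  der := S.hasFDerivAt_P ν hg s
  bd := S.P'_bd ν hg s
  lip := S.P'_lip ν hg s
  su := by
    intro u A hA
    set B : G → E := fun w => (2⁻¹ : ℝ) • (A + S.c (S.h s w) * A * S.c (S.h s w)⁻¹) with hB
    have hBm : ∀ w, B w ∈ S.su := fun w =>
      S.su.smul_mem _ (S.su.add_mem hA (S.conj _ _ hA))
    have cB : Continuous B := by
      have c1 := S.cont_c_h s
      have c2 : Continuous fun w => S.c (S.h s w)⁻¹ := S.cont.comp (S.continuous_h s).inv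
      exact ((continuous_const.add ((c1.mul continuous_const).mul c2))).const_smul _
    have cw : Continuous fun w => S.c (S.h s w * u) :=
      S.cont.comp ((S.continuous_h s).mul continuous_const)
    have e1 : S.P' ν s g' (S.c u) (A * S.c u) =
        ∫ w, g' (S.c (S.h s w * u)) (B w * S.c (S.h s w * u)) ∂ν := by
      have a1 := S.P'_sym ν hg s u A hA
      have a2 := S.P'_apply ν hg s (S.c u) (A * S.c u)
      have i1 : Integrable (fun w => g' (S.c (S.h s w * u)) (A * S.c (S.h s w * u))) ν :=
        integrable_of_continuous ν ((hg.cont'.comp cw).clm_apply (continuous_const.mul cw))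
      have i2 : Integrable (fun w => g' (S.c (S.h s w) * S.c u) (S.c (S.h s w) * (A * S.c u))) ν := by
        have c1 := S.cont_c_h s
        exact integrable_of_continuous ν ((hg.cont'.comp (c1.mul continuous_const)).clm_apply
          (c1.mul continuous_const))
      have a3 : S.P' ν s g' (S.c u) (A * S.c u) = (2⁻¹ : ℝ) *
          (∫ w, (g' (S.c (S.h s w * u)) (A * S.c (S.h s w * u)) +
            g' (S.c (S.h s w) * S.c u) (S.c (S.h s w) * (A * S.c u))) ∂ν) := by
        rw [integral_add i1 i2, ← a1, ← a2]; ring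
      rw [a3, ← integral_const_mul]
      refine integral_congr_ae (Filter.Eventually.of_forall fun w => ?_)
      simp only [hB, smul_mul_assoc, map_smul, add_mul, map_add, smul_eq_mul]
      congr 3
      · rw [map_mul]
      · rw [mul_assoc (S.c (S.h s w) * A), ← map_mul, inv_mul_cancel_left, mul_assoc]
    have iB : Integrable (fun w => ‖B w‖) ν := integrable_of_continuous ν cB.norm
    have iB2 : Integrable (fun w => ‖B w‖ ^ 2) ν := integrable_of_continuous ν (cB.norm.pow 2)
    have e2 : ∫ w, ‖B w‖ ∂ν ≤ r * ‖A‖ := by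
      have h1 : (∫ w, ‖B w‖ ∂ν) ^ 2 ≤ ∫ w, ‖B w‖ ^ 2 ∂ν := by
        set m := ∫ w, ‖B w‖ ∂ν
        have h0 : 0 ≤ ∫ w, (‖B w‖ - m) ^ 2 ∂ν := integral_nonneg fun w => sq_nonneg _
        have h2 : ∀ w, (‖B w‖ - m) ^ 2 = ‖B w‖ ^ 2 - 2 * m * ‖B w‖ + m ^ 2 := fun w => by ring
        simp_rw [h2] at h0
        have i1 : Integrable (fun w => ‖B w‖ ^ 2 - 2 * m * ‖B w‖) ν := iB2.sub (iB.const_mul _)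
        rw [integral_add i1 (integrable_const _), integral_sub iB2 (iB.const_mul _),
          integral_const_mul] at h0
        simp at h0
        nlinarith
      have h2 : (∫ w, ‖B w‖ ∂ν) ^ 2 ≤ (r * ‖A‖) ^ 2 := by
        rw [mul_pow]; exact h1.trans (hcontr A hA)
      exact (le_abs_self _).trans (abs_le_of_sq_le_sq h2 (by positivity))
    rw [e1]
    calc |∫ w, g' (S.c (S.h s w * u)) (B w * S.c (S.h s w * u)) ∂ν|
        ≤ ∫ w, |g' (S.c (S.h s w * u)) (B w * S.c (S.h s w * u))| ∂ν := abs_integral_le_integral_abs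
      _ ≤ ∫ w, C * ‖B w‖ ∂ν := by
          apply integral_mono _ (iB.const_mul C) (fun w => hg.su _ _ (hBm w))
          exact integrable_of_continuous ν ((hg.cont'.comp cw).clm_apply (cB.mul cw)).abs
      _ = C * ∫ w, ‖B w‖ ∂ν := integral_const_mul _ _
      _ ≤ C * (r * ‖A‖) := mul_le_mul_of_nonneg_left e2 hC
      _ = r * C * ‖A‖ := by ring

end Setup
end Abstract
end HaarConc
end

section
set_option linter.unusedSectionVars false

namespace HaarConc
section Abstract3

variable {E G : Type*} [NormedRing E] [InnerProductSpace ℝ E] [IsScalarTower ℝ E E]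
  [SMulCommClass ℝ E E] [FiniteDimensional ℝ E]
  [Group G] [TopologicalSpace G] [IsTopologicalGroup G] [CompactSpace G]
  [SecondCountableTopology G] [MeasurableSpace G] [BorelSpace G]

namespace Setup

variable (S : Setup E G)

lemma norm_mul_c (A : E) (u : G) : ‖A * S.c u‖ = ‖A‖ := S.isoR u A

lemma hasDerivAt_ch (w : G) (s : ℝ) :
    HasDerivAt (fun s => S.c (S.h s w)) (S.H w * S.c (S.h s w)) s := by
  have h1 := ((rm (S.c w⁻¹)).comp (lm (S.c w))).hasFDerivAt.comp_hasDerivAt s (S.hD s)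
  have e1 : (fun s => S.c (S.h s w)) =
      (((rm (S.c w⁻¹)).comp (lm (S.c w)) : E →L[ℝ] E) ∘ fun s => S.c (S.D s)) := by
    funext s
    simp [h]
  rw [e1]
  refine h1.congr_deriv ?_
  simp only [H, h, map_mul, ContinuousLinearMap.comp_apply, lm_apply, rm_apply]
  have : S.c w⁻¹ * S.c w = 1 := by rw [← map_mul]; simp
  simp only [mul_assoc]
  rw [← mul_assoc (S.c w⁻¹), this, one_mul]

/-- the curve through `u` -/
lemma hasDerivAt_chu (w u : G) (s : ℝ) :
    HasDerivAt (fun s => S.c (S.h s w * u)) (S.H w * S.c (S.h s w * u)) s := by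
  have h1 := (rm (S.c u)).hasFDerivAt.comp_hasDerivAt s (S.hasDerivAt_ch w s)
  have e1 : (fun s => S.c (S.h s w * u)) = ((rm (S.c u)) ∘ fun s => S.c (S.h s w)) := by
    funext s; simp
  rw [e1]
  refine h1.congr_deriv ?_
  simp [mul_assoc]

lemma h_zero (w : G) : S.h 0 w = 1 := by simp [h, S.D0]

lemma curve_dist (w u : G) (s : ℝ) (hs : 0 ≤ s) :
    ‖S.c (S.h s w * u) - S.c u‖ ≤ ‖S.K‖ * s := by
  have := Convex.norm_image_sub_le_of_norm_hasDerivWithin_le (𝕜 := ℝ) (s := Set.univ) (C := ‖S.K‖)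
    (x := 0) (y := s)
    (fun x _ => (S.hasDerivAt_chu w u x).hasDerivWithinAt) (fun x _ => by
      rw [S.isoR, S.norm_H]) convex_univ (Set.mem_univ _) (Set.mem_univ _)
  simpa [S.h_zero, abs_of_nonneg hs] using this

variable {S}
lemma step_small {L M C : ℝ} {g : E → ℝ} {g' : E → E →L[ℝ] ℝ} (hg : S.Cls L M C g g')
    (w u : G) (s : ℝ) (hs : 0 ≤ s) :
    |g (S.c (S.h s w * u)) - g (S.c u)| ≤ C * ‖S.K‖ * s := by
  have := Convex.norm_image_sub_le_of_norm_hasDerivWithin_le (𝕜 := ℝ) (s := Set.univ)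
    (C := C * ‖S.K‖) (x := 0) (y := s) (f := fun s => g (S.c (S.h s w * u)))
    (fun x _ => ((hg.der _).comp_hasDerivAt x (S.hasDerivAt_chu w u x)).hasDerivWithinAt)
    (fun x _ => by
      have := hg.su (S.h x w * u) _ (S.H_mem w)
      rwa [S.norm_H] at this) convex_univ (Set.mem_univ _) (Set.mem_univ _)
  simpa [S.h_zero, abs_of_nonneg hs] using this

lemma Cls.L_nonneg {L M C : ℝ} {g : E → ℝ} {g' : E → E →L[ℝ] ℝ} (hg : S.Cls L M C g g') : 0 ≤ L :=
  (norm_nonneg _).trans (hg.bd 0)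

lemma step_lin {L M C : ℝ} (hM : 0 ≤ M) {g : E → ℝ} {g' : E → E →L[ℝ] ℝ} (hg : S.Cls L M C g g')
    (w u : G) (s : ℝ) (hs : 0 ≤ s) :
    |g (S.c (S.h s w * u)) - g (S.c u) - s * g' (S.c u) (S.H w * S.c u)|
      ≤ (M + L) * ‖S.K‖ ^ 2 * s ^ 2 := by
  have hL := hg.L_nonneg
  have key : ∀ x ∈ Set.Icc 0 s, |g' (S.c (S.h x w * u)) (S.H w * S.c (S.h x w * u)) -
      g' (S.c u) (S.H w * S.c u)| ≤ (M + L) * ‖S.K‖ ^ 2 * s := by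
    intro x hx
    have hd := S.curve_dist w u x hx.1
    set y := S.c (S.h x w * u) with hy
    set z := S.c u with hz
    have e : g' y (S.H w * y) - g' z (S.H w * z) =
        (g' y - g' z) (S.H w * y) + g' z (S.H w * (y - z)) := by
      simp only [sub_apply, mul_sub, map_sub]; ring
    rw [e]
    have b1 : |(g' y - g' z) (S.H w * y)| ≤ M * (‖S.K‖ * x) * ‖S.K‖ := by
      refine ((g' y - g' z).le_opNorm _).trans ?_
      rw [hy, S.isoR, S.norm_H]
      refine mul_le_mul_of_nonneg_right ((hg.lip _ _).trans ?_) (norm_nonneg _)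
      exact mul_le_mul_of_nonneg_left hd hM
    have b2 : |g' z (S.H w * (y - z))| ≤ L * (‖S.K‖ * (‖S.K‖ * x)) := by
      refine ((g' z).le_opNorm _).trans ?_
      refine mul_le_mul (hg.bd _) ?_ (norm_nonneg _) hL
      refine (norm_mul_le _ _).trans ?_
      rw [S.norm_H]
      exact mul_le_mul_of_nonneg_left hd (norm_nonneg _)
    have b3 : M * (‖S.K‖ * x) * ‖S.K‖ + L * (‖S.K‖ * (‖S.K‖ * x)) = (M + L) * ‖S.K‖ ^ 2 * x := by
      ring
    refine (abs_add_le _ _).trans ((add_le_add b1 b2).trans ?_)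
    rw [b3]
    exact mul_le_mul_of_nonneg_left hx.2 (by positivity)
  have := Convex.norm_image_sub_le_of_norm_hasDerivWithin_le (𝕜 := ℝ) (s := Set.Icc 0 s)
    (C := (M + L) * ‖S.K‖ ^ 2 * s) (x := 0) (y := s)
    (f := fun x => g (S.c (S.h x w * u)) - x * g' (S.c u) (S.H w * S.c u))
    (f' := fun x => g' (S.c (S.h x w * u)) (S.H w * S.c (S.h x w * u)) -
      g' (S.c u) (S.H w * S.c u))
    (fun x _ => by
      have h1 := ((hg.der _).comp_hasDerivAt x (S.hasDerivAt_chu w u x))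
      have h2 := (hasDerivAt_id x).mul_const (g' (S.c u) (S.H w * S.c u))
      have h3 := h1.sub h2
      rw [one_mul] at h3
      exact h3.hasDerivWithinAt)
    (fun x hx => key x hx) (convex_Icc 0 s) (Set.left_mem_Icc.2 hs) (Set.right_mem_Icc.2 hs)
  simp only [S.h_zero, one_mul, zero_mul, sub_zero, Real.norm_eq_abs, abs_of_nonneg hs] at this
  calc _ = |g (S.c (S.h s w * u)) - s * g' (S.c u) (S.H w * S.c u) - g (S.c u)| := by
        congr 1; ring
    _ ≤ _ := this
    _ = _ := by ring

lemma lin_sq {L M C : ℝ} (hC : 0 ≤ C) {g : E → ℝ} {g' : E → E →L[ℝ] ℝ} (hg : S.Cls L M C g g')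
    (ν : Measure G)
    (hiso : ∀ A ∈ S.su, ∫ w, (inner ℝ A (S.H w)) ^ 2 ∂ν ≤ ‖A‖ ^ 2) (u : G) :
    ∫ w, (g' (S.c u) (S.H w * S.c u)) ^ 2 ∂ν ≤ C ^ 2 := by
  let T : S.su →L[ℝ] ℝ := ((g' (S.c u)).comp (rm (S.c u))).comp S.su.subtypeL
  let A0 : S.su := (InnerProductSpace.toDual ℝ S.su).symm T
  have hA : ∀ A ∈ S.su, inner ℝ (A0 : E) A = g' (S.c u) (A * S.c u) := by
    intro A hA
    have := InnerProductSpace.toDual_symm_apply (𝕜 := ℝ) (x := (⟨A, hA⟩ : S.su)) (y := T)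
    exact this
  have hn : ‖(A0 : E)‖ ≤ C := by
    have h1 : ‖(A0 : E)‖ ^ 2 ≤ C * ‖(A0 : E)‖ := by
      rw [← real_inner_self_eq_norm_sq, hA _ A0.2]
      exact (le_abs_self _).trans (hg.su u _ A0.2)
    rcases eq_or_lt_of_le (norm_nonneg (A0 : E)) with h0 | h0
    · rw [← h0]; exact hC
    · nlinarith
  calc ∫ w, (g' (S.c u) (S.H w * S.c u)) ^ 2 ∂ν = ∫ w, (inner ℝ (A0 : E) (S.H w)) ^ 2 ∂ν := by
        simp_rw [fun w => hA _ (S.H_mem w)]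
    _ ≤ ‖(A0 : E)‖ ^ 2 := hiso _ A0.2
    _ ≤ C ^ 2 := by gcongr

lemma continuous_H : Continuous (S.H) := by
  unfold H
  exact (S.cont.mul continuous_const).mul (S.cont.comp continuous_inv)

variable (ν : Measure G) [IsProbabilityMeasure ν]

lemma one_step {L M C : ℝ} (hC : 0 ≤ C) (hM : 0 ≤ M) {g : E → ℝ} {g' : E → E →L[ℝ] ℝ}
    (hg : S.Cls L M C g g')
    (hiso : ∀ A ∈ S.su, ∫ w, (inner ℝ A (S.H w)) ^ 2 ∂ν ≤ ‖A‖ ^ 2) (u : G)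
    (ε : ℝ) (hε : 0 ≤ ε) (l : ℝ) :
    ∫ w, Real.exp (l * g (S.c (S.h ε w * u))) ∂ν ≤ Real.exp (l * S.P ν ε g (S.c u) +
      l ^ 2 / 2 * Real.exp (2 * |l| * (C * ‖S.K‖ * ε)) *
      (ε ^ 2 * C ^ 2 + 3 * (M + L) * ‖S.K‖ ^ 3 * C * ε ^ 3)) := by
  have hL := hg.L_nonneg
  have cw : Continuous fun w => S.c (S.h ε w * u) :=
      S.cont.comp ((S.continuous_h ε).mul continuous_const)
  have cY : Continuous fun w => g (S.c (S.h ε w * u)) - g (S.c u) :=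
    (hg.cont.comp cw).sub continuous_const
  have clin : Continuous fun w => g' (S.c u) (S.H w * S.c u) :=
    (g' (S.c u)).continuous.comp (continuous_H.mul continuous_const)
  have hv : ∫ w, (g (S.c (S.h ε w * u)) - g (S.c u)) ^ 2 ∂ν ≤
      (ε ^ 2 * C ^ 2 + 3 * (M + L) * ‖S.K‖ ^ 3 * C * ε ^ 3) := by
    have pt : ∀ w, (g (S.c (S.h ε w * u)) - g (S.c u)) ^ 2 ≤
        ε ^ 2 * (g' (S.c u) (S.H w * S.c u)) ^ 2 + 3 * (M + L) * ‖S.K‖ ^ 3 * C * ε ^ 3 := by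
      intro w
      have b1 := step_small hg w u ε hε
      have b2 := step_lin hM hg w u ε hε
      have b3 := hg.su u _ (S.H_mem w)
      rw [S.norm_H] at b3
      set d := g (S.c (S.h ε w * u)) - g (S.c u)
      set q := g' (S.c u) (S.H w * S.c u)
      set B := (M + L) * ‖S.K‖ ^ 2 * ε ^ 2
      have b4 : |d + ε * q| ≤ 2 * (C * ‖S.K‖ * ε) := by
        refine (abs_add_le _ _).trans ?_
        rw [abs_mul, abs_of_nonneg hε]
        nlinarith
      have b5 : (d - ε * q) * (d + ε * q) ≤ B * (2 * (C * ‖S.K‖ * ε)) := by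
        refine (le_abs_self _).trans ?_
        rw [abs_mul]
        exact mul_le_mul b2 b4 (abs_nonneg _) (by positivity)
      have b6 : B * (2 * (C * ‖S.K‖ * ε)) ≤ 3 * (M + L) * ‖S.K‖ ^ 3 * C * ε ^ 3 := by
        have : 0 ≤ (M + L) * ‖S.K‖ ^ 3 * C * ε ^ 3 := by positivity
        have e : B * (2 * (C * ‖S.K‖ * ε)) = 2 * ((M + L) * ‖S.K‖ ^ 3 * C * ε ^ 3) := by
          simp only [B]; ring
        rw [e]; linarith
      nlinarith
    have i1 : Integrable (fun w => ε ^ 2 * (g' (S.c u) (S.H w * S.c u)) ^ 2) ν :=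
      integrable_of_continuous ν (continuous_const.mul (clin.pow 2))
    calc _ ≤ ∫ w, (ε ^ 2 * (g' (S.c u) (S.H w * S.c u)) ^ 2 +
          3 * (M + L) * ‖S.K‖ ^ 3 * C * ε ^ 3) ∂ν :=
          integral_mono (integrable_of_continuous ν (cY.pow 2)) (i1.add (integrable_const _)) pt
      _ = ε ^ 2 * ∫ w, (g' (S.c u) (S.H w * S.c u)) ^ 2 ∂ν +
          3 * (M + L) * ‖S.K‖ ^ 3 * C * ε ^ 3 := by
          rw [integral_add i1 (integrable_const _), integral_const_mul]; simp
      _ ≤ _ := by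
          have := lin_sq hC hg ν hiso u
          gcongr
  have hm := mgf_bound ν (fun w => g (S.c (S.h ε w * u)) - g (S.c u))
    (integrable_of_continuous ν cY).aestronglyMeasurable (C * ‖S.K‖ * ε) l _
    (fun w => step_small hg w u ε hε) hv
  have e1 : ∀ w, Real.exp (l * g (S.c (S.h ε w * u))) =
      Real.exp (l * g (S.c u)) * Real.exp (l * (g (S.c (S.h ε w * u)) - g (S.c u))) := by
    intro w; rw [← Real.exp_add]; congr 1; ring
  have e2 : ∫ w, (g (S.c (S.h ε w * u)) - g (S.c u)) ∂ν = S.P ν ε g (S.c u) - g (S.c u) := by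
    have i1 : Integrable (fun w => g (S.c (S.h ε w * u))) ν :=
      integrable_of_continuous ν (hg.cont.comp cw)
    rw [integral_sub i1 (integrable_const _)]
    simp [P]
  rw [e2] at hm
  simp_rw [e1]
  rw [integral_const_mul]
  refine (mul_le_mul_of_nonneg_left hm (Real.exp_pos _).le).trans ?_
  rw [← Real.exp_add]
  apply le_of_eq
  congr 1
  ring

variable [ν.IsMulLeftInvariant]

lemma swap_inv {F : E → ℝ} (hF : Continuous F) (ε : ℝ) :
    ∫ u, ∫ w, F (S.c (S.h ε w * u)) ∂ν ∂ν = ∫ u, F (S.c u) ∂ν := by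
  have c : Continuous fun p : G × G => F (S.c (S.h ε p.2 * p.1)) :=
    hF.comp (S.cont.comp (((S.continuous_h ε).comp continuous_snd).mul continuous_fst))
  have i : Integrable (Function.uncurry fun u w => F (S.c (S.h ε w * u))) (ν.prod ν) :=
    Continuous.integrable_of_hasCompactSupport c (HasCompactSupport.of_compactSpace _)
  rw [integral_integral_swap i]
  have : ∀ w, ∫ u, F (S.c (S.h ε w * u)) ∂ν = ∫ u, F (S.c u) ∂ν := fun w =>
    integral_mul_left_eq_self (fun u => F (S.c u)) (S.h ε w)
  simp_rw [this]
  simp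

lemma iterate {L M C r ε : ℝ} (hC : 0 ≤ C) (hM : 0 ≤ M) (hr : 0 ≤ r) (hr1 : r ≤ 1) (hε : 0 ≤ ε)
    {g : E → ℝ} {g' : E → E →L[ℝ] ℝ} (hg : S.Cls L M C g g')
    (hiso : ∀ A ∈ S.su, ∫ w, (inner ℝ A (S.H w)) ^ 2 ∂ν ≤ ‖A‖ ^ 2)
    (hcontr : ∀ A ∈ S.su, ∫ w, ‖(2⁻¹ : ℝ) • (A + S.c (S.h ε w) * A * S.c (S.h ε w)⁻¹)‖ ^ 2 ∂ν
      ≤ r ^ 2 * ‖A‖ ^ 2) (l : ℝ) (n : ℕ) :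
    ∃ gn gn', S.Cls L M (r ^ n * C) gn gn' ∧ ∫ u, gn (S.c u) ∂ν = ∫ u, g (S.c u) ∂ν ∧
      ∫ u, Real.exp (l * g (S.c u)) ∂ν ≤
        Real.exp (l ^ 2 / 2 * Real.exp (2 * |l| * (C * ‖S.K‖ * ε)) *
          (ε ^ 2 * C ^ 2 * (∑ j ∈ Finset.range n, (r ^ 2) ^ j) +
            3 * (M + L) * ‖S.K‖ ^ 3 * C * ε ^ 3 * (∑ j ∈ Finset.range n, r ^ j))) *
        ∫ u, Real.exp (l * gn (S.c u)) ∂ν := by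
  have hL := hg.L_nonneg
  induction n with
  | zero => exact ⟨g, g', by simpa using hg, rfl, by simp⟩
  | succ n ih =>
    obtain ⟨q, q', hq, hq1, hq2⟩ := ih
    have hCn : 0 ≤ r ^ n * C := by positivity
    have hCn' : r ^ n * C ≤ C := mul_le_of_le_one_left hC (pow_le_one₀ hr hr1)
    have hP := S.P_cls ν hCn hq ε r hr hcontr
    refine ⟨S.P ν ε q, S.P' ν ε q', ?_, ?_, ?_⟩
    · convert hP using 1; ring
    · rw [← hq1, ← swap_inv (S := S) ν hq.cont ε]
      simp [P]
    · have cexp : Continuous fun x : E => Real.exp (l * q x) :=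
        Real.continuous_exp.comp (continuous_const.mul hq.cont)
      have s1 : ∫ u, Real.exp (l * q (S.c u)) ∂ν ≤
          Real.exp (l ^ 2 / 2 * Real.exp (2 * |l| * (C * ‖S.K‖ * ε)) *
            (ε ^ 2 * C ^ 2 * (r ^ 2) ^ n + 3 * (M + L) * ‖S.K‖ ^ 3 * C * ε ^ 3 * r ^ n)) *
          ∫ u, Real.exp (l * S.P ν ε q (S.c u)) ∂ν := by
        rw [← swap_inv (S := S) ν cexp ε, ← integral_const_mul]
        have cP : Continuous fun u => Real.exp (l * S.P ν ε q (S.c u)) :=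
          Real.continuous_exp.comp (continuous_const.mul (hP.cont.comp S.cont))
        have c2 : Continuous fun p : G × G => Real.exp (l * q (S.c (S.h ε p.2 * p.1))) :=
          cexp.comp (S.cont.comp (((S.continuous_h ε).comp continuous_snd).mul continuous_fst))
        have i2 : Integrable (fun p : G × G => Real.exp (l * q (S.c (S.h ε p.2 * p.1)))) (ν.prod ν) :=
          Continuous.integrable_of_hasCompactSupport c2 (HasCompactSupport.of_compactSpace _)
        refine integral_mono i2.integral_prod_left
          ((integrable_of_continuous ν cP).const_mul _) fun u => ?_
        refine (one_step ν hCn hM hq hiso u ε hε l).trans ?_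
        rw [← Real.exp_add]
        apply Real.exp_le_exp.2
        rw [add_comm]
        refine add_le_add ?_ le_rfl
        have e : ε ^ 2 * (r ^ n * C) ^ 2 + 3 * (M + L) * ‖S.K‖ ^ 3 * (r ^ n * C) * ε ^ 3 =
          (ε ^ 2 * C ^ 2 * (r ^ 2) ^ n + 3 * (M + L) * ‖S.K‖ ^ 3 * C * ε ^ 3 * r ^ n) := by
          rw [← pow_mul, mul_comm 2 n, pow_mul]; ring
        rw [e]
        gcongr
      refine hq2.trans ((mul_le_mul_of_nonneg_left s1 (Real.exp_pos _).le).trans ?_)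
      rw [← mul_assoc, ← Real.exp_add]
      apply le_of_eq
      rw [Finset.sum_range_succ, Finset.sum_range_succ]
      congr 2
      ring

end Setup
end Abstract3
end HaarConc
end

section
set_option linter.unusedSectionVars false

namespace HaarConc
section Abstract4

variable {E G : Type*} [NormedRing E] [InnerProductSpace ℝ E] [IsScalarTower ℝ E E]
  [SMulCommClass ℝ E E] [FiniteDimensional ℝ E]
  [Group G] [TopologicalSpace G] [IsTopologicalGroup G] [CompactSpace G]
  [SecondCountableTopology G] [MeasurableSpace G] [BorelSpace G]

namespace Setup

variable {S : Setup E G}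
variable (ν : Measure G) [IsProbabilityMeasure ν] [ν.IsMulLeftInvariant]

lemma limit_n {L M C ε κ : ℝ} (hC : 0 ≤ C) (hM : 0 ≤ M) (hε : 0 < ε) (hκ : 0 < κ)
    (hκ1 : κ * ε ^ 2 < 1)
    {g : E → ℝ} {g' : E → E →L[ℝ] ℝ} (hg : S.Cls L M C g g')
    (hiso : ∀ A ∈ S.su, ∫ w, (inner ℝ A (S.H w)) ^ 2 ∂ν ≤ ‖A‖ ^ 2)
    (hcontr : ∀ A ∈ S.su, ∫ w, ‖(2⁻¹ : ℝ) • (A + S.c (S.h ε w) * A * S.c (S.h ε w)⁻¹)‖ ^ 2 ∂ν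
      ≤ (1 - κ * ε ^ 2) * ‖A‖ ^ 2) (l Q B : ℝ) (hB : 0 ≤ B)
    (hcenter : ∀ C q q', 0 ≤ C → S.Cls L M C q q' →
      ∫ u, Real.exp (l * q (S.c u)) ∂ν ≤ Real.exp (l * ∫ u, q (S.c u) ∂ν + B * C + Q)) :
    ∫ u, Real.exp (l * g (S.c u)) ∂ν ≤ Real.exp (l ^ 2 / 2 * Real.exp (2 * |l| * (C * ‖S.K‖ * ε)) *
          (C ^ 2 / κ + 6 * (M + L) * ‖S.K‖ ^ 3 * C / κ * ε) + (l * ∫ u, g (S.c u) ∂ν + Q)) := by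
  have hL := hg.L_nonneg
  set r := Real.sqrt (1 - κ * ε ^ 2) with hr
  have hr0 : 0 ≤ r := Real.sqrt_nonneg _
  have hr2 : r ^ 2 = 1 - κ * ε ^ 2 := Real.sq_sqrt (by linarith)
  have hκε : 0 < κ * ε ^ 2 := by positivity
  have hr1 : r < 1 := by nlinarith
  have s1 : ∀ n, ∑ j ∈ Finset.range n, (r ^ 2) ^ j ≤ 1 / (κ * ε ^ 2) := by
    intro n
    have := (summable_geometric_of_lt_one (sq_nonneg r) (by nlinarith)).sum_le_tsum
      (Finset.range n) (fun j _ => by positivity)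
    rw [tsum_geometric_of_lt_one (sq_nonneg r) (by nlinarith), hr2] at this
    rw [hr2]
    refine this.trans (le_of_eq ?_)
    rw [one_div]; congr 1; ring
  have s2 : ∀ n, ∑ j ∈ Finset.range n, r ^ j ≤ 2 / (κ * ε ^ 2) := by
    intro n
    have := (summable_geometric_of_lt_one hr0 hr1).sum_le_tsum
      (Finset.range n) (fun j _ => by positivity)
    rw [tsum_geometric_of_lt_one hr0 hr1] at this
    refine this.trans ?_
    rw [inv_eq_one_div, div_le_div_iff₀ (by linarith) hκε]
    nlinarith
  have key : ∀ n : ℕ, ∫ u, Real.exp (l * g (S.c u)) ∂ν ≤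
      Real.exp (l ^ 2 / 2 * Real.exp (2 * |l| * (C * ‖S.K‖ * ε)) *
          (C ^ 2 / κ + 6 * (M + L) * ‖S.K‖ ^ 3 * C / κ * ε) +
          (l * ∫ u, g (S.c u) ∂ν + B * (r ^ n * C) + Q)) := by
    intro n
    obtain ⟨q, q', hq, hq1, hq2⟩ := iterate ν hC hM hr0 hr1.le hε.le hg hiso
      (by rw [hr2]; exact hcontr) l n
    have h3 := hcenter _ q q' (by positivity) hq
    rw [hq1] at h3
    refine hq2.trans ((mul_le_mul_of_nonneg_left h3 (Real.exp_pos _).le).trans ?_)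
    rw [← Real.exp_add]
    apply Real.exp_le_exp.2
    refine add_le_add (mul_le_mul_of_nonneg_left ?_ (by positivity)) le_rfl
    have e1 : C ^ 2 / κ = ε ^ 2 * C ^ 2 * (1 / (κ * ε ^ 2)) := by field_simp
    have e2 : 6 * (M + L) * ‖S.K‖ ^ 3 * C / κ * ε =
      3 * (M + L) * ‖S.K‖ ^ 3 * C * ε ^ 3 * (2 / (κ * ε ^ 2)) := by field_simp; ring
    rw [e1, e2]
    have := s1 n
    have := s2 n
    gcongr
  refine ge_of_tendsto' (x := Filter.atTop) ?_ key
  have t1 : Filter.Tendsto (fun n : ℕ => r ^ n) Filter.atTop (nhds 0) :=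
    tendsto_pow_atTop_nhds_zero_of_lt_one hr0 hr1
  have t2 := (((t1.mul_const C).const_mul B).const_add (l * ∫ u, g (S.c u) ∂ν)).add_const Q
  have t3 := t2.const_add (l ^ 2 / 2 * Real.exp (2 * |l| * (C * ‖S.K‖ * ε)) *
          (C ^ 2 / κ + 6 * (M + L) * ‖S.K‖ ^ 3 * C / κ * ε))
  simp only [zero_mul, mul_zero, add_zero] at t3
  exact (Real.continuous_exp.tendsto _).comp t3

lemma limit_eps {L M C κ ε₀ : ℝ} (hC : 0 ≤ C) (hM : 0 ≤ M) (hκ : 0 < κ) (hε₀ : 0 < ε₀)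
    {g : E → ℝ} {g' : E → E →L[ℝ] ℝ} (hg : S.Cls L M C g g')
    (hiso : ∀ A ∈ S.su, ∫ w, (inner ℝ A (S.H w)) ^ 2 ∂ν ≤ ‖A‖ ^ 2)
    (hcontr : ∀ ε, 0 < ε → ε < ε₀ → ∀ A ∈ S.su,
      ∫ w, ‖(2⁻¹ : ℝ) • (A + S.c (S.h ε w) * A * S.c (S.h ε w)⁻¹)‖ ^ 2 ∂ν
      ≤ (1 - κ * ε ^ 2) * ‖A‖ ^ 2) (l Q B : ℝ) (hB : 0 ≤ B)
    (hcenter : ∀ C q q', 0 ≤ C → S.Cls L M C q q' →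
      ∫ u, Real.exp (l * q (S.c u)) ∂ν ≤ Real.exp (l * ∫ u, q (S.c u) ∂ν + B * C + Q)) :
    ∫ u, Real.exp (l * g (S.c u)) ∂ν ≤ Real.exp (l ^ 2 / 2 * (C ^ 2 / κ) +
      (l * ∫ u, g (S.c u) ∂ν + Q)) := by
  have hc : Continuous fun ε : ℝ => Real.exp (l ^ 2 / 2 *
      Real.exp (2 * |l| * (C * ‖S.K‖ * ε)) *
          (C ^ 2 / κ + 6 * (M + L) * ‖S.K‖ ^ 3 * C / κ * ε) + (l * ∫ u, g (S.c u) ∂ν + Q)) := by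
    fun_prop
  have ht := (hc.tendsto 0).mono_left (nhdsWithin_le_nhds (s := Set.Ioi 0))
  simp only [mul_zero, Real.exp_zero, mul_one, add_zero] at ht
  refine ge_of_tendsto ht ?_
  have c2 : Continuous fun ε : ℝ => κ * ε ^ 2 := by fun_prop
  have e1 : ∀ᶠ ε in nhdsWithin (0 : ℝ) (Set.Ioi 0), κ * ε ^ 2 < 1 := by
    refine nhdsWithin_le_nhds ?_
    exact (c2.tendsto 0).eventually_lt_const (by simp)
  have e2 : ∀ᶠ ε in nhdsWithin (0 : ℝ) (Set.Ioi 0), ε < ε₀ :=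
    nhdsWithin_le_nhds (Iio_mem_nhds hε₀)
  filter_upwards [e1, e2, self_mem_nhdsWithin] with ε h1 h2 h3
  exact limit_n ν hC hM h3 hκ h1 hg hiso (hcontr ε h3 h2) l Q B hB hcenter

end Setup
end Abstract4
end HaarConc
end

section
set_option linter.unusedSectionVars false

namespace HaarConc

lemma jensen_exp {Ω : Type*} [MeasurableSpace Ω] (μ : Measure Ω) [IsProbabilityMeasure μ]
    {Y : Ω → ℝ} (hY : Integrable Y μ) (hE : Integrable (fun ω => Real.exp (Y ω)) μ) :
    Real.exp (∫ ω, Y ω ∂μ) ≤ ∫ ω, Real.exp (Y ω) ∂μ := by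
  set m := ∫ ω, Y ω ∂μ with hm
  have i1 : Integrable (fun ω => Real.exp m * (Y ω - m + 1)) μ :=
    ((hY.sub (integrable_const m)).add (integrable_const 1)).const_mul _
  have h1 : ∫ ω, Real.exp m * (Y ω - m + 1) ∂μ ≤ ∫ ω, Real.exp (Y ω) ∂μ := by
    refine integral_mono i1 hE fun ω => ?_
    have := Real.add_one_le_exp (Y ω - m)
    calc Real.exp m * (Y ω - m + 1) ≤ Real.exp m * Real.exp (Y ω - m) :=
          mul_le_mul_of_nonneg_left this (Real.exp_pos _).le
      _ = Real.exp (Y ω) := by rw [← Real.exp_add]; congr 1; ring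
  have i2 : Integrable (fun ω => Y ω - m) μ := hY.sub (integrable_const m)
  rw [integral_const_mul, integral_add i2 (integrable_const 1),
    integral_sub hY (integrable_const m)] at h1
  simp at h1
  linarith

section Abstract5

variable {E G : Type*} [NormedRing E] [InnerProductSpace ℝ E] [IsScalarTower ℝ E E]
  [SMulCommClass ℝ E E] [FiniteDimensional ℝ E]
  [Group G] [TopologicalSpace G] [IsTopologicalGroup G] [CompactSpace G]
  [SecondCountableTopology G] [MeasurableSpace G] [BorelSpace G]

/-- the central data -/
structure Setup.Center (S : Setup E G) (ι : Type*) [Fintype ι] where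
  T : (ι → ℝ) → G
  contT : Continuous T
  T0 : T 0 = 1
  Z : (ι → ℝ) →ₗ[ℝ] E
  hT : ∀ φ s, HasDerivAt (fun s : ℝ => S.c (T (s • φ))) (Z φ * S.c (T (s • φ))) s
  φ : G → ι → ℝ
  hφ : Measurable φ
  bφ : ∀ u i, |φ u i| ≤ Real.pi
  B : ℝ
  reach : ∀ x u, ∃ A ∈ S.su, ‖A‖ ≤ B ∧ ∃ γ : ℝ → G, γ 0 = 1 ∧
    (∀ s, HasDerivAt (fun s => S.c (γ s)) (A * S.c (γ s)) s) ∧ γ 1 * T (φ u) = x * u * x⁻¹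
  n : ℝ
  hn : 0 < n
  hZ : ∀ b, ‖Z b‖ ^ 2 ≤ (∑ i, b i ^ 2) / n

namespace Setup

variable {S : Setup E G} {ι : Type*} [Fintype ι] (R : S.Center ι)
variable (ν : Measure G) [IsProbabilityMeasure ν] [ν.IsMulLeftInvariant]

lemma Center.reach_bound {L M C : ℝ} (hC : 0 ≤ C) {q : E → ℝ} {q' : E → E →L[ℝ] ℝ}
    (hq : S.Cls L M C q q') (x u : G) :
    |q (S.c (x * u)) - q (S.c (R.T (R.φ u) * x))| ≤ C * R.B := by
  obtain ⟨A, hA, hAB, γ, γ0, hγ, hγ1⟩ := R.reach x u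
  set y := R.T (R.φ u) * x with hy
  have e : x * u = γ 1 * y := by
    rw [hy, ← mul_assoc, hγ1]; group
  have hd : ∀ s, HasDerivAt (fun s => S.c (γ s * y)) (A * S.c (γ s * y)) s := by
    intro s
    have h1 := (rm (S.c y)).hasFDerivAt.comp_hasDerivAt s (hγ s)
    have e1 : (fun s => S.c (γ s * y)) = ((rm (S.c y)) ∘ fun s => S.c (γ s)) := by
      funext s; simp
    rw [e1]
    refine h1.congr_deriv ?_
    simp [mul_assoc]
  have := Convex.norm_image_sub_le_of_norm_hasDerivWithin_le (𝕜 := ℝ) (s := Set.univ)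
    (C := C * R.B) (x := 0) (y := 1) (f := fun s => q (S.c (γ s * y)))
    (fun x _ => ((hq.der _).comp_hasDerivAt x (hd x)).hasDerivWithinAt)
    (fun x _ => (hq.su (γ x * y) A hA).trans (mul_le_mul_of_nonneg_left hAB hC))
    convex_univ (Set.mem_univ _) (Set.mem_univ _)
  rw [e]
  simpa [γ0] using this

lemma Center.coef {L M C : ℝ} {q : E → ℝ} {q' : E → E →L[ℝ] ℝ}
    (hq : S.Cls L M C q q') (x : G) :
    ∃ a : ι → ℝ, (∀ b, q' (S.c x) (R.Z b * S.c x) = ∑ i, a i * b i) ∧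
      ∑ i, a i ^ 2 ≤ L ^ 2 / R.n := by
  classical
  let a : ι → ℝ := fun i => q' (S.c x) (R.Z (Pi.single i 1) * S.c x)
  have ha : ∀ b, q' (S.c x) (R.Z b * S.c x) = ∑ i, a i * b i := by
    intro b
    have e : b = ∑ i, b i • (Pi.single i (1 : ℝ) : ι → ℝ) := by
      funext j
      simp [Finset.sum_apply, Pi.single_apply]
    conv_lhs => rw [e]
    rw [map_sum, Finset.sum_mul, map_sum]
    refine Finset.sum_congr rfl fun i _ => ?_
    rw [map_smul, smul_mul_assoc, map_smul, smul_eq_mul, mul_comm]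
  refine ⟨a, ha, ?_⟩
  have hL := hq.L_nonneg
  have h1 : ∑ i, a i ^ 2 ≤ L * ‖R.Z a‖ := by
    have : ∑ i, a i ^ 2 = q' (S.c x) (R.Z a * S.c x) := by
      rw [ha]; exact Finset.sum_congr rfl fun i _ => by ring
    rw [this]
    refine (le_abs_self _).trans (((q' (S.c x)).le_opNorm _).trans ?_)
    rw [S.isoR]
    exact mul_le_mul_of_nonneg_right (hq.bd _) (norm_nonneg _)
  have h2 := R.hZ a
  have h0 : 0 ≤ ∑ i, a i ^ 2 := Finset.sum_nonneg fun i _ => sq_nonneg _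
  set s := ∑ i, a i ^ 2
  have h3 : s ^ 2 ≤ L ^ 2 * (s / R.n) := by
    calc s ^ 2 ≤ (L * ‖R.Z a‖) ^ 2 := by gcongr
      _ = L ^ 2 * ‖R.Z a‖ ^ 2 := by ring
      _ ≤ _ := by gcongr
  rcases eq_or_lt_of_le h0 with h | h
  · rw [← h]; have := R.hn; positivity
  · have : s * s ≤ (L ^ 2 / R.n) * s := by
      calc s * s = s ^ 2 := by ring
        _ ≤ _ := h3
        _ = _ := by ring
    exact le_of_mul_le_mul_right this h

/-- for a fixed central direction -/
lemma Center.fixed {L M C : ℝ} {q : E → ℝ} {q' : E → E →L[ℝ] ℝ}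
    (hq : S.Cls L M C q q') (l : ℝ) (b : ι → ℝ) :
    ∫ x, Real.exp (l * (q (S.c (R.T b * x)) - q (S.c x))) ∂ν ≤
      ∫ x, Real.exp (l * q' (S.c x) (R.Z b * S.c x)) ∂ν := by
  set μ : Measure ℝ := volume.restrict (Set.Ioc 0 1) with hμ
  have : IsProbabilityMeasure μ := ⟨by simp [hμ]⟩
  have cT : Continuous fun p : G × ℝ => S.c (R.T (p.2 • b) * p.1) := by
    have := R.contT
    have := S.cont
    fun_prop
  have cK : Continuous fun p : G × ℝ =>
      q' (S.c (R.T (p.2 • b) * p.1)) (R.Z b * S.c (R.T (p.2 • b) * p.1)) :=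
    (hq.cont'.comp cT).clm_apply (continuous_const.mul cT)
  have bK : ∀ p : G × ℝ,
      |q' (S.c (R.T (p.2 • b) * p.1)) (R.Z b * S.c (R.T (p.2 • b) * p.1))| ≤ L * ‖R.Z b‖ := by
    intro p
    refine ((q' _).le_opNorm _).trans ?_
    rw [S.isoR]
    exact mul_le_mul_of_nonneg_right (hq.bd _) (norm_nonneg _)
  have cE : Continuous fun p : G × ℝ => Real.exp (l *
      q' (S.c (R.T (p.2 • b) * p.1)) (R.Z b * S.c (R.T (p.2 • b) * p.1))) :=
    Real.continuous_exp.comp (continuous_const.mul cK)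
  have bE : ∀ p : G × ℝ, ‖Real.exp (l *
      q' (S.c (R.T (p.2 • b) * p.1)) (R.Z b * S.c (R.T (p.2 • b) * p.1)))‖ ≤
      Real.exp (|l| * (L * ‖R.Z b‖)) := by
    intro p
    rw [Real.norm_eq_abs, Real.abs_exp]
    apply Real.exp_le_exp.2
    refine (le_abs_self _).trans ?_
    rw [abs_mul]
    exact mul_le_mul_of_nonneg_left (bK p) (abs_nonneg _)
  have iE : Integrable (Function.uncurry fun (x : G) (s : ℝ) => Real.exp (l *
      q' (S.c (R.T (s • b) * x)) (R.Z b * S.c (R.T (s • b) * x)))) (ν.prod μ) :=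
    Integrable.of_bound cE.aestronglyMeasurable _ (Filter.Eventually.of_forall bE)
  have pt : ∀ x, Real.exp (l * (q (S.c (R.T b * x)) - q (S.c x))) ≤
      ∫ s, Real.exp (l * q' (S.c (R.T (s • b) * x)) (R.Z b * S.c (R.T (s • b) * x))) ∂μ := by
    intro x
    have hd : ∀ s : ℝ, HasDerivAt (fun s : ℝ => S.c (R.T (s • b) * x))
        (R.Z b * S.c (R.T (s • b) * x)) s := by
      intro s
      have h1 := (rm (S.c x)).hasFDerivAt.comp_hasDerivAt s (R.hT b s)
      have e1 : (fun s : ℝ => S.c (R.T (s • b) * x)) =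
          ((rm (S.c x)) ∘ fun s : ℝ => S.c (R.T (s • b))) := by
        funext s; simp
      rw [e1]
      refine h1.congr_deriv ?_
      simp [mul_assoc]
    have cs : Continuous fun s : ℝ =>
        q' (S.c (R.T (s • b) * x)) (R.Z b * S.c (R.T (s • b) * x)) :=
      cK.comp (continuous_const.prodMk continuous_id : Continuous fun s : ℝ => (x, s))
    have ftc := intervalIntegral.integral_eq_sub_of_hasDerivAt (a := 0) (b := 1)
      (f := fun s : ℝ => q (S.c (R.T (s • b) * x)))
      (fun s _ => (hq.der _).comp_hasDerivAt s (hd s)) (cs.intervalIntegrable _ _)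
    rw [intervalIntegral.integral_of_le zero_le_one] at ftc
    simp only [one_smul, zero_smul, R.T0, one_mul] at ftc
    rw [← ftc, ← integral_const_mul]
    refine jensen_exp μ ?_ ?_
    · exact (Integrable.of_bound cs.aestronglyMeasurable (L * ‖R.Z b‖)
        (Filter.Eventually.of_forall fun s => bK (x, s))).const_mul l
    · exact Integrable.of_bound (Real.continuous_exp.comp (continuous_const.mul cs)).aestronglyMeasurable
        _ (Filter.Eventually.of_forall fun s => bE (x, s))
  have c1 : Continuous fun x : G => Real.exp (l * (q (S.c (R.T b * x)) - q (S.c x))) := by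
    have := hq.cont
    have := S.cont
    fun_prop
  calc _ ≤ ∫ x, ∫ s, Real.exp (l * q' (S.c (R.T (s • b) * x))
          (R.Z b * S.c (R.T (s • b) * x))) ∂μ ∂ν :=
        integral_mono (integrable_of_continuous ν c1) iE.integral_prod_left pt
    _ = ∫ s, ∫ x, Real.exp (l * q' (S.c (R.T (s • b) * x))
          (R.Z b * S.c (R.T (s • b) * x))) ∂ν ∂μ := integral_integral_swap iE
    _ = ∫ s : ℝ, ∫ x, Real.exp (l * q' (S.c x) (R.Z b * S.c x)) ∂ν ∂μ := by
        refine integral_congr_ae (Filter.Eventually.of_forall fun s => ?_)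
        exact integral_mul_left_eq_self
          (fun x => Real.exp (l * q' (S.c x) (R.Z b * S.c x))) (R.T (s • b))
    _ = _ := by simp

lemma Center.center {L M C : ℝ} (hC : 0 ≤ C) {q : E → ℝ} {q' : E → E →L[ℝ] ℝ}
    (hq : S.Cls L M C q q') (l : ℝ)
    (hmgf : ∀ a : ι → ℝ, ∫ u, Real.exp (∑ i, a i * R.φ u i) ∂ν ≤
      Real.exp (Real.pi ^ 2 / 2 * ∑ i, a i ^ 2)) :
    ∫ u, Real.exp (l * q (S.c u)) ∂ν ≤ Real.exp (l * ∫ u, q (S.c u) ∂ν + (|l| * R.B) * C +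
      l ^ 2 * Real.pi ^ 2 * L ^ 2 / (2 * R.n)) := by
  have cq : Continuous fun u => q (S.c u) := hq.cont.comp S.cont
  obtain ⟨b0, hb0⟩ := isCompact_univ.exists_bound_of_continuousOn (f := fun u => q (S.c u))
    cq.continuousOn
  have hb : ∀ u, |q (S.c u)| ≤ b0 := fun u => hb0 u (Set.mem_univ _)
  set m := ∫ u, q (S.c u) ∂ν with hm
  -- Jensen
  have j1 : Real.exp (-(l * m)) ≤ ∫ x, Real.exp (-(l * q (S.c x))) ∂ν := by
    have := jensen_exp ν (Y := fun x => -(l * q (S.c x)))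
      (integrable_of_continuous ν (continuous_const.mul cq).neg)
      (integrable_of_continuous ν (Real.continuous_exp.comp (continuous_const.mul cq).neg))
    rwa [integral_neg, integral_const_mul] at this
  -- measurability
  have mT : Measurable fun p : G × G => R.T (R.φ p.2) * p.1 :=
    ((R.contT.measurable.comp (R.hφ.comp measurable_snd))).mul measurable_fst
  have mF : Measurable fun p : G × G =>
      Real.exp (l * (q (S.c (R.T (R.φ p.2) * p.1)) - q (S.c p.1))) :=
    Real.measurable_exp.comp (((cq.measurable.comp mT).sub
      (cq.measurable.comp measurable_fst)).const_mul l)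
  have bF : ∀ p : G × G, ‖Real.exp (l * (q (S.c (R.T (R.φ p.2) * p.1)) - q (S.c p.1)))‖ ≤
      Real.exp (|l| * (2 * b0)) := by
    intro p
    rw [Real.norm_eq_abs, Real.abs_exp]
    apply Real.exp_le_exp.2
    refine (le_abs_self _).trans ?_
    rw [abs_mul]
    refine mul_le_mul_of_nonneg_left ((abs_sub _ _).trans ?_) (abs_nonneg _)
    have h1 := hb (R.T (R.φ p.2) * p.1)
    have h2 := hb p.1
    linarith
  have iF : Integrable (Function.uncurry fun x u =>
      Real.exp (l * (q (S.c (R.T (R.φ u) * x)) - q (S.c x)))) (ν.prod ν) :=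
    Integrable.of_bound mF.aestronglyMeasurable _ (Filter.Eventually.of_forall bF)
  have cH : Continuous fun p : G × (ι → ℝ) =>
      Real.exp (l * q' (S.c p.1) (R.Z p.2 * S.c p.1)) := by
    have c1 : Continuous fun p : G × (ι → ℝ) => S.c p.1 := S.cont.comp continuous_fst
    have c2 : Continuous fun p : G × (ι → ℝ) => R.Z p.2 :=
      (LinearMap.continuous_of_finiteDimensional R.Z).comp continuous_snd
    exact Real.continuous_exp.comp (continuous_const.mul ((hq.cont'.comp c1).clm_apply (c2.mul c1)))
  have mH : Measurable fun p : G × G => Real.exp (l * q' (S.c p.1) (R.Z (R.φ p.2) * S.c p.1)) :=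
    cH.measurable.comp (measurable_fst.prodMk (R.hφ.comp measurable_snd))
  have bZ : ∀ u, ‖R.Z (R.φ u)‖ ≤ Real.sqrt ((∑ i : ι, Real.pi ^ 2) / R.n) := by
    intro u
    apply Real.le_sqrt_of_sq_le
    refine (R.hZ _).trans ?_
    refine div_le_div_of_nonneg_right (Finset.sum_le_sum fun i _ => ?_) R.hn.le
    exact sq_le_sq.2 ((R.bφ u i).trans (le_abs_self _))
  have bH : ∀ p : G × G, ‖Real.exp (l * q' (S.c p.1) (R.Z (R.φ p.2) * S.c p.1))‖ ≤
      Real.exp (|l| * (L * Real.sqrt ((∑ i : ι, Real.pi ^ 2) / R.n))) := by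
    intro p
    rw [Real.norm_eq_abs, Real.abs_exp]
    apply Real.exp_le_exp.2
    refine (le_abs_self _).trans ?_
    rw [abs_mul]
    refine mul_le_mul_of_nonneg_left (((q' _).le_opNorm _).trans ?_) (abs_nonneg _)
    rw [S.isoR]
    exact mul_le_mul (hq.bd _) (bZ _) (norm_nonneg _) hq.L_nonneg
  have iH : Integrable (Function.uncurry fun u x =>
      Real.exp (l * q' (S.c x) (R.Z (R.φ u) * S.c x))) (ν.prod ν) :=
    Integrable.of_bound (mH.comp measurable_swap).aestronglyMeasurable _
      (Filter.Eventually.of_forall fun p => bH p.swap)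
  have step1 : ∀ x, (∫ u, Real.exp (l * q (S.c u)) ∂ν) * Real.exp (-(l * q (S.c x))) ≤
      Real.exp (|l| * R.B * C) *
        ∫ u, Real.exp (l * (q (S.c (R.T (R.φ u) * x)) - q (S.c x))) ∂ν := by
    intro x
    rw [← integral_mul_left_eq_self (fun u => Real.exp (l * q (S.c u))) x, ← integral_mul_const,
      ← integral_const_mul]
    have c1 : Continuous fun u => Real.exp (l * q (S.c (x * u))) * Real.exp (-(l * q (S.c x))) := by
      have := hq.cont
      have := S.cont
      fun_prop
    refine integral_mono (integrable_of_continuous ν c1) ?_ fun u => ?_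
    · refine Integrable.const_mul ?_ _
      exact Integrable.of_bound (mF.comp (measurable_const.prodMk measurable_id :
        Measurable fun u : G => (x, u))).aestronglyMeasurable _
        (Filter.Eventually.of_forall fun u => bF (x, u))
    · have h1 := R.reach_bound hC hq x u
      simp only
      rw [← Real.exp_add, ← Real.exp_add]
      apply Real.exp_le_exp.2
      have h2 : l * (q (S.c (x * u)) - q (S.c (R.T (R.φ u) * x))) ≤ |l| * (C * R.B) := by
        refine (le_abs_self _).trans ?_
        rw [abs_mul]
        exact mul_le_mul_of_nonneg_left h1 (abs_nonneg _)
      nlinarith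
  have step2 : (∫ u, Real.exp (l * q (S.c u)) ∂ν) * Real.exp (-(l * m)) ≤
      Real.exp (|l| * R.B * C) *
        ∫ x, ∫ u, Real.exp (l * (q (S.c (R.T (R.φ u) * x)) - q (S.c x))) ∂ν ∂ν := by
    have h0 : 0 ≤ ∫ u, Real.exp (l * q (S.c u)) ∂ν := integral_nonneg fun u => (Real.exp_pos _).le
    refine (mul_le_mul_of_nonneg_left j1 h0).trans ?_
    rw [← integral_const_mul, ← integral_const_mul]
    refine integral_mono ?_ (iF.integral_prod_left.const_mul _) step1
    exact (integrable_of_continuous ν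
      (Real.continuous_exp.comp (continuous_const.mul cq).neg)).const_mul _
  have step3 : ∫ x, ∫ u, Real.exp (l * (q (S.c (R.T (R.φ u) * x)) - q (S.c x))) ∂ν ∂ν ≤
      Real.exp (l ^ 2 * Real.pi ^ 2 * L ^ 2 / (2 * R.n)) := by
    rw [integral_integral_swap iF]
    calc _ ≤ ∫ u, ∫ x, Real.exp (l * q' (S.c x) (R.Z (R.φ u) * S.c x)) ∂ν ∂ν :=
          integral_mono iF.integral_prod_right iH.integral_prod_left fun u => R.fixed ν hq l (R.φ u)
      _ = ∫ x, ∫ u, Real.exp (l * q' (S.c x) (R.Z (R.φ u) * S.c x)) ∂ν ∂ν :=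
          integral_integral_swap iH
      _ ≤ ∫ x, Real.exp (l ^ 2 * Real.pi ^ 2 * L ^ 2 / (2 * R.n)) ∂ν := by
          refine integral_mono iH.integral_prod_right (integrable_const _) fun x => ?_
          obtain ⟨a, ha, ha2⟩ := R.coef hq x
          simp only [ha, Finset.mul_sum]
          have := hmgf (fun i => l * a i)
          simp only [mul_assoc] at this ⊢
          refine this.trans (Real.exp_le_exp.2 ?_)
          have e : ∑ i, (l * a i) ^ 2 = l ^ 2 * ∑ i, a i ^ 2 := by
            rw [Finset.mul_sum]; exact Finset.sum_congr rfl fun i _ => by ring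
          rw [e]
          calc Real.pi ^ 2 / 2 * (l ^ 2 * ∑ i, a i ^ 2) ≤
              Real.pi ^ 2 / 2 * (l ^ 2 * (L ^ 2 / R.n)) := by gcongr
            _ = _ := by field_simp
      _ = _ := by simp
  have h4 : ∫ u, Real.exp (l * q (S.c u)) ∂ν =
      ((∫ u, Real.exp (l * q (S.c u)) ∂ν) * Real.exp (-(l * m))) * Real.exp (l * m) := by
    rw [mul_assoc, ← Real.exp_add]; simp
  rw [h4]
  calc _ ≤ (Real.exp (|l| * R.B * C) * Real.exp (l ^ 2 * Real.pi ^ 2 * L ^ 2 / (2 * R.n))) *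
        Real.exp (l * m) := by
        refine mul_le_mul_of_nonneg_right (step2.trans ?_) (Real.exp_pos _).le
        exact mul_le_mul_of_nonneg_left step3 (Real.exp_pos _).le
    _ = _ := by
        rw [← Real.exp_add, ← Real.exp_add]; congr 1; ring

end Setup
end Abstract5
end HaarConc
end

section
set_option linter.unusedSectionVars false

namespace HaarConc

lemma smooth_approx {E : Type*} [NormedAddCommGroup E] [NormedSpace ℝ E] [FiniteDimensional ℝ E]
    [MeasurableSpace E] [BorelSpace E]
    [HasContDiffBump E]
    (F : E → ℝ) (L : NNReal) (hF : LipschitzWith L F) (δ : ℝ) (hδ : 0 < δ) :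
    ∃ (g : E → ℝ) (g' : E → E →L[ℝ] ℝ) (M : ℝ), 0 ≤ M ∧ (∀ x, HasFDerivAt g (g' x) x) ∧
      (∀ x, ‖g' x‖ ≤ L) ∧ (∀ x y, ‖g' x - g' y‖ ≤ M * ‖x - y‖) ∧
      ∀ x, |g x - F x| ≤ L * δ := by
  let μ : Measure E := Measure.addHaar
  let b : ContDiffBump (0 : E) := ⟨δ / 2, δ, by positivity, by linarith⟩
  set ψ : E → ℝ := b.normed μ with hψ
  have hcψ : HasCompactSupport ψ := b.hasCompactSupport_normed
  have hdψ : ContDiff ℝ 1 ψ := b.contDiff_normed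
  have iψ : Integrable ψ μ := b.integrable_normed
  have hli : LocallyIntegrable F μ := hF.continuous.locallyIntegrable
  let g : E → ℝ := MeasureTheory.convolution ψ F (ContinuousLinearMap.lsmul ℝ ℝ) μ
  let Λ := (ContinuousLinearMap.lsmul ℝ ℝ : ℝ →L[ℝ] ℝ →L[ℝ] ℝ).precompL E
  have hΛ : ∀ (a : E →L[ℝ] ℝ) (u : ℝ), Λ a u = u • a := by
    intro a u
    ext v
    simp [Λ, ContinuousLinearMap.precompL_apply, mul_comm]
  let g' : E → E →L[ℝ] ℝ := MeasureTheory.convolution (fderiv ℝ ψ) F Λ μ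
  have hg : ∀ x, HasFDerivAt g (g' x) x := fun x =>
    hcψ.hasFDerivAt_convolution_left _ hdψ hli x
  have hcψ' : HasCompactSupport (fderiv ℝ ψ) := hcψ.fderiv ℝ
  have hdψ' : Continuous (fderiv ℝ ψ) := hdψ.continuous_fderiv one_ne_zero
  have iψ' : Integrable (fun t => ‖fderiv ℝ ψ t‖) μ :=
    (hdψ'.integrable_of_hasCompactSupport hcψ').norm
  have ce : ∀ x, ConvolutionExistsAt ψ F x (ContinuousLinearMap.lsmul ℝ ℝ) μ := fun x =>
    hcψ.convolutionExists_left _ hdψ.continuous hli x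
  have ce' : ∀ x, ConvolutionExistsAt (fderiv ℝ ψ) F x Λ μ := fun x =>
    hcψ'.convolutionExists_left _ hdψ' hli x
  have hFl : ∀ x y t, |F (x - t) - F (y - t)| ≤ L * ‖x - y‖ := by
    intro x y t
    have := hF.dist_le_mul (x - t) (y - t)
    rwa [Real.dist_eq, dist_eq_norm, sub_sub_sub_cancel_right] at this
  have hgl : LipschitzWith L g := by
    apply LipschitzWith.of_dist_le_mul
    intro x y
    have e : g x - g y = ∫ t, ψ t * (F (x - t) - F (y - t)) ∂μ := by
      have := integral_sub (ce x) (ce y)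
      simp only [g, MeasureTheory.convolution]
      rw [← this]
      refine integral_congr_ae (Filter.Eventually.of_forall fun t => ?_)
      simp [mul_sub]
    rw [Real.dist_eq, dist_eq_norm, e]
    calc |∫ t, ψ t * (F (x - t) - F (y - t)) ∂μ| ≤ ∫ t, ψ t * (L * ‖x - y‖) ∂μ := by
          refine norm_integral_le_of_norm_le (μ := μ) (f := fun t => ψ t * (F (x - t) - F (y - t)))
            (iψ.mul_const _) (Filter.Eventually.of_forall fun t => ?_)
          rw [norm_mul, Real.norm_eq_abs, Real.norm_eq_abs, abs_of_nonneg (b.nonneg_normed t)]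
          exact mul_le_mul_of_nonneg_left (hFl x y t) (b.nonneg_normed t)
      _ = L * ‖x - y‖ := by rw [integral_mul_const, b.integral_normed, one_mul]
  refine ⟨g, g', (L : ℝ) * ∫ t, ‖fderiv ℝ ψ t‖ ∂μ, ?_, hg, ?_, ?_, ?_⟩
  · have : 0 ≤ ∫ t, ‖fderiv ℝ ψ t‖ ∂μ := integral_nonneg fun t => norm_nonneg _
    positivity
  · exact fun x => (hg x).le_of_lipschitz hgl
  · intro x y
    have e : g' x - g' y = ∫ t, Λ (fderiv ℝ ψ t) (F (x - t) - F (y - t)) ∂μ := by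
      have := integral_sub (ce' x) (ce' y)
      simp only [g', MeasureTheory.convolution]
      rw [← this]
      refine integral_congr_ae (Filter.Eventually.of_forall fun t => ?_)
      simp only [map_sub]
    rw [e]
    calc ‖∫ t, Λ (fderiv ℝ ψ t) (F (x - t) - F (y - t)) ∂μ‖
        ≤ ∫ t, ‖fderiv ℝ ψ t‖ * (L * ‖x - y‖) ∂μ := by
          refine norm_integral_le_of_norm_le (iψ'.mul_const _) (Filter.Eventually.of_forall fun t => ?_)
          rw [hΛ, norm_smul, mul_comm, Real.norm_eq_abs]
          exact mul_le_mul_of_nonneg_left (hFl x y t) (norm_nonneg _)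
      _ = _ := by rw [integral_mul_const]; ring
  · intro x
    have := b.dist_normed_convolution_le (μ := μ) (g := F) (x₀ := x) (ε := L * δ)
      hF.continuous.aestronglyMeasurable (fun y hy => by
        refine (hF.dist_le_mul y x).trans ?_
        have : dist y x ≤ δ := (Metric.mem_ball.1 hy).le
        gcongr)
    rwa [Real.dist_eq] at this

section Abstract6

variable {E G : Type*} [NormedRing E] [InnerProductSpace ℝ E] [IsScalarTower ℝ E E]
  [SMulCommClass ℝ E E] [FiniteDimensional ℝ E]
  [Group G] [TopologicalSpace G] [IsTopologicalGroup G] [CompactSpace G]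
  [SecondCountableTopology G] [MeasurableSpace G] [BorelSpace G]

namespace Setup

variable {S : Setup E G} {ι : Type*} [Fintype ι] (R : S.Center ι)
variable (ν : Measure G) [IsProbabilityMeasure ν] [ν.IsMulLeftInvariant]

lemma mgf_smooth {L M κ ε₀ : ℝ} (hM : 0 ≤ M) (hκ : 0 < κ) (hε₀ : 0 < ε₀)
    {g : E → ℝ} {g' : E → E →L[ℝ] ℝ} (hg : S.Cls L M L g g')
    (hiso : ∀ A ∈ S.su, ∫ w, (inner ℝ A (S.H w)) ^ 2 ∂ν ≤ ‖A‖ ^ 2)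
    (hcontr : ∀ ε, 0 < ε → ε < ε₀ → ∀ A ∈ S.su,
      ∫ w, ‖(2⁻¹ : ℝ) • (A + S.c (S.h ε w) * A * S.c (S.h ε w)⁻¹)‖ ^ 2 ∂ν
      ≤ (1 - κ * ε ^ 2) * ‖A‖ ^ 2)
    (hmgf : ∀ a : ι → ℝ, ∫ u, Real.exp (∑ i, a i * R.φ u i) ∂ν ≤
      Real.exp (Real.pi ^ 2 / 2 * ∑ i, a i ^ 2)) (l : ℝ) :
    ∫ u, Real.exp (l * g (S.c u)) ∂ν ≤ Real.exp (l * ∫ u, g (S.c u) ∂ν +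
      l ^ 2 * L ^ 2 / 2 * (1 / κ + Real.pi ^ 2 / R.n)) := by
  have hB : 0 ≤ R.B := by
    obtain ⟨A, _, h, _⟩ := R.reach 1 1
    exact (norm_nonneg _).trans h
  have := limit_eps ν hg.L_nonneg hM hκ hε₀ hg hiso hcontr l
    (l ^ 2 * Real.pi ^ 2 * L ^ 2 / (2 * R.n)) (|l| * R.B) (by positivity)
    (fun C q q' hC hq => R.center ν hC hq l hmgf)
  refine this.trans (le_of_eq ?_)
  congr 1
  have := R.hn
  field_simp
  ring

lemma mgf_lip {L κ ε₀ : ℝ} (hL : 0 ≤ L) (hκ : 0 < κ) (hε₀ : 0 < ε₀)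
    {f : G → ℝ} (hf : ∀ u v, |f u - f v| ≤ L * ‖S.c u - S.c v‖)
    (hiso : ∀ A ∈ S.su, ∫ w, (inner ℝ A (S.H w)) ^ 2 ∂ν ≤ ‖A‖ ^ 2)
    (hcontr : ∀ ε, 0 < ε → ε < ε₀ → ∀ A ∈ S.su,
      ∫ w, ‖(2⁻¹ : ℝ) • (A + S.c (S.h ε w) * A * S.c (S.h ε w)⁻¹)‖ ^ 2 ∂ν
      ≤ (1 - κ * ε ^ 2) * ‖A‖ ^ 2)
    (hmgf : ∀ a : ι → ℝ, ∫ u, Real.exp (∑ i, a i * R.φ u i) ∂ν ≤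
      Real.exp (Real.pi ^ 2 / 2 * ∑ i, a i ^ 2)) (l : ℝ) :
    Continuous f ∧ ∫ u, Real.exp (l * f u) ∂ν ≤ Real.exp (l * ∫ u, f u ∂ν +
      l ^ 2 * L ^ 2 / 2 * (1 / κ + Real.pi ^ 2 / R.n)) := by
  borelize E
  -- McShane extension
  obtain ⟨F, hF, hFf⟩ : ∃ F : E → ℝ, LipschitzWith L.toNNReal F ∧ ∀ u, F (S.c u) = f u := by
    have hinj : ∀ u v, S.c u = S.c v → f u = f v := by
      intro u v h
      have := hf u v
      rw [h] at this
      simp only [sub_self, norm_zero, mul_zero] at this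
      exact sub_eq_zero.1 (abs_nonpos_iff.1 this)
    let f0 : E → ℝ := Function.extend S.c f 0
    have hf0 : ∀ u, f0 (S.c u) = f u := by
      intro u
      have hft : Function.FactorsThrough f S.c := fun u v h => hinj u v h
      exact hft.extend_apply _ u
    have hl : LipschitzOnWith L.toNNReal f0 (Set.range S.c) := by
      apply LipschitzOnWith.of_dist_le_mul
      rintro _ ⟨u, rfl⟩ _ ⟨v, rfl⟩
      rw [hf0, hf0, Real.dist_eq, dist_eq_norm, Real.coe_toNNReal _ hL]
      exact hf u v
    obtain ⟨F, hF, he⟩ := hl.extend_real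
    exact ⟨F, hF, fun u => by rw [← he (Set.mem_range_self u), hf0]⟩
  have cf : Continuous f := by
    have : f = fun u => F (S.c u) := by funext u; rw [hFf]
    rw [this]; exact hF.continuous.comp S.cont
  refine ⟨cf, ?_⟩
  have key : ∀ δ : ℝ, 0 < δ → ∫ u, Real.exp (l * f u) ∂ν ≤ Real.exp (2 * |l| * (L * δ) +
      (l * ∫ u, f u ∂ν + l ^ 2 * L ^ 2 / 2 * (1 / κ + Real.pi ^ 2 / R.n))) := by
    intro δ hδ
    obtain ⟨g, g', M, hM, hg1, hg2, hg3, hg4⟩ := smooth_approx F _ hF δ hδ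
    rw [Real.coe_toNNReal _ hL] at hg2 hg4
    have hg : S.Cls L M L g g' := ⟨hg1, hg2, hg3, fun u A _ => by
      refine ((g' _).le_opNorm _).trans ?_
      rw [S.isoR]
      exact mul_le_mul_of_nonneg_right (hg2 _) (norm_nonneg _)⟩
    have cg : Continuous fun u => g (S.c u) := hg.cont.comp S.cont
    have h1 := mgf_smooth R ν hM hκ hε₀ hg hiso hcontr hmgf l
    have hd : ∀ u, |g (S.c u) - f u| ≤ L * δ := fun u => by rw [← hFf]; exact hg4 _
    have h2 : |∫ u, g (S.c u) ∂ν - ∫ u, f u ∂ν| ≤ L * δ := by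
      have i1 : Integrable (fun u => g (S.c u)) ν := integrable_of_continuous ν cg
      rw [← integral_sub i1 (integrable_of_continuous ν cf)]
      have := norm_integral_le_of_norm_le_const (μ := ν) (C := L * δ)
        (f := fun u => g (S.c u) - f u) (Filter.Eventually.of_forall hd)
      simpa using this
    have h3 : ∫ u, Real.exp (l * f u) ∂ν ≤
        Real.exp (|l| * (L * δ)) * ∫ u, Real.exp (l * g (S.c u)) ∂ν := by
      rw [← integral_const_mul]
      refine integral_mono (integrable_of_continuous ν (by fun_prop))
        ((integrable_of_continuous ν (Real.continuous_exp.comp (continuous_const.mul cg))).const_mul _) fun u => ?_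
      simp only
      rw [← Real.exp_add]
      apply Real.exp_le_exp.2
      have : l * (f u - g (S.c u)) ≤ |l| * (L * δ) := by
        refine (le_abs_self _).trans ?_
        rw [abs_mul, abs_sub_comm]
        exact mul_le_mul_of_nonneg_left (hd u) (abs_nonneg _)
      linarith
    refine h3.trans ((mul_le_mul_of_nonneg_left h1 (Real.exp_pos _).le).trans ?_)
    rw [← Real.exp_add]
    apply Real.exp_le_exp.2
    have : l * (∫ u, g (S.c u) ∂ν - ∫ u, f u ∂ν) ≤ |l| * (L * δ) := by
      refine (le_abs_self _).trans ?_
      rw [abs_mul]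
      exact mul_le_mul_of_nonneg_left h2 (abs_nonneg _)
    linarith
  have hc : Continuous fun δ : ℝ => Real.exp (2 * |l| * (L * δ) +
      (l * ∫ u, f u ∂ν + l ^ 2 * L ^ 2 / 2 * (1 / κ + Real.pi ^ 2 / R.n))) := by
    fun_prop
  have ht := (hc.tendsto 0).mono_left (nhdsWithin_le_nhds (s := Set.Ioi 0))
  simp only [mul_zero, zero_add] at ht
  refine ge_of_tendsto ht ?_
  filter_upwards [self_mem_nhdsWithin] with δ hδ
  exact key δ hδ

/-- Chernoff -/
lemma tail {L κ ε₀ N : ℝ} (hL : 0 < L) (hκ : 0 < κ) (hε₀ : 0 < ε₀) (hN : 0 < N)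
    (hκN : 1 / κ + Real.pi ^ 2 / R.n ≤ 12 / N)
    {f : G → ℝ} (hf : ∀ u v, |f u - f v| ≤ L * ‖S.c u - S.c v‖)
    (hiso : ∀ A ∈ S.su, ∫ w, (inner ℝ A (S.H w)) ^ 2 ∂ν ≤ ‖A‖ ^ 2)
    (hcontr : ∀ ε, 0 < ε → ε < ε₀ → ∀ A ∈ S.su,
      ∫ w, ‖(2⁻¹ : ℝ) • (A + S.c (S.h ε w) * A * S.c (S.h ε w)⁻¹)‖ ^ 2 ∂ν
      ≤ (1 - κ * ε ^ 2) * ‖A‖ ^ 2)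
    (hmgf : ∀ a : ι → ℝ, ∫ u, Real.exp (∑ i, a i * R.φ u i) ∂ν ≤
      Real.exp (Real.pi ^ 2 / 2 * ∑ i, a i ^ 2)) (t : ℝ) (ht : 0 < t) :
    ν {u | (∫ v, f v ∂ν) + t ≤ f u} ≤ ENNReal.ofReal (Real.exp (-(N * t ^ 2) / (24 * L ^ 2))) := by
  set l : ℝ := t * N / (12 * L ^ 2) with hl
  have hl0 : 0 < l := by positivity
  obtain ⟨cf, h1⟩ := mgf_lip R ν hL.le hκ hε₀ hf hiso hcontr hmgf l
  set m := ∫ v, f v ∂ν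
  have hi : Integrable (fun u => Real.exp (l * f u)) ν := integrable_of_continuous ν (by fun_prop)
  have h2 := ProbabilityTheory.measure_ge_le_exp_mul_mgf (μ := ν) (X := f) (m + t) hl0.le hi
  rw [← ofReal_measureReal]
  apply ENNReal.ofReal_le_ofReal
  refine h2.trans ?_
  unfold ProbabilityTheory.mgf
  refine (mul_le_mul_of_nonneg_left h1 (Real.exp_pos _).le).trans ?_
  rw [← Real.exp_add]
  apply Real.exp_le_exp.2
  have h3 : l ^ 2 * L ^ 2 / 2 * (1 / κ + Real.pi ^ 2 / R.n) ≤ l ^ 2 * L ^ 2 / 2 * (12 / N) := by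
    gcongr
  have h4 : -l * (m + t) + (l * m + l ^ 2 * L ^ 2 / 2 * (12 / N)) = -(N * t ^ 2) / (24 * L ^ 2) := by
    rw [hl]; field_simp; ring
  linarith

end Setup
end Abstract6
end HaarConc
end

section
set_option linter.unusedSectionVars false

namespace HaarConc
section Mat
variable {n : Type*} [Fintype n] [DecidableEq n]

/-- diagonal unitary -/
noncomputable def dg (θ : n → ℝ) : Matrix.unitaryGroup n ℂ :=
  ⟨Matrix.diagonal fun p => Complex.exp (Complex.I * θ p), by
    rw [Matrix.mem_unitaryGroup_iff, Matrix.star_eq_conjTranspose, Matrix.diagonal_conjTranspose,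
      Matrix.diagonal_mul_diagonal, ← Matrix.diagonal_one]
    congr 1
    funext p
    simp [← Complex.exp_conj, ← Complex.exp_add]⟩

lemma coe_dg (θ : n → ℝ) : (dg θ : Matrix n n ℂ) =
    Matrix.diagonal fun p => Complex.exp (Complex.I * θ p) := rfl

lemma dg_zero : dg (0 : n → ℝ) = 1 := by
  apply Subtype.ext
  simp [coe_dg]

lemma dg_add (θ η : n → ℝ) : dg (θ + η) = dg θ * dg η := by
  apply Subtype.ext
  rw [Matrix.UnitaryGroup.mul_val, coe_dg, coe_dg, coe_dg, Matrix.diagonal_mul_diagonal]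
  congr 1
  funext p
  rw [← Complex.exp_add]; congr 1; push_cast [Pi.add_apply]; ring

lemma star_mul_self_coe (z : Matrix.unitaryGroup n ℂ) : star (z : Matrix n n ℂ) * z = 1 :=
  Matrix.UnitaryGroup.star_mul_self z

lemma mul_star_self_coe (z : Matrix.unitaryGroup n ℂ) : (z : Matrix n n ℂ) * star (z : Matrix n n ℂ) = 1 :=
  Matrix.mem_unitaryGroup_iff.1 z.2

lemma diag_herm (A : Matrix n n ℂ) (hA : A.IsHermitian) :
    ∃ (z : Matrix.unitaryGroup n ℂ) (θ : n → ℝ), A = z * Matrix.diagonal (fun p => (θ p : ℂ)) *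
      star (z : Matrix n n ℂ) := by
  refine ⟨hA.eigenvectorUnitary, hA.eigenvalues, ?_⟩
  conv_lhs => rw [hA.spectral_theorem]
  rw [Unitary.conjStarAlgAut_apply]
  rfl

lemma diag_skew (A : Matrix n n ℂ) (hA : star A = -A) :
    ∃ (z : Matrix.unitaryGroup n ℂ) (θ : n → ℝ),
      A = z * Matrix.diagonal (fun p => Complex.I * (θ p : ℂ)) * star (z : Matrix n n ℂ) := by
  obtain ⟨z, θ, h⟩ := diag_herm (-Complex.I • A) (by
    rw [Matrix.IsHermitian, ← Matrix.star_eq_conjTranspose, star_smul, hA]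
    simp)
  refine ⟨z, θ, ?_⟩
  have h1 : A = Complex.I • (-Complex.I • A) := by
    rw [smul_smul]; simp
  have h2 : (Matrix.diagonal fun p => Complex.I * (θ p : ℂ)) =
      Complex.I • Matrix.diagonal (fun p => (θ p : ℂ)) := by
    rw [← Matrix.diagonal_smul]; rfl
  rw [h1, h, h2, Matrix.mul_smul, Matrix.smul_mul]

open scoped Matrix.Norms.L2Operator in
lemma unitary_exp (u : Matrix.unitaryGroup n ℂ) : ∃ S : Matrix n n ℂ, S.IsHermitian ∧
    NormedSpace.exp (Complex.I • S) = (u : Matrix n n ℂ) := by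
  let v : unitary (Matrix n n ℂ) := u
  refine ⟨Unitary.argSelfAdjoint v, (Unitary.argSelfAdjoint v).2, ?_⟩
  have hc : ContinuousOn Complex.arg (spectrum ℂ (v : Matrix n n ℂ)) :=
    (Matrix.finite_spectrum _).continuousOn _
  rw [Unitary.argSelfAdjoint_coe, ← CFC.exp_eq_normedSpace_exp (𝕜 := ℂ),
    ← cfc_comp_smul .., ← cfc_comp' ..]
  conv_rhs => rw [← cfc_id' ℂ (v : Matrix n n ℂ)]
  refine cfc_congr fun y hy ↦ ?_
  have hy₁ : ‖y‖ = 1 := spectrum.norm_eq_one_of_unitary v.2 hy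
  have : Complex.I * y.arg = Complex.log y :=
    Complex.ext (by simp [Complex.log_re, hy₁]) (by simp [Complex.log_im])
  have hy0 : y ≠ 0 := by
    intro h; rw [h] at hy₁; simp at hy₁
  simpa [← Complex.exp_eq_exp_ℂ, this] using Complex.exp_log hy0

lemma diag_unitary (u : Matrix.unitaryGroup n ℂ) : ∃ (z : Matrix.unitaryGroup n ℂ) (θ : n → ℝ),
    u = z * dg θ * z⁻¹ ∧ ∀ p, |θ p| ≤ Real.pi := by
  obtain ⟨S, hS, hu⟩ := unitary_exp u
  obtain ⟨z, θ, h⟩ := diag_herm S hS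
  have hz : (z : Matrix n n ℂ)⁻¹ = star (z : Matrix n n ℂ) :=
    Matrix.inv_eq_right_inv (mul_star_self_coe z)
  have hzu : IsUnit (z : Matrix n n ℂ) := by
    rw [Matrix.isUnit_iff_isUnit_det]
    exact Matrix.UnitaryGroup.det_isUnit z
  have e1 : Complex.I • S = z * (Matrix.diagonal fun p => Complex.I * (θ p : ℂ)) *
      (z : Matrix n n ℂ)⁻¹ := by
    have h2 : (Matrix.diagonal fun p => Complex.I * (θ p : ℂ)) =
      Complex.I • Matrix.diagonal (fun p => (θ p : ℂ)) := by
      rw [← Matrix.diagonal_smul]; rfl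
    rw [h, h2, hz, Matrix.mul_smul, Matrix.smul_mul]
  rw [e1, Matrix.exp_conj _ _ hzu, Matrix.exp_diagonal] at hu
  have e2 : NormedSpace.exp (fun p => Complex.I * (θ p : ℂ)) =
      fun p => Complex.exp (Complex.I * θ p) := by
    funext p
    rw [Pi.coe_exp, Complex.exp_eq_exp_ℂ]
  rw [e2] at hu
  refine ⟨z, fun p => Complex.arg (Complex.exp (Complex.I * θ p)), ?_,
    fun p => Complex.abs_arg_le_pi _⟩
  apply Subtype.ext
  rw [Matrix.UnitaryGroup.mul_val, Matrix.UnitaryGroup.mul_val, coe_dg, ← hu, hz]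
  have : (fun p => Complex.exp (Complex.I * (Complex.arg (Complex.exp (Complex.I * θ p)) : ℝ))) =
      fun p => Complex.exp (Complex.I * θ p) := by
    funext p
    have hn : ‖Complex.exp (Complex.I * θ p)‖ = 1 := by
      rw [mul_comm]; exact Complex.norm_exp_ofReal_mul_I _
    have := Complex.norm_mul_exp_arg_mul_I (Complex.exp (Complex.I * θ p))
    rw [hn] at this
    simpa [mul_comm] using this
  rw [this]
  rfl

/-- the generic curve -/
noncomputable def curve (z : Matrix.unitaryGroup n ℂ) (θ : n → ℝ) (s : ℝ) :
    Matrix.unitaryGroup n ℂ := z * dg (s • θ) * z⁻¹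

/-- its generator -/
noncomputable def gen (z : Matrix.unitaryGroup n ℂ) (θ : n → ℝ) : Matrix n n ℂ :=
  z * Matrix.diagonal (fun p => Complex.I * (θ p : ℂ)) * star (z : Matrix n n ℂ)

lemma curve_zero (z : Matrix.unitaryGroup n ℂ) (θ : n → ℝ) : curve z θ 0 = 1 := by
  simp [curve, dg_zero]

lemma coe_curve (z : Matrix.unitaryGroup n ℂ) (θ : n → ℝ) (s : ℝ) :
    (curve z θ s : Matrix n n ℂ) =
      z * Matrix.diagonal (fun p => Complex.exp (Complex.I * (s * θ p : ℝ))) *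
        star (z : Matrix n n ℂ) := rfl

lemma hasDerivAt_curve (z : Matrix.unitaryGroup n ℂ) (θ : n → ℝ) (s : ℝ) (p q : n) :
    HasDerivAt (fun s => (curve z θ s : Matrix n n ℂ) p q)
      ((gen z θ * (curve z θ s : Matrix n n ℂ)) p q) s := by
  have e : ∀ s : ℝ, (curve z θ s : Matrix n n ℂ) p q =
      ∑ r, (z : Matrix n n ℂ) p r * Complex.exp (Complex.I * (s * θ r : ℝ)) *
        star (z : Matrix n n ℂ) r q := by
    intro s
    rw [coe_curve, Matrix.mul_apply]
    simp [Matrix.mul_diagonal]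
  have e2 : (gen z θ * (curve z θ s : Matrix n n ℂ)) p q =
      ∑ r, (z : Matrix n n ℂ) p r * (Complex.exp (Complex.I * (s * θ r : ℝ)) *
        (Complex.I * θ r)) * star (z : Matrix n n ℂ) r q := by
    rw [coe_curve, gen]
    have : (z * Matrix.diagonal (fun p => Complex.I * (θ p : ℂ)) * star (z : Matrix n n ℂ)) *
      (z * Matrix.diagonal (fun p => Complex.exp (Complex.I * (s * θ p : ℝ))) *
        star (z : Matrix n n ℂ)) = z * (Matrix.diagonal (fun p => Complex.I * (θ p : ℂ)) *
        Matrix.diagonal (fun p => Complex.exp (Complex.I * (s * θ p : ℝ)))) *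
        star (z : Matrix n n ℂ) := by
      simp only [Matrix.mul_assoc]
      rw [← Matrix.mul_assoc (star (z : Matrix n n ℂ)) (z : Matrix n n ℂ), star_mul_self_coe, Matrix.one_mul]
    rw [this, Matrix.diagonal_mul_diagonal, Matrix.mul_apply]
    refine Finset.sum_congr rfl fun r _ => ?_
    rw [Matrix.mul_diagonal]
    ring
  simp_rw [e]
  rw [e2]
  apply HasDerivAt.fun_sum
  intro r _
  apply HasDerivAt.mul_const
  apply HasDerivAt.const_mul
  have h1 : HasDerivAt (fun s : ℝ => Complex.I * ((s * θ r : ℝ) : ℂ)) (Complex.I * θ r) s := by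
    have := (((hasDerivAt_id s).mul_const (θ r)).ofReal_comp).const_mul Complex.I
    simpa using this
  exact h1.cexp

lemma gen_star (z : Matrix.unitaryGroup n ℂ) (θ : n → ℝ) : star (gen z θ) = - gen z θ := by
  unfold gen
  rw [star_mul, star_mul, star_star, Matrix.star_eq_conjTranspose (Matrix.diagonal _),
    Matrix.diagonal_conjTranspose, ← Matrix.mul_assoc]
  have : star (fun p => Complex.I * (θ p : ℂ)) = -(fun p => Complex.I * (θ p : ℂ)) := by
    funext p; simp
  have h2 : Matrix.diagonal (-(fun p => Complex.I * (θ p : ℂ))) =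
      -Matrix.diagonal (fun p => Complex.I * (θ p : ℂ)) := by
    ext a b
    by_cases h : a = b
    · subst h; simp
    · simp [h]
  rw [this, h2, Matrix.mul_neg, Matrix.neg_mul]

lemma gen_trace (z : Matrix.unitaryGroup n ℂ) (θ : n → ℝ) :
    (gen z θ).trace = Complex.I * ((∑ p, θ p : ℝ) : ℂ) := by
  unfold gen
  rw [Matrix.trace_mul_comm, ← Matrix.mul_assoc, star_mul_self_coe, Matrix.one_mul,
    Matrix.trace_diagonal]
  push_cast
  rw [Finset.mul_sum]

end Mat
end HaarConc
end

section
namespace HaarConc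

/-- ambient algebra -/
def Amb {k : ℕ} (N : Fin k → ℕ) := ∀ i, Matrix (Fin (N i)) (Fin (N i)) ℂ

variable {k : ℕ} {N : Fin k → ℕ}

noncomputable instance : Ring (Amb N) := inferInstanceAs (Ring (∀ i, Matrix (Fin (N i)) (Fin (N i)) ℂ))
noncomputable instance : Module ℝ (Amb N) :=
  inferInstanceAs (Module ℝ (∀ i, Matrix (Fin (N i)) (Fin (N i)) ℂ))
instance : IsScalarTower ℝ (Amb N) (Amb N) :=
  inferInstanceAs (IsScalarTower ℝ (∀ i, Matrix (Fin (N i)) (Fin (N i)) ℂ) (∀ i, Matrix (Fin (N i)) (Fin (N i)) ℂ))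
instance : SMulCommClass ℝ (Amb N) (Amb N) :=
  inferInstanceAs (SMulCommClass ℝ (∀ i, Matrix (Fin (N i)) (Fin (N i)) ℂ) (∀ i, Matrix (Fin (N i)) (Fin (N i)) ℂ))
instance : FiniteDimensional ℝ (Amb N) :=
  inferInstanceAs (FiniteDimensional ℝ (∀ i, Matrix (Fin (N i)) (Fin (N i)) ℂ))

/-- squared Frobenius norm -/
noncomputable def fsq {m n : Type*} [Fintype m] [Fintype n] (M : Matrix m n ℂ) : ℝ :=
  ∑ p, ∑ q, ‖M p q‖ ^ 2

/-- inner product core -/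
@[reducible]
noncomputable def ambCore : InnerProductSpace.Core ℝ (Amb N) where
  inner A B := ∑ i, ∑ p, ∑ q, ((starRingEnd ℂ) (A i p q) * B i p q).re
  conj_inner_symm A B := by
    simp only [conj_trivial]
    refine Finset.sum_congr rfl fun i _ => Finset.sum_congr rfl fun p _ =>
      Finset.sum_congr rfl fun q _ => ?_
    simp [Complex.mul_re]; ring
  re_inner_nonneg A := by
    simp only [RCLike.re_to_real]
    refine Finset.sum_nonneg fun i _ => Finset.sum_nonneg fun p _ =>
      Finset.sum_nonneg fun q _ => ?_
    simp [Complex.mul_re]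
    nlinarith [sq_nonneg (A i p q).re, sq_nonneg (A i p q).im]
  add_left A B C := by
    simp only [← Finset.sum_add_distrib]
    refine Finset.sum_congr rfl fun i _ => Finset.sum_congr rfl fun p _ =>
      Finset.sum_congr rfl fun q _ => ?_
    have : (A + B) i p q = A i p q + B i p q := rfl
    rw [this]
    simp [Complex.mul_re]; ring
  smul_left A B r := by
    simp only [Finset.mul_sum]
    refine Finset.sum_congr rfl fun i _ => Finset.sum_congr rfl fun p _ =>
      Finset.sum_congr rfl fun q _ => ?_
    have : (r • A) i p q = r • A i p q := rfl
    rw [this]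
    simp [Complex.mul_re]; ring
  definite A h := by
    have hn : ∀ i p q, 0 ≤ ((starRingEnd ℂ) (A i p q) * A i p q).re := by
      intro i p q
      simp [Complex.mul_re]
      nlinarith [sq_nonneg (A i p q).re, sq_nonneg (A i p q).im]
    funext i
    ext p q
    have h1 := (Finset.sum_eq_zero_iff_of_nonneg (fun i _ => Finset.sum_nonneg fun p _ =>
      Finset.sum_nonneg fun q _ => hn i p q)).1 h i (Finset.mem_univ _)
    have h2 := (Finset.sum_eq_zero_iff_of_nonneg (fun p _ =>
      Finset.sum_nonneg fun q _ => hn i p q)).1 h1 p (Finset.mem_univ _)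
    have h3 := (Finset.sum_eq_zero_iff_of_nonneg (fun q _ => hn i p q)).1 h2 q (Finset.mem_univ _)
    simp [Complex.mul_re] at h3
    have : (0 : Amb N) i p q = 0 := rfl
    rw [this]
    apply Complex.ext
    · simp; nlinarith [sq_nonneg (A i p q).re, sq_nonneg (A i p q).im]
    · simp; nlinarith [sq_nonneg (A i p q).re, sq_nonneg (A i p q).im]

noncomputable instance ambNACG : NormedAddCommGroup (Amb N) :=
  @InnerProductSpace.Core.toNormedAddCommGroup ℝ (Amb N) _ _ _ ambCore

noncomputable instance ambIPS0 : @InnerProductSpace ℝ (Amb N) _ (ambNACG.toSeminormedAddCommGroup) :=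
  @InnerProductSpace.ofCore ℝ (Amb N) _ _ _ ambCore.toCore

lemma amb_inner (A B : Amb N) : inner ℝ A B =
    ∑ i, ∑ p, ∑ q, ((starRingEnd ℂ) (A i p q) * B i p q).re := rfl

lemma amb_normSq (A : Amb N) : ‖A‖ ^ 2 = ∑ i, fsq (A i) := by
  rw [← real_inner_self_eq_norm_sq, amb_inner]
  refine Finset.sum_congr rfl fun i _ => Finset.sum_congr rfl fun p _ =>
      Finset.sum_congr rfl fun q _ => ?_
  rw [← Complex.normSq_eq_norm_sq, ← Complex.normSq_eq_conj_mul_self]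
  simp

lemma fsq_nonneg {m n : Type*} [Fintype m] [Fintype n] (M : Matrix m n ℂ) : 0 ≤ fsq M :=
  Finset.sum_nonneg fun _ _ => Finset.sum_nonneg fun _ _ => by positivity

lemma fsq_mul_le {n : Type*} [Fintype n] (A B : Matrix n n ℂ) : fsq (A * B) ≤ fsq A * fsq B := by
  have h1 : ∀ p q, ‖(A * B) p q‖ ^ 2 ≤ (∑ r, ‖A p r‖ ^ 2) * ∑ r, ‖B r q‖ ^ 2 := by
    intro p q
    rw [Matrix.mul_apply]
    calc ‖∑ r, A p r * B r q‖ ^ 2 ≤ (∑ r, ‖A p r‖ * ‖B r q‖) ^ 2 := by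
          gcongr
          refine (norm_sum_le _ _).trans (le_of_eq ?_)
          simp
      _ ≤ _ := Finset.sum_mul_sq_le_sq_mul_sq _ _ _
  unfold fsq
  calc ∑ p, ∑ q, ‖(A * B) p q‖ ^ 2 ≤ ∑ p, ∑ q, (∑ r, ‖A p r‖ ^ 2) * ∑ r, ‖B r q‖ ^ 2 :=
        Finset.sum_le_sum fun p _ => Finset.sum_le_sum fun q _ => h1 p q
    _ = _ := by
        rw [Finset.sum_mul]
        refine Finset.sum_congr rfl fun p _ => ?_
        rw [← Finset.mul_sum]
        congr 1
        exact Finset.sum_comm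

noncomputable instance ambNR : NormedRing (Amb N) :=
  { (inferInstance : Ring (Amb N)), (inferInstance : NormedAddCommGroup (Amb N)) with
    norm_mul_le := by
      intro A B
      have : ‖A * B‖ ^ 2 ≤ (‖A‖ * ‖B‖) ^ 2 := by
        rw [mul_pow, amb_normSq, amb_normSq, amb_normSq]
        calc ∑ i, fsq ((A * B) i) ≤ ∑ i, fsq (A i) * fsq (B i) :=
              Finset.sum_le_sum fun i _ => fsq_mul_le _ _
          _ ≤ ∑ i, fsq (A i) * ∑ j, fsq (B j) := by
              refine Finset.sum_le_sum fun i _ => ?_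
              refine mul_le_mul_of_nonneg_left ?_ (fsq_nonneg _)
              exact Finset.single_le_sum (f := fun j => fsq (B j)) (fun j _ => fsq_nonneg _) (Finset.mem_univ i)
          _ = _ := by rw [Finset.sum_mul]
      exact abs_le_of_sq_le_sq' this (by positivity) |>.2 }

noncomputable instance ambIPS : InnerProductSpace ℝ (Amb N) := ambIPS0


/-- assembling derivatives -/
lemma amb_hasDerivAt (g : ℝ → Amb N) (g' : Amb N) (s : ℝ)
    (h : ∀ i p q, HasDerivAt (fun s => g s i p q) (g' i p q) s) : HasDerivAt g g' s := by
  let e : (∀ i, Fin (N i) → Fin (N i) → ℂ) →ₗ[ℝ] Amb N :=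
    { toFun := fun A => A, map_add' := fun _ _ => rfl, map_smul' := fun _ _ => rfl }
  let g0 : ℝ → (∀ i, Fin (N i) → Fin (N i) → ℂ) := g
  let g1 : (∀ i, Fin (N i) → Fin (N i) → ℂ) := g'
  have h0 : HasDerivAt g0 g1 s :=
    hasDerivAt_pi.2 fun i => hasDerivAt_pi.2 fun p => hasDerivAt_pi.2 fun q => h i p q
  exact (LinearMap.toContinuousLinearMap e).hasFDerivAt.comp_hasDerivAt s h0

lemma amb_continuous {X : Type*} [TopologicalSpace X] (g : X → Amb N)
    (h : ∀ i p q, Continuous (fun s => g s i p q)) : Continuous g := by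
  let e : (∀ i, Fin (N i) → Fin (N i) → ℂ) →ₗ[ℝ] Amb N :=
    { toFun := fun A => A, map_add' := fun _ _ => rfl, map_smul' := fun _ _ => rfl }
  let g0 : X → (∀ i, Fin (N i) → Fin (N i) → ℂ) := g
  have h0 : Continuous g0 := continuous_pi fun i => continuous_pi fun p => continuous_pi fun q => h i p q
  exact (LinearMap.continuous_of_finiteDimensional e).comp h0

end HaarConc
end

section
set_option linter.unusedSectionVars false

namespace HaarConc
section Mat2
variable {n : Type*} [Fintype n] [DecidableEq n]

lemma fsq_eq_trace (M : Matrix n n ℂ) : ((fsq M : ℝ) : ℂ) = (star M * M).trace := by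
  unfold fsq
  rw [Matrix.trace, Finset.sum_comm]
  push_cast
  refine Finset.sum_congr rfl fun q _ => ?_
  rw [Matrix.diag_apply, Matrix.mul_apply]
  refine Finset.sum_congr rfl fun p _ => ?_
  rw [Matrix.star_apply, Complex.star_def, ← Complex.normSq_eq_conj_mul_self,
    Complex.normSq_eq_norm_sq]
  push_cast; rfl

lemma fsq_mul_left (u : Matrix.unitaryGroup n ℂ) (M : Matrix n n ℂ) :
    fsq ((u : Matrix n n ℂ) * M) = fsq M := by
  have : ((fsq ((u : Matrix n n ℂ) * M) : ℝ) : ℂ) = ((fsq M : ℝ) : ℂ) := by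
    rw [fsq_eq_trace, fsq_eq_trace, star_mul, Matrix.mul_assoc,
      ← Matrix.mul_assoc (star (u : Matrix n n ℂ)), star_mul_self_coe, Matrix.one_mul]
  exact_mod_cast this

lemma fsq_mul_right (u : Matrix.unitaryGroup n ℂ) (M : Matrix n n ℂ) :
    fsq (M * (u : Matrix n n ℂ)) = fsq M := by
  have : ((fsq (M * (u : Matrix n n ℂ)) : ℝ) : ℂ) = ((fsq M : ℝ) : ℂ) := by
    rw [fsq_eq_trace, fsq_eq_trace, star_mul, Matrix.mul_assoc, Matrix.trace_mul_comm]
    simp only [Matrix.mul_assoc]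
    rw [mul_star_self_coe, Matrix.mul_one]
  exact_mod_cast this

lemma coe_inv (u : Matrix.unitaryGroup n ℂ) :
    ((u⁻¹ : Matrix.unitaryGroup n ℂ) : Matrix n n ℂ) = star (u : Matrix n n ℂ) := rfl

noncomputable instance : CompactSpace (Matrix.unitaryGroup n ℂ) := by
  rw [← isCompact_univ_iff, Topology.IsEmbedding.subtypeVal.isCompact_iff]
  have hc : IsCompact (Set.pi Set.univ fun _ : n => Set.pi Set.univ fun _ : n =>
      Metric.closedBall (0 : ℂ) 1) :=
    isCompact_univ_pi fun _ => isCompact_univ_pi fun _ => isCompact_closedBall _ _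
  have hcl : IsClosed {M : Matrix n n ℂ | M * star M = 1} :=
    isClosed_eq (by fun_prop) continuous_const
  refine IsCompact.of_isClosed_subset (s := (Set.pi Set.univ fun _ : n => Set.pi Set.univ fun _ : n =>
      Metric.closedBall (0 : ℂ) 1)) ?_ ?_ ?_
  · exact hc
  · have : (Subtype.val '' (Set.univ : Set (Matrix.unitaryGroup n ℂ))) =
        {M : Matrix n n ℂ | M * star M = 1} := by
      ext M
      simp [Matrix.mem_unitaryGroup_iff]
    rw [this]; exact hcl
  · rintro _ ⟨u, -, rfl⟩
    intro p _ q _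
    simpa using entry_norm_bound_of_unitary u.2 p q

instance : SecondCountableTopology (Matrix n n ℂ) :=
  inferInstanceAs (SecondCountableTopology (n → n → ℂ))

instance : SecondCountableTopology (Matrix.unitaryGroup n ℂ) :=
  Topology.IsEmbedding.subtypeVal.secondCountableTopology


lemma continuous_entry (p q : n) : Continuous fun u : Matrix.unitaryGroup n ℂ =>
    (u : Matrix n n ℂ) p q :=
  (continuous_subtype_val).matrix_elem p q

/-- scale -/
noncomputable def eta (n : Type*) [Fintype n] : ℝ :=
  Real.sqrt (Fintype.card n * (Fintype.card n + 1))

lemma eta_sq : eta n ^ 2 = Fintype.card n * (Fintype.card n + 1) :=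
  Real.sq_sqrt (by positivity)

/-- angles of the base direction -/
noncomputable def th (o : n) : n → ℝ := fun p =>
  eta n * ((if p = o then 1 else 0) - 1 / Fintype.card n)

lemma th_sum (o : n) : ∑ p, th o p = 0 := by
  have : (Fintype.card n : ℝ) ≠ 0 := by
    have : Nonempty n := ⟨o⟩
    exact_mod_cast Fintype.card_ne_zero
  unfold th
  rw [← Finset.mul_sum, Finset.sum_sub_distrib]
  simp [this]

end Mat2

section SetupDef
variable {k : ℕ} {N : Fin k → ℕ}

/-- coercion -/
def cHom (N : Fin k → ℕ) : (∀ i, Matrix.unitaryGroup (Fin (N i)) ℂ) →* Amb N where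
  toFun u := fun i => (u i : Matrix (Fin (N i)) (Fin (N i)) ℂ)
  map_one' := rfl
  map_mul' _ _ := rfl

/-- traceless skew -/
def suSub (N : Fin k → ℕ) : Submodule ℝ (Amb N) where
  carrier := {A | ∀ i, star (A i) = - A i ∧ (A i).trace = 0}
  add_mem' := by
    intro A B hA hB i
    have : (A + B) i = A i + B i := rfl
    rw [this, star_add, (hA i).1, (hB i).1, Matrix.trace_add, (hA i).2, (hB i).2]
    constructor
    · abel
    · simp
  zero_mem' := by
    intro i
    have : (0 : Amb N) i = 0 := rfl
    rw [this]; simp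
  smul_mem' := by
    intro r A hA i
    have : (r • A) i = r • A i := rfl
    rw [this, star_smul, (hA i).1, Matrix.trace_smul, (hA i).2]
    simp

/-- componentwise curve -/
noncomputable def pcurve (z : ∀ i, Matrix.unitaryGroup (Fin (N i)) ℂ) (θ : ∀ i, Fin (N i) → ℝ) (s : ℝ) :
    ∀ i, Matrix.unitaryGroup (Fin (N i)) ℂ := fun i => curve (z i) (θ i) s

/-- componentwise generator -/
noncomputable def pgen (z : ∀ i, Matrix.unitaryGroup (Fin (N i)) ℂ) (θ : ∀ i, Fin (N i) → ℝ) : Amb N :=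
  fun i => gen (z i) (θ i)

lemma pcurve_zero (z : ∀ i, Matrix.unitaryGroup (Fin (N i)) ℂ) (θ : ∀ i, Fin (N i) → ℝ) :
    pcurve z θ 0 = 1 := by
  funext i; exact curve_zero _ _

lemma pcurve_deriv (z : ∀ i, Matrix.unitaryGroup (Fin (N i)) ℂ) (θ : ∀ i, Fin (N i) → ℝ) (s : ℝ) :
    HasDerivAt (fun s => cHom N (pcurve z θ s)) (pgen z θ * cHom N (pcurve z θ s)) s := by
  apply amb_hasDerivAt
  intro i p q
  exact hasDerivAt_curve (z i) (θ i) s p q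

lemma pgen_mem (z : ∀ i, Matrix.unitaryGroup (Fin (N i)) ℂ) (θ : ∀ i, Fin (N i) → ℝ)
    (h : ∀ i, ∑ p, θ i p = 0) : pgen z θ ∈ suSub N := by
  intro i
  refine ⟨gen_star _ _, ?_⟩
  have := gen_trace (z i) (θ i)
  rw [h i] at this
  rw [Complex.ofReal_zero, mul_zero] at this
  exact this

/-- the concrete setup -/
noncomputable def mkSetup (o : ∀ i, Fin (N i)) : Setup (Amb N) (∀ i, Matrix.unitaryGroup (Fin (N i)) ℂ) where
  c := cHom N
  cont := amb_continuous _ fun i p q => (continuous_entry p q).comp (continuous_apply i)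
  isoL u V := by
    have : ‖cHom N u * V‖ ^ 2 = ‖V‖ ^ 2 := by
      rw [amb_normSq, amb_normSq]
      exact Finset.sum_congr rfl fun i _ => fsq_mul_left (u i) (V i)
    exact (sq_eq_sq₀ (norm_nonneg _) (norm_nonneg _)).1 this
  isoR u V := by
    have : ‖V * cHom N u‖ ^ 2 = ‖V‖ ^ 2 := by
      rw [amb_normSq, amb_normSq]
      exact Finset.sum_congr rfl fun i _ => fsq_mul_right (u i) (V i)
    exact (sq_eq_sq₀ (norm_nonneg _) (norm_nonneg _)).1 this
  su := suSub N
  conj u A hA := by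
    intro i
    have : (cHom N u * A * cHom N u⁻¹) i = (u i : Matrix (Fin (N i)) (Fin (N i)) ℂ) * A i *
      star (u i : Matrix (Fin (N i)) (Fin (N i)) ℂ) := rfl
    rw [this]
    constructor
    · rw [star_mul, star_mul, star_star, (hA i).1]
      simp [Matrix.mul_assoc]
    · rw [Matrix.trace_mul_comm, ← Matrix.mul_assoc, star_mul_self_coe, Matrix.one_mul, (hA i).2]
  oneParam A hA := by
    choose z θ h using fun i => diag_skew (A i) (hA i).1
    refine ⟨pcurve z θ, pcurve_zero _ _, fun s => ?_⟩
    have : A = pgen z θ := by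
      funext i; exact h i
    rw [this]
    exact pcurve_deriv z θ s
  K := pgen 1 fun i => th (o i)
  hK := pgen_mem _ _ fun i => th_sum _
  D := pcurve 1 fun i => th (o i)
  D0 := pcurve_zero _ _
  hD := pcurve_deriv _ _

end SetupDef
end HaarConc
end

section
set_option linter.unusedSectionVars false

namespace HaarConc
section Mom
variable {n : Type*} [Fintype n] [DecidableEq n]

/-- a two-level reflection -/
noncomputable def twoM (p q : n) (c s : ℝ) : Matrix n n ℂ :=
  1 + (Matrix.single p p ((c : ℂ) - 1) + Matrix.single p q (s : ℂ) + Matrix.single q p (s : ℂ) +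
    Matrix.single q q (-(c : ℂ) - 1))

lemma twoM_row_p {p q : n} (hpq : p ≠ q) (c s : ℝ) (X : Matrix n n ℂ) (r : n) :
    (twoM p q c s * X) p r = c * X p r + s * X q r := by
  unfold twoM
  simp [Matrix.add_mul, hpq]
  ring

lemma twoM_row_q {p q : n} (hpq : p ≠ q) (c s : ℝ) (X : Matrix n n ℂ) (r : n) :
    (twoM p q c s * X) q r = s * X p r - c * X q r := by
  unfold twoM
  simp [Matrix.add_mul, hpq.symm]
  ring

lemma twoM_row_ne {p q i : n} (hp : i ≠ p) (hq : i ≠ q) (c s : ℝ) (X : Matrix n n ℂ) (r : n) :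
    (twoM p q c s * X) i r = X i r := by
  unfold twoM
  simp [Matrix.add_mul, hp, hq]

lemma twoM_mem {p q : n} (hpq : p ≠ q) (c s : ℝ) (hcs : c ^ 2 + s ^ 2 = 1) :
    twoM p q c s ∈ Matrix.unitaryGroup n ℂ := by
  have hs : star (twoM p q c s) = twoM p q c s := by
    unfold twoM
    simp [Matrix.star_eq_conjTranspose]
    abel
  have hcs' : (c : ℂ) ^ 2 + (s : ℂ) ^ 2 = 1 := by exact_mod_cast hcs
  rw [Matrix.mem_unitaryGroup_iff, hs]
  have key : twoM p q c s * (twoM p q c s * 1) = 1 := by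
    ext i j
    by_cases hp : i = p
    · subst hp
      rw [twoM_row_p hpq, twoM_row_p hpq, twoM_row_q hpq]
      linear_combination (1 : Matrix n n ℂ) i j * hcs'
    · by_cases hq : i = q
      · subst hq
        rw [twoM_row_q hpq, twoM_row_p hpq, twoM_row_q hpq]
        linear_combination (1 : Matrix n n ℂ) i j * hcs'
      · rw [twoM_row_ne hp hq, twoM_row_ne hp hq]
  simpa using key

variable [MeasurableSpace (Matrix.unitaryGroup n ℂ)] [BorelSpace (Matrix.unitaryGroup n ℂ)]
  (μ : Measure (Matrix.unitaryGroup n ℂ)) [IsProbabilityMeasure μ] [μ.IsMulLeftInvariant]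

/-- coordinates -/
def co (o p : n) (w : Matrix.unitaryGroup n ℂ) : ℂ := (w : Matrix n n ℂ) p o

/-- squared coordinates -/
noncomputable def sq (o p : n) (w : Matrix.unitaryGroup n ℂ) : ℝ := Complex.normSq (co o p w)

@[fun_prop]
lemma co_cont (o p : n) : Continuous (co o p) := continuous_entry p o

@[fun_prop]
lemma sq_cont (o p : n) : Continuous (sq o p) := Complex.continuous_normSq.comp (co_cont o p)

lemma sq_sum (o : n) (w : Matrix.unitaryGroup n ℂ) : ∑ p, sq o p w = 1 := by
  have h := congrFun (congrFun (star_mul_self_coe w) o) o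
  rw [Matrix.mul_apply, Matrix.one_apply_eq] at h
  have : ((∑ p, sq o p w : ℝ) : ℂ) = 1 := by
    rw [← h]
    push_cast
    refine Finset.sum_congr rfl fun p _ => ?_
    rw [sq, Complex.normSq_eq_conj_mul_self]; rfl
  exact_mod_cast this

lemma integ {F : Matrix.unitaryGroup n ℂ → ℝ} (hF : Continuous F) : Integrable F μ :=
  Setup.integrable_of_continuous μ hF

/-- invariance under two-level rotations -/
lemma two_inv {p q : n} (hpq : p ≠ q) (o : n) (c s : ℝ) (hcs : c ^ 2 + s ^ 2 = 1) (F : ℂ → ℝ) :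
    ∫ w, F (co o p w) ∂μ = ∫ w, F (c * co o p w + s * co o q w) ∂μ := by
  rw [← integral_mul_left_eq_self _ (⟨_, twoM_mem hpq c s hcs⟩ : Matrix.unitaryGroup n ℂ)]
  refine integral_congr_ae (Filter.Eventually.of_forall fun w => ?_)
  simp only
  congr 1
  exact twoM_row_p hpq c s _ _

/-- invariance under phases -/
lemma phase_inv {p q : n} (hpq : p ≠ q) (o : n) (t : ℝ) (F : ℂ → ℂ → ℝ) :
    ∫ w, F (co o p w) (co o q w) ∂μ =
      ∫ w, F (co o p w) (Complex.exp (Complex.I * t) * co o q w) ∂μ := by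
  rw [← integral_mul_left_eq_self _ (dg (fun r => if r = q then t else 0))]
  refine integral_congr_ae (Filter.Eventually.of_forall fun w => ?_)
  simp only
  congr 1
  · unfold co
    rw [Matrix.UnitaryGroup.mul_val, coe_dg, Matrix.diagonal_mul]
    simp [hpq]
  · unfold co
    rw [Matrix.UnitaryGroup.mul_val, coe_dg, Matrix.diagonal_mul]
    simp

lemma m2_eq {p q : n} (hpq : p ≠ q) (o : n) : ∫ w, sq o p w ∂μ = ∫ w, sq o q w ∂μ := by
  have := two_inv μ hpq o 0 1 (by norm_num) Complex.normSq
  simpa [sq] using this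

lemma m4_eq {p q : n} (hpq : p ≠ q) (o : n) :
    ∫ w, sq o p w ^ 2 ∂μ = ∫ w, sq o q w ^ 2 ∂μ := by
  have := two_inv μ hpq o 0 1 (by norm_num) (fun z => Complex.normSq z ^ 2)
  simpa [sq] using this

/-- real part of the product -/
noncomputable def rp (o p q : n) (w : Matrix.unitaryGroup n ℂ) : ℝ :=
  (co o p w * (starRingEnd ℂ) (co o q w)).re

@[fun_prop]
lemma rp_cont (o p q : n) : Continuous (rp o p q) := by
  unfold rp
  exact Complex.continuous_re.comp ((co_cont o p).mul (Complex.continuous_conj.comp (co_cont o q)))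

lemma rp_sq {p q : n} (hpq : p ≠ q) (o : n) :
    ∫ w, rp o p q w ^ 2 ∂μ = (∫ w, sq o p w * sq o q w ∂μ) / 2 := by
  have h := phase_inv μ hpq o (Real.pi / 2) (fun z y => ((z * (starRingEnd ℂ) y).re) ^ 2)
  have h2 : ∫ w, sq o p w * sq o q w ∂μ = ∫ w, rp o p q w ^ 2 ∂μ + ∫ w, rp o p q w ^ 2 ∂μ := by
    have e : ∀ w : Matrix.unitaryGroup n ℂ,
        ((co o p w * (starRingEnd ℂ) (Complex.exp (Complex.I * (Real.pi / 2 : ℝ)) * co o q w)).re) ^ 2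
        = sq o p w * sq o q w - rp o p q w ^ 2 := by
      intro w
      have : Complex.exp (Complex.I * (Real.pi / 2 : ℝ)) = Complex.I := by
        rw [mul_comm]; push_cast; exact Complex.exp_pi_div_two_mul_I
      rw [this]
      unfold sq rp
      simp [Complex.normSq_apply, Complex.mul_re, Complex.mul_im]
      ring
    simp_rw [e] at h
    rw [integral_sub (integ μ (by fun_prop)) (integ μ (by fun_prop))] at h
    have : ∫ w, rp o p q w ^ 2 ∂μ = ∫ w, ((co o p w * (starRingEnd ℂ) (co o q w)).re) ^ 2 ∂μ := rfl
    linarith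
  linarith

lemma rp_odd {p q : n} (hpq : p ≠ q) (o : n) (a b : ℝ) :
    ∫ w, (a * sq o p w + b * sq o q w) * rp o p q w ∂μ = 0 := by
  have h := phase_inv μ hpq o Real.pi (fun z y => (a * Complex.normSq z + b * Complex.normSq y) *
    ((z * (starRingEnd ℂ) y).re))
  have e : Complex.exp (Complex.I * Real.pi) = -1 := by
    rw [mul_comm]; exact Complex.exp_pi_mul_I
  simp only [e, neg_mul, one_mul, map_neg, Complex.normSq_neg, mul_neg, Complex.neg_re] at h
  rw [integral_neg] at h
  have : ∫ w, (a * sq o p w + b * sq o q w) * rp o p q w ∂μ =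
    ∫ w, (a * Complex.normSq (co o p w) + b * Complex.normSq (co o q w)) *
    ((co o p w * (starRingEnd ℂ) (co o q w)).re) ∂μ := rfl
  linarith

lemma m22_eq {p q : n} (hpq : p ≠ q) (o : n) :
    ∫ w, sq o p w * sq o q w ∂μ = (∫ w, sq o p w ^ 2 ∂μ) / 2 := by
  have h0 : Real.sqrt 2 ^ 2 = 2 := Real.sq_sqrt (by norm_num)
  have h := two_inv μ hpq o (Real.sqrt 2 / 2) (Real.sqrt 2 / 2) (by rw [div_pow, h0]; norm_num)
    (fun z => Complex.normSq z ^ 2)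
  have e : ∀ w : Matrix.unitaryGroup n ℂ, Complex.normSq (((Real.sqrt 2 / 2 : ℝ) : ℂ) * co o p w +
      ((Real.sqrt 2 / 2 : ℝ) : ℂ) * co o q w) ^ 2 = (sq o p w ^ 2 / 4 + sq o q w ^ 2 / 4 +
        sq o p w * sq o q w / 2 + rp o p q w ^ 2) +
        ((1:ℝ) * sq o p w + (1:ℝ) * sq o q w) * rp o p q w := by
    intro w
    have e1 : Complex.normSq (((Real.sqrt 2 / 2 : ℝ) : ℂ) * co o p w +
      ((Real.sqrt 2 / 2 : ℝ) : ℂ) * co o q w) = (sq o p w + sq o q w) / 2 + rp o p q w := by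
      rw [← mul_add, Complex.normSq_mul, Complex.normSq_ofReal, Complex.normSq_add]
      have : Real.sqrt 2 / 2 * (Real.sqrt 2 / 2) = 1 / 2 := by nlinarith
      rw [this]
      unfold sq rp
      ring
    rw [e1]; ring
  simp_rw [e] at h
  rw [integral_add (integ μ (by fun_prop)) (integ μ (by fun_prop)), rp_odd μ hpq,
    integral_add (integ μ (by fun_prop)) (integ μ (by fun_prop)),
    integral_add (integ μ (by fun_prop)) (integ μ (by fun_prop)),
    integral_add (integ μ (by fun_prop)) (integ μ (by fun_prop)), rp_sq μ hpq,
    integral_div, integral_div, integral_div] at h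
  have h4 := m4_eq μ hpq o
  have : ∫ w, sq o p w ^ 2 ∂μ = ∫ w, Complex.normSq (co o p w) ^ 2 ∂μ := rfl
  linarith

lemma m2_val (o p : n) : ∫ w, sq o p w ∂μ = 1 / Fintype.card n := by
  have h : ∑ q, ∫ w, sq o q w ∂μ = 1 := by
    rw [← integral_finsetSum _ fun q _ => integ μ (by fun_prop)]
    simp [sq_sum]
  have h1 : ∀ q, ∫ w, sq o q w ∂μ = ∫ w, sq o p w ∂μ := by
    intro q
    by_cases hq : q = p
    · rw [hq]
    · exact m2_eq μ hq o
  simp_rw [h1] at h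
  simp at h
  have hc : (Fintype.card n : ℝ) ≠ 0 := by
    intro h0; rw [h0] at h; simp at h
  field_simp
  linarith

lemma m4_quad (o r : n) (θ : n → ℝ) : ∫ w, (∑ p, θ p * sq o p w) ^ 2 ∂μ =
    (∫ w, sq o r w ^ 2 ∂μ) / 2 * (∑ p, θ p ^ 2 + (∑ p, θ p) ^ 2) := by
  set m := ∫ w, sq o r w ^ 2 ∂μ with hm
  have hm' : ∀ p, ∫ w, sq o p w ^ 2 ∂μ = m := by
    intro q
    by_cases hq : q = r
    · rw [hq]
    · exact m4_eq μ hq o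
  have e : ∀ w : Matrix.unitaryGroup n ℂ, (∑ p, θ p * sq o p w) ^ 2 =
      ∑ p, ∑ q, θ p * θ q * (sq o p w * sq o q w) := by
    intro w
    rw [pow_two, Finset.sum_mul_sum]
    refine Finset.sum_congr rfl fun p _ => Finset.sum_congr rfl fun q _ => ?_
    ring
  simp_rw [e]
  rw [integral_finsetSum _ fun q _ => integ μ (by fun_prop)]
  have e2 : ∀ p q, ∫ w, θ p * θ q * (sq o p w * sq o q w) ∂μ =
      m / 2 * (θ p * θ q + if p = q then θ p ^ 2 else 0) := by
    intro p q
    rw [integral_const_mul]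
    by_cases h : p = q
    · subst h
      have := hm' p
      simp_rw [pow_two] at this
      rw [this]
      simp
      ring
    · rw [m22_eq μ h, hm']
      simp [h]
      ring
  have e3 : ∀ p, ∫ w, ∑ q, θ p * θ q * (sq o p w * sq o q w) ∂μ =
      ∑ q, m / 2 * (θ p * θ q + if p = q then θ p ^ 2 else 0) := by
    intro p
    rw [integral_finsetSum _ fun q _ => integ μ (by fun_prop)]
    exact Finset.sum_congr rfl fun q _ => e2 p q
  simp_rw [e3, ← Finset.mul_sum, Finset.sum_add_distrib]
  rw [pow_two (∑ p, θ p), Finset.sum_mul_sum]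
  simp only [Finset.sum_ite_eq, Finset.mem_univ, if_true, ← Finset.mul_sum]
  ring

lemma m4_val (o r : n) : (∫ w, sq o r w ^ 2 ∂μ) / 2 = 1 / (Fintype.card n * (Fintype.card n + 1)) := by
  have h := m4_quad μ o r (fun _ => 1)
  simp [sq_sum] at h
  have hc : (Fintype.card n : ℝ) ≠ 0 := by
    intro h0; rw [h0] at h; simp at h
  rw [eq_div_iff (by positivity)]
  linarith

end Mom
end HaarConc
end

section
set_option linter.unusedSectionVars false

namespace HaarConc
section Mom2
variable {n : Type*} [Fintype n] [DecidableEq n]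

/-- conjugated matrix -/
noncomputable def cj (A : Matrix n n ℂ) (w : Matrix.unitaryGroup n ℂ) : Matrix n n ℂ :=
  star (w : Matrix n n ℂ) * A * w

lemma cj_cont (A : Matrix n n ℂ) : Continuous (cj A) := by
  unfold cj
  have : Continuous fun w : Matrix.unitaryGroup n ℂ => (w : Matrix n n ℂ) := continuous_subtype_val
  fun_prop

@[fun_prop]
lemma cj_entry_cont (A : Matrix n n ℂ) (p q : n) : Continuous fun w => cj A w p q :=
  (cj_cont A).matrix_elem p q

lemma cj_star {A : Matrix n n ℂ} (hA : star A = -A) (w : Matrix.unitaryGroup n ℂ) :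
    star (cj A w) = - cj A w := by
  unfold cj
  rw [star_mul, star_mul, star_star, hA]
  simp [Matrix.mul_assoc]

lemma cj_gen (z : Matrix.unitaryGroup n ℂ) (θ : n → ℝ) (w : Matrix.unitaryGroup n ℂ) :
    cj (gen z θ) w = cj (Matrix.diagonal fun p => Complex.I * (θ p : ℂ)) (z⁻¹ * w) := by
  unfold cj gen
  rw [Matrix.UnitaryGroup.mul_val, coe_inv, star_mul, star_star]
  simp only [Matrix.mul_assoc]

lemma cj_diag_oo (θ : n → ℝ) (o : n) (y : Matrix.unitaryGroup n ℂ) :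
    cj (Matrix.diagonal fun p => Complex.I * (θ p : ℂ)) y o o =
      Complex.I * ((∑ p, θ p * sq o p y : ℝ) : ℂ) := by
  unfold cj
  rw [Matrix.mul_apply]
  push_cast
  rw [Finset.mul_sum]
  refine Finset.sum_congr rfl fun p _ => ?_
  rw [Matrix.mul_diagonal, sq, Complex.normSq_eq_conj_mul_self, Matrix.star_apply]
  unfold co
  simp only [Complex.star_def]
  ring

lemma row_sq (M : Matrix n n ℂ) (o : n) :
    ((∑ b, ‖M o b‖ ^ 2 : ℝ) : ℂ) = (M * star M) o o := by
  rw [Matrix.mul_apply]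
  push_cast
  refine Finset.sum_congr rfl fun b _ => ?_
  rw [Matrix.star_apply, Complex.star_def, mul_comm, ← Complex.normSq_eq_conj_mul_self,
    Complex.normSq_eq_norm_sq]
  push_cast; rfl

lemma cj_diag_row (θ : n → ℝ) (o : n) (y : Matrix.unitaryGroup n ℂ) :
    ∑ b, ‖cj (Matrix.diagonal fun p => Complex.I * (θ p : ℂ)) y o b‖ ^ 2 =
      ∑ p, θ p ^ 2 * sq o p y := by
  have : ((∑ b, ‖cj (Matrix.diagonal fun p => Complex.I * (θ p : ℂ)) y o b‖ ^ 2 : ℝ) : ℂ) =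
      ((∑ p, θ p ^ 2 * sq o p y : ℝ) : ℂ) := by
    rw [row_sq]
    have e : cj (Matrix.diagonal fun p => Complex.I * (θ p : ℂ)) y *
        star (cj (Matrix.diagonal fun p => Complex.I * (θ p : ℂ)) y) =
        star (y : Matrix n n ℂ) * (Matrix.diagonal fun p => (θ p : ℂ) ^ 2) * y := by
      unfold cj
      rw [star_mul, star_mul, star_star]
      simp only [Matrix.mul_assoc]
      rw [← Matrix.mul_assoc (y : Matrix n n ℂ) (star (y : Matrix n n ℂ)), mul_star_self_coe,
        Matrix.one_mul, Matrix.star_eq_conjTranspose (Matrix.diagonal _),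
        Matrix.diagonal_conjTranspose, ← Matrix.mul_assoc (Matrix.diagonal _) (Matrix.diagonal _),
        Matrix.diagonal_mul_diagonal]
      congr 3
      ext p
      simp only [Pi.star_apply, star_mul', Complex.star_def, Complex.conj_I, Complex.conj_ofReal]
      linear_combination (-(θ p : ℂ) ^ 2) * Complex.I_sq
    rw [e, Matrix.mul_apply]
    push_cast
    refine Finset.sum_congr rfl fun p _ => ?_
    rw [Matrix.mul_diagonal, sq, Complex.normSq_eq_conj_mul_self, Matrix.star_apply]
    unfold co
    simp only [Complex.star_def]
    ring
  exact_mod_cast this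

lemma fsq_gen (z : Matrix.unitaryGroup n ℂ) (θ : n → ℝ) : fsq (gen z θ) = ∑ p, θ p ^ 2 := by
  unfold gen
  have : star (z : Matrix n n ℂ) = ((z⁻¹ : Matrix.unitaryGroup n ℂ) : Matrix n n ℂ) := rfl
  rw [this, fsq_mul_right, fsq_mul_left]
  unfold fsq
  refine Finset.sum_congr rfl fun p _ => ?_
  rw [Finset.sum_eq_single p]
  · simp
  · intro b _ hb
    simp [Matrix.diagonal_apply_ne' _ hb]
  · simp

variable [MeasurableSpace (Matrix.unitaryGroup n ℂ)] [BorelSpace (Matrix.unitaryGroup n ℂ)]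
  (μ : Measure (Matrix.unitaryGroup n ℂ)) [IsProbabilityMeasure μ] [μ.IsMulLeftInvariant]

lemma traceless_gen {A : Matrix n n ℂ} (hA : star A = -A) (ht : A.trace = 0) :
    ∃ (z : Matrix.unitaryGroup n ℂ) (θ : n → ℝ), A = gen z θ ∧ ∑ p, θ p = 0 := by
  obtain ⟨z, θ, h⟩ := diag_skew A hA
  refine ⟨z, θ, h, ?_⟩
  have := gen_trace z θ
  rw [gen, ← h, ht] at this
  have h3 : ((∑ p, θ p : ℝ) : ℂ) = 0 := by
    rcases mul_eq_zero.1 this.symm with h | h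
    · exact absurd h Complex.I_ne_zero
    · exact h
  exact_mod_cast h3

lemma cj_mean {A : Matrix n n ℂ} (hA : star A = -A) (ht : A.trace = 0) (o : n) :
    ∫ w, (cj A w o o).im ∂μ = 0 := by
  obtain ⟨z, θ, rfl, hθ⟩ := traceless_gen hA ht
  simp_rw [cj_gen]
  rw [integral_mul_left_eq_self (fun w => (cj (Matrix.diagonal fun p => Complex.I * (θ p : ℂ)) w o o).im)]
  simp_rw [cj_diag_oo]
  simp only [Complex.I_mul_im, Complex.ofReal_re]
  rw [integral_finsetSum _ fun q _ => integ μ (by fun_prop)]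
  simp_rw [integral_const_mul, m2_val]
  rw [← Finset.sum_mul, hθ, zero_mul]

lemma cj_var {A : Matrix n n ℂ} (hA : star A = -A) (ht : A.trace = 0) (o : n) :
    ∫ w, (cj A w o o).im ^ 2 ∂μ = fsq A / (Fintype.card n * (Fintype.card n + 1)) := by
  obtain ⟨z, θ, rfl, hθ⟩ := traceless_gen hA ht
  simp_rw [cj_gen]
  rw [integral_mul_left_eq_self (fun w => (cj (Matrix.diagonal fun p => Complex.I * (θ p : ℂ)) w o o).im ^ 2)]
  simp_rw [cj_diag_oo]
  simp only [Complex.I_mul_im, Complex.ofReal_re]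
  rw [m4_quad μ o o, m4_val, hθ, fsq_gen]
  ring

lemma cj_norm_oo {A : Matrix n n ℂ} (hA : star A = -A) (o : n) (w : Matrix.unitaryGroup n ℂ) :
    ‖cj A w o o‖ ^ 2 = (cj A w o o).im ^ 2 := by
  have h := congrFun (congrFun (cj_star hA w) o) o
  rw [Matrix.star_apply, Matrix.neg_apply] at h
  have h2 := congrArg Complex.re h
  simp at h2
  rw [← Complex.normSq_eq_norm_sq, Complex.normSq_apply]
  have : (cj A w o o).re = 0 := by linarith
  rw [this]; ring

lemma cj_row {A : Matrix n n ℂ} (hA : star A = -A) (ht : A.trace = 0) (o : n) :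
    ∫ w, ∑ b, ‖cj A w o b‖ ^ 2 ∂μ = fsq A / Fintype.card n := by
  obtain ⟨z, θ, rfl, hθ⟩ := traceless_gen hA ht
  simp_rw [cj_gen]
  rw [integral_mul_left_eq_self (fun w => ∑ b, ‖cj (Matrix.diagonal fun p => Complex.I * (θ p : ℂ)) w o b‖ ^ 2)]
  simp_rw [cj_diag_row]
  rw [integral_finsetSum _ fun q _ => integ μ (by fun_prop)]
  simp_rw [integral_const_mul, m2_val]
  rw [← Finset.sum_mul, fsq_gen]
  ring

/-- pointwise contraction identity -/
lemma contr_pt {A : Matrix n n ℂ} (hA : star A = -A) (o : n) (ε : ℝ) (w : Matrix.unitaryGroup n ℂ) :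
    fsq ((2⁻¹ : ℝ) • (A + ((w * curve 1 (th o) ε * w⁻¹ : Matrix.unitaryGroup n ℂ) : Matrix n n ℂ) * A *
      (((w * curve 1 (th o) ε * w⁻¹)⁻¹ : Matrix.unitaryGroup n ℂ) : Matrix n n ℂ))) =
    fsq A - (1 - Real.cos (ε * eta n)) * (∑ b, ‖cj A w o b‖ ^ 2 - ‖cj A w o o‖ ^ 2) := by
  set D : Matrix.unitaryGroup n ℂ := curve 1 (th o) ε with hD
  set d : n → ℂ := fun p => Complex.exp (Complex.I * (ε * th o p : ℝ)) with hd
  have hDd : (D : Matrix n n ℂ) = Matrix.diagonal d := by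
    rw [hD, coe_curve]; simp [hd]
  set B := cj A w with hB
  have hAB : A = (w : Matrix n n ℂ) * B * star (w : Matrix n n ℂ) := by
    rw [hB]; unfold cj
    simp only [Matrix.mul_assoc]
    rw [mul_star_self_coe, Matrix.mul_one, ← Matrix.mul_assoc, mul_star_self_coe, Matrix.one_mul]
  have hfB : fsq A = fsq B := by
    rw [hB]; unfold cj
    rw [fsq_mul_right, ← coe_inv, fsq_mul_left]
  have e1 : fsq ((2⁻¹ : ℝ) • (A + ((w * D * w⁻¹ : Matrix.unitaryGroup n ℂ) : Matrix n n ℂ) * A *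
      (((w * D * w⁻¹)⁻¹ : Matrix.unitaryGroup n ℂ) : Matrix n n ℂ))) =
      fsq ((2⁻¹ : ℝ) • (B * (D : Matrix n n ℂ) + (D : Matrix n n ℂ) * B)) := by
    rw [← fsq_mul_right (w * D), ← fsq_mul_left (w⁻¹)]
    congr 1
    rw [Matrix.smul_mul, Matrix.mul_smul]
    congr 1
    rw [Matrix.add_mul, Matrix.mul_add]
    congr 1
    · rw [hB]; unfold cj
      simp only [Matrix.UnitaryGroup.mul_val, coe_inv, Matrix.mul_assoc]
    · rw [hB]; unfold cj
      have : (((w * D * w⁻¹)⁻¹ : Matrix.unitaryGroup n ℂ) : Matrix n n ℂ) * ((w * D : Matrix.unitaryGroup n ℂ) : Matrix n n ℂ)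
        = (w : Matrix n n ℂ) := by
        rw [← Matrix.UnitaryGroup.mul_val]
        congr 1
        group
      rw [Matrix.mul_assoc _ _ ((w * D : Matrix.unitaryGroup n ℂ) : Matrix n n ℂ), this]
      simp only [Matrix.UnitaryGroup.mul_val, coe_inv, Matrix.mul_assoc]
      rw [← Matrix.mul_assoc (star (w : Matrix n n ℂ)) (w : Matrix n n ℂ), star_mul_self_coe,
        Matrix.one_mul]
  rw [e1, hfB]
  have hent : ∀ b c, ((2⁻¹ : ℝ) • (B * (D : Matrix n n ℂ) + (D : Matrix n n ℂ) * B)) b c = ((d b + d c) / 2) * B b c := by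
    intro b c
    rw [hDd, Matrix.smul_apply, Matrix.add_apply, Matrix.mul_diagonal, Matrix.diagonal_mul,
      Complex.real_smul]
    push_cast; ring
  have hd1 : ∀ b, ‖d b‖ = 1 := by
    intro b
    rw [hd]; simp only
    rw [mul_comm]; exact Complex.norm_exp_ofReal_mul_I _
  have hdne : ∀ b, b ≠ o → d b = Complex.exp (Complex.I * (-(ε * eta n / Fintype.card n) : ℝ)) := by
    intro b hb
    simp only [hd, th, if_neg hb]
    congr 3
    ring
  have hdo : d o = Complex.exp (Complex.I * (-(ε * eta n / Fintype.card n) : ℝ)) *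
      Complex.exp ((ε * eta n : ℝ) * Complex.I) := by
    simp only [hd, th, if_true]
    rw [← Complex.exp_add]
    congr 1
    push_cast; ring
  have hsum : ∀ b, b ≠ o → ‖(d o + d b) / 2‖ ^ 2 = 1 - (1 - Real.cos (ε * eta n)) / 2 := by
    intro b hb
    have : d o + d b = d b * (1 + Complex.exp ((ε * eta n : ℝ) * Complex.I)) := by
      rw [hdo, hdne b hb]; ring
    rw [this, norm_div, norm_mul, hd1, one_mul, div_pow, ← Complex.normSq_eq_norm_sq,
      Complex.normSq_apply]
    simp only [Complex.add_re, Complex.one_re, Complex.add_im, Complex.one_im,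
      Complex.exp_ofReal_mul_I_re, Complex.exp_ofReal_mul_I_im]
    have := Real.sin_sq_add_cos_sq (ε * eta n)
    norm_num
    nlinarith
  have hBs : ∀ b, ‖B b o‖ = ‖B o b‖ := by
    intro b
    have h := congrFun (congrFun (cj_star hA w) b) o
    rw [Matrix.star_apply, Matrix.neg_apply] at h
    rw [← hB] at h
    have := congrArg norm h
    rw [norm_star, norm_neg] at this
    exact this.symm
  -- entrywise
  set κ := (1 - Real.cos (ε * eta n)) / 2 with hκ
  have hpt : ∀ b c, ‖((2⁻¹ : ℝ) • (B * (D : Matrix n n ℂ) + (D : Matrix n n ℂ) * B)) b c‖ ^ 2 = ‖B b c‖ ^ 2 -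
      κ * ((if b = o then ‖B o c‖ ^ 2 else 0) + (if c = o then ‖B o b‖ ^ 2 else 0)
        - (if b = o then (if c = o then 2 * ‖B o o‖ ^ 2 else 0) else 0)) := by
    intro b c
    rw [hent, norm_mul, mul_pow]
    by_cases hb : b = o
    · by_cases hc : c = o
      · subst hb; subst hc
        have : (d c + d c) / 2 = d c := by ring
        rw [this, hd1]
        simp
        ring
      · subst hb
        rw [hsum c hc]
        simp [hc]
        ring
    · by_cases hc : c = o
      · subst hc
        rw [add_comm, hsum b hb, hBs]
        simp [hb]
        ring
      · have : (d b + d c) / 2 = d b := by rw [hdne b hb, hdne c hc]; ring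
        rw [this, hd1]
        simp [hb, hc]
  unfold fsq
  simp_rw [hpt, Finset.sum_sub_distrib, ← Finset.mul_sum, Finset.sum_sub_distrib,
    Finset.sum_add_distrib]
  simp
  rw [hκ]
  ring

lemma contr_int {A : Matrix n n ℂ} (hA : star A = -A) (ht : A.trace = 0) (o : n) (ε : ℝ) :
    ∫ w, fsq ((2⁻¹ : ℝ) • (A + ((w * curve 1 (th o) ε * w⁻¹ : Matrix.unitaryGroup n ℂ) : Matrix n n ℂ) * A *
      (((w * curve 1 (th o) ε * w⁻¹)⁻¹ : Matrix.unitaryGroup n ℂ) : Matrix n n ℂ))) ∂μ =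
    (1 - (1 - Real.cos (ε * eta n)) / (Fintype.card n + 1)) * fsq A := by
  simp_rw [contr_pt hA, cj_norm_oo hA]
  rw [integral_sub (integrable_const _) (integ μ (by fun_prop)), integral_const_mul,
    integral_sub (integ μ (by fun_prop)) (integ μ (by fun_prop)), cj_row μ hA ht, cj_var μ hA ht]
  have hc : (Fintype.card n : ℝ) ≠ 0 := by
    have : Nonempty n := ⟨o⟩
    exact_mod_cast Fintype.card_ne_zero
  simp
  field_simp
  ring

end Mom2
end HaarConc
end

section
set_option linter.unusedSectionVars false

namespace HaarConc
section Inn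
variable {n : Type*} [Fintype n] [DecidableEq n]

lemma inner_trace (A X : Matrix n n ℂ) :
    ∑ p, ∑ q, ((starRingEnd ℂ) (A p q) * X p q).re = ((star A * X).trace).re := by
  rw [Matrix.trace, Complex.re_sum, Finset.sum_comm]
  refine Finset.sum_congr rfl fun q _ => ?_
  rw [Matrix.diag_apply, Matrix.mul_apply, Complex.re_sum]
  rfl

lemma inner_single {A : Matrix n n ℂ} (hA : star A = -A) (ht : A.trace = 0) (o : n)
    (w : Matrix.unitaryGroup n ℂ) :
    ∑ p, ∑ q, ((starRingEnd ℂ) (A p q) * ((w : Matrix n n ℂ) * gen 1 (th o) *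
      star (w : Matrix n n ℂ)) p q).re = eta n * (cj A w o o).im := by
  rw [inner_trace, hA]
  have e : (-A * ((w : Matrix n n ℂ) * gen 1 (th o) * star (w : Matrix n n ℂ))).trace =
      -(cj A w * Matrix.diagonal (fun p => Complex.I * (th o p : ℂ))).trace := by
    have h1 : gen 1 (th o) = Matrix.diagonal (fun p => Complex.I * (th o p : ℂ)) := by
      simp [gen]
    rw [h1, Matrix.neg_mul, Matrix.trace_neg, ← Matrix.mul_assoc, Matrix.trace_mul_comm]
    unfold cj
    simp only [Matrix.mul_assoc]
  have htr : (cj A w).trace = 0 := by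
    unfold cj
    rw [Matrix.mul_assoc, Matrix.trace_mul_comm, Matrix.mul_assoc, mul_star_self_coe, Matrix.mul_one, ht]
  rw [e]
  have e2 : (cj A w * Matrix.diagonal (fun p => Complex.I * (th o p : ℂ))).trace =
      Complex.I * eta n * cj A w o o - Complex.I * eta n / Fintype.card n * (cj A w).trace := by
    rw [Matrix.trace, Matrix.trace, Finset.mul_sum]
    simp only [Matrix.diag_apply, Matrix.mul_diagonal, th]
    have : Complex.I * eta n * cj A w o o = ∑ p, if p = o then Complex.I * eta n * cj A w p p else 0 := by
      simp
    rw [this, ← Finset.sum_sub_distrib]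
    refine Finset.sum_congr rfl fun p _ => ?_
    split_ifs <;> push_cast <;> ring
  rw [e2, htr]
  simp [Complex.mul_re]

end Inn

section Prod
variable {k : ℕ} {N : Fin k → ℕ}
  [∀ i, MeasurableSpace (Matrix.unitaryGroup (Fin (N i)) ℂ)]
  [∀ i, BorelSpace (Matrix.unitaryGroup (Fin (N i)) ℂ)]
  (ν : ∀ i, Measure (Matrix.unitaryGroup (Fin (N i)) ℂ))
  [∀ i, IsProbabilityMeasure (ν i)] [∀ i, (ν i).IsMulLeftInvariant]

lemma memLp_cont {n : Type*} [Fintype n] [DecidableEq n] [MeasurableSpace (Matrix.unitaryGroup n ℂ)]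
    [BorelSpace (Matrix.unitaryGroup n ℂ)] (μ : Measure (Matrix.unitaryGroup n ℂ)) [IsProbabilityMeasure μ]
    {F : Matrix.unitaryGroup n ℂ → ℝ} (hF : Continuous F) : MemLp F 2 μ := by
  rw [memLp_two_iff_integrable_sq hF.measurable.aestronglyMeasurable]
  exact Setup.integrable_of_continuous μ (hF.pow 2)

lemma hiso_conc (o : ∀ i, Fin (N i)) (A : Amb N) (hA : A ∈ (mkSetup o).su) :
    ∫ w, (inner ℝ A ((mkSetup o).H w)) ^ 2 ∂(Measure.pi ν) ≤ ‖A‖ ^ 2 := by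
  have hA' : A ∈ suSub N := hA
  have e : ∀ w, inner ℝ A ((mkSetup o).H w) =
      ∑ i, eta (Fin (N i)) * (cj (A i) (w i) (o i) (o i)).im := by
    intro w
    rw [amb_inner]
    exact Finset.sum_congr rfl fun i _ => inner_single (hA' i).1 (hA' i).2 (o i) (w i)
  simp_rw [e]
  have hc : ∀ i, Continuous fun w => eta (Fin (N i)) * (cj (A i) w (o i) (o i)).im := by
    intro i
    exact continuous_const.mul (Complex.continuous_im.comp (cj_entry_cont _ _ _))
  have hm : ∀ i, ∫ w, eta (Fin (N i)) * (cj (A i) w (o i) (o i)).im ∂(ν i) = 0 := by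
    intro i
    rw [integral_const_mul, cj_mean (ν i) (hA' i).1 (hA' i).2, mul_zero]
  have hv := ProbabilityTheory.variance_sum_pi (μ := ν)
    (X := fun i w => eta (Fin (N i)) * (cj (A i) w (o i) (o i)).im) fun i => memLp_cont (ν i) (hc i)
  have hcs : Continuous fun w : (∀ i, Matrix.unitaryGroup (Fin (N i)) ℂ) =>
      ∑ i, eta (Fin (N i)) * (cj (A i) (w i) (o i) (o i)).im :=
    continuous_finsetSum _ fun i _ => (hc i).comp (continuous_apply i)
  have hfun : (∑ i, fun (w : ∀ i, Matrix.unitaryGroup (Fin (N i)) ℂ) =>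
      eta (Fin (N i)) * (cj (A i) (w i) (o i) (o i)).im) =
      fun w => ∑ i, eta (Fin (N i)) * (cj (A i) (w i) (o i) (o i)).im := by
    funext w; simp
  rw [hfun, ProbabilityTheory.variance_of_integral_eq_zero hcs.measurable.aemeasurable] at hv
  · rw [hv, amb_normSq]
    refine le_of_eq (Finset.sum_congr rfl fun i _ => ?_)
    rw [ProbabilityTheory.variance_of_integral_eq_zero (hc i).measurable.aemeasurable (hm i)]
    simp_rw [mul_pow]
    rw [integral_const_mul, cj_var (ν i) (hA' i).1 (hA' i).2, eta_sq]
    have : (Fintype.card (Fin (N i)) : ℝ) ≠ 0 := by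
      have : Nonempty (Fin (N i)) := ⟨o i⟩
      exact_mod_cast Fintype.card_ne_zero
    field_simp
  · rw [integral_finsetSum _ fun i _ => ?_]
    · refine Finset.sum_eq_zero fun i _ => ?_
      rw [integral_comp_eval (μ := ν) (f := fun w => eta (Fin (N i)) * (cj (A i) w (o i) (o i)).im)
        (hc i).measurable.aestronglyMeasurable]
      exact hm i
    · exact integrable_comp_eval (μ := ν) (f := fun w => eta (Fin (N i)) * (cj (A i) w (o i) (o i)).im)
        (Setup.integrable_of_continuous (ν i) (hc i))

/-- the contracted squared norm -/
noncomputable def fc {n : Type*} [Fintype n] [DecidableEq n] (A : Matrix n n ℂ) (o : n) (ε : ℝ)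
    (w : Matrix.unitaryGroup n ℂ) : ℝ :=
  fsq ((2⁻¹ : ℝ) • (A + ((w * curve 1 (th o) ε * w⁻¹ : Matrix.unitaryGroup n ℂ) : Matrix n n ℂ) * A *
      (((w * curve 1 (th o) ε * w⁻¹)⁻¹ : Matrix.unitaryGroup n ℂ) : Matrix n n ℂ)))

lemma fc_cont {n : Type*} [Fintype n] [DecidableEq n] [MeasurableSpace (Matrix.unitaryGroup n ℂ)]
    [BorelSpace (Matrix.unitaryGroup n ℂ)] {A : Matrix n n ℂ} (hA : star A = -A)
    (o : n) (ε : ℝ) : Continuous (fc A o ε) := by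
  have : fc A o ε = fun w => fsq A - (1 - Real.cos (ε * eta n)) *
      (∑ b, ‖cj A w o b‖ ^ 2 - ‖cj A w o o‖ ^ 2) := by
    funext w; exact contr_pt hA o ε w
  rw [this]
  fun_prop

lemma hcontr_conc (o : ∀ i, Fin (N i)) {κ ε : ℝ}
    (h : ∀ i, κ * ε ^ 2 ≤ (1 - Real.cos (ε * eta (Fin (N i)))) / (N i + 1))
    (A : Amb N) (hA : A ∈ (mkSetup o).su) :
    ∫ w, ‖(2⁻¹ : ℝ) • (A + (mkSetup o).c ((mkSetup o).h ε w) * A *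
      (mkSetup o).c ((mkSetup o).h ε w)⁻¹)‖ ^ 2 ∂(Measure.pi ν) ≤ (1 - κ * ε ^ 2) * ‖A‖ ^ 2 := by
  have hA' : A ∈ suSub N := hA
  have e : ∀ w, ‖(2⁻¹ : ℝ) • (A + (mkSetup o).c ((mkSetup o).h ε w) * A *
      (mkSetup o).c ((mkSetup o).h ε w)⁻¹)‖ ^ 2 = ∑ i, fc (A i) (o i) ε (w i) := by
    intro w
    rw [amb_normSq]
    refine Finset.sum_congr rfl fun i _ => ?_
    rfl
  have hc := fun i => fc_cont (hA' i).1 (o i) ε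
  rw [integral_congr_ae (Filter.Eventually.of_forall e)]
  rw [integral_finsetSum _ fun i _ => integrable_comp_eval (μ := ν)
    (Setup.integrable_of_continuous (ν i) (hc i)), amb_normSq, Finset.mul_sum]
  refine Finset.sum_le_sum fun i _ => ?_
  rw [integral_comp_eval (μ := ν) (hc i).measurable.aestronglyMeasurable]
  have h2 : ∫ w, fc (A i) (o i) ε w ∂(ν i) = _ := contr_int (ν i) (hA' i).1 (hA' i).2 (o i) ε
  rw [h2]
  refine mul_le_mul_of_nonneg_right ?_ (fsq_nonneg _)
  have := h i
  rw [Fintype.card_fin]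
  linarith

end Prod

/-- the cosine estimate -/
lemma cos_est (n : ℕ) {ε : ℝ} (hε : |ε * eta (Fin n)| ≤ 1 / 2) :
    (0.95 * n / 2) * ε ^ 2 ≤ (1 - Real.cos (ε * eta (Fin n))) / (n + 1) := by
  set y := ε * eta (Fin n) with hy
  have h1 := Real.cos_bound (x := y) (by linarith)
  have h2 := (abs_le.1 h1).2
  have hy4 : |y| ^ 4 ≤ y ^ 2 / 4 := by
    have : |y| ^ 4 = y ^ 2 * |y| ^ 2 := by rw [← sq_abs y]; ring
    rw [this]
    have h3 : |y| ^ 2 ≤ 1 / 4 := by nlinarith [abs_nonneg y]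
    nlinarith [sq_nonneg y]
  have hy2 : y ^ 2 = ε ^ 2 * (n * (n + 1)) := by
    rw [hy, mul_pow, eta_sq, Fintype.card_fin]
  rw [le_div_iff₀ (by positivity)]
  have : 0.95 / 2 * y ^ 2 ≤ 1 - Real.cos y := by nlinarith [sq_nonneg y]
  rw [hy2] at this
  linarith

end HaarConc
end

section
set_option linter.unusedSectionVars false

namespace HaarConc
section Cen
variable {n : Type*} [Fintype n] [DecidableEq n]

lemma det_norm (u : Matrix.unitaryGroup n ℂ) : ‖(u : Matrix n n ℂ).det‖ = 1 := by
  have h := congrArg Matrix.det (star_mul_self_coe u)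
  rw [Matrix.det_mul, Matrix.star_eq_conjTranspose, Matrix.det_conjTranspose, Matrix.det_one] at h
  have h2 := congrArg norm h
  rw [norm_mul, norm_star, norm_one] at h2
  nlinarith [norm_nonneg (u : Matrix n n ℂ).det]

/-- argument of determinant -/
noncomputable def ad (u : Matrix.unitaryGroup n ℂ) : ℝ := ((u : Matrix n n ℂ).det).arg

lemma exp_ad (u : Matrix.unitaryGroup n ℂ) : Complex.exp (Complex.I * ad u) = (u : Matrix n n ℂ).det := by
  have := Complex.norm_mul_exp_arg_mul_I ((u : Matrix n n ℂ).det)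
  rw [det_norm] at this
  rw [mul_comm, ad]
  simpa using this

lemma det_dg (θ : n → ℝ) : (dg θ : Matrix n n ℂ).det = Complex.exp (Complex.I * (∑ p, θ p : ℝ)) := by
  rw [coe_dg, Matrix.det_diagonal, ← Complex.exp_sum]
  push_cast
  rw [Finset.mul_sum]

lemma det_conj (x u : Matrix.unitaryGroup n ℂ) :
    ((x * u * x⁻¹ : Matrix.unitaryGroup n ℂ) : Matrix n n ℂ).det = (u : Matrix n n ℂ).det := by
  have h := congrArg Matrix.det (mul_star_self_coe x)
  rw [Matrix.det_mul, Matrix.det_one] at h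
  rw [Matrix.UnitaryGroup.mul_val, Matrix.UnitaryGroup.mul_val, Matrix.det_mul, Matrix.det_mul, coe_inv]
  linear_combination (u : Matrix n n ℂ).det * h

lemma reach_single (o : n) (x u : Matrix.unitaryGroup n ℂ) :
    ∃ (z : Matrix.unitaryGroup n ℂ) (θ : n → ℝ), ∑ p, θ p = 0 ∧
      fsq (gen z θ) ≤ Fintype.card n * (Real.pi + Fintype.card n * Real.pi) ^ 2 ∧
      curve z θ 1 * dg (fun _ => ad u / Fintype.card n) = x * u * x⁻¹ := by
  have hc : (Fintype.card n : ℝ) ≠ 0 := by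
    have : Nonempty n := ⟨o⟩
    exact_mod_cast Fintype.card_ne_zero
  set T : Matrix.unitaryGroup n ℂ := dg (fun _ => ad u / Fintype.card n) with hT
  obtain ⟨z, θ, hs, hθ⟩ := diag_unitary (x * u * x⁻¹ * T⁻¹)
  have hdT : (T : Matrix n n ℂ).det = (u : Matrix n n ℂ).det := by
    rw [hT, det_dg, ← exp_ad]
    congr 3
    simp
    field_simp
  have h1 : Complex.exp (Complex.I * (∑ p, θ p : ℝ)) = 1 := by
    rw [← det_dg, ← det_conj z, ← hs, Matrix.UnitaryGroup.mul_val, Matrix.det_mul, det_conj, ← hdT,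
      ← Matrix.det_mul, coe_inv, mul_star_self_coe, Matrix.det_one]
  obtain ⟨m, hm⟩ := Complex.exp_eq_one_iff.1 h1
  have hm' : ∑ p, θ p = m * (2 * Real.pi) := by
    have : ((∑ p, θ p : ℝ) : ℂ) = ((m * (2 * Real.pi) : ℝ) : ℂ) := by
      apply mul_left_cancel₀ Complex.I_ne_zero
      rw [hm]; push_cast; ring
    exact_mod_cast this
  set S := ∑ p, θ p with hS
  set θ' : n → ℝ := fun p => θ p - if p = o then S else 0 with hθ'
  have hdg : dg θ' = dg θ := by
    apply Subtype.ext
    rw [coe_dg, coe_dg]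
    congr 1
    funext p
    simp only [hθ']
    split_ifs with hp
    · push_cast
      rw [mul_sub, Complex.exp_sub, h1, div_one]
    · simp
  have hSb : |S| ≤ Fintype.card n * Real.pi := by
    refine (Finset.abs_sum_le_sum_abs _ _).trans ?_
    refine (Finset.sum_le_sum fun p _ => hθ p).trans ?_
    simp
  refine ⟨z, θ', ?_, ?_, ?_⟩
  · simp [hθ', Finset.sum_sub_distrib, ← hS]
  · rw [fsq_gen]
    have : ∀ p ∈ Finset.univ, θ' p ^ 2 ≤ (Real.pi + Fintype.card n * Real.pi) ^ 2 := by
      intro p _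
      rw [← sq_abs (θ' p)]
      have hb : |θ' p| ≤ Real.pi + Fintype.card n * Real.pi := by
        simp only [hθ']
        refine (abs_sub _ _).trans (add_le_add (hθ p) ?_)
        split_ifs
        · exact hSb
        · simp; positivity
      gcongr
    refine (Finset.sum_le_sum this).trans ?_
    simp
  · have : curve z θ' 1 = x * u * x⁻¹ * T⁻¹ := by
      rw [hs, curve, one_smul, hdg]
    rw [this]; group

lemma ad_cont_det : Continuous fun u : Matrix.unitaryGroup n ℂ => (u : Matrix n n ℂ).det :=
  continuous_subtype_val.matrix_det

variable [MeasurableSpace (Matrix.unitaryGroup n ℂ)] [BorelSpace (Matrix.unitaryGroup n ℂ)]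

lemma ad_meas : Measurable (ad : Matrix.unitaryGroup n ℂ → ℝ) :=
  Complex.measurable_arg.comp ad_cont_det.measurable

variable (μ : Measure (Matrix.unitaryGroup n ℂ)) [IsProbabilityMeasure μ] [μ.IsMulLeftInvariant]

lemma exp_int (a : ℝ) : ∫ t in (-Real.pi)..Real.pi, Real.exp (a * t) ≤
    2 * Real.pi * Real.exp (Real.pi ^ 2 / 2 * a ^ 2) := by
  have h1 : ∫ t in (-Real.pi)..Real.pi, Real.exp (a * (-t)) =
      ∫ t in (-Real.pi)..Real.pi, Real.exp (a * t) := by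
    have := intervalIntegral.integral_comp_neg (a := -Real.pi) (b := Real.pi) (fun t => Real.exp (a * t))
    simpa using this
  have h2 : ∫ t in (-Real.pi)..Real.pi, Real.exp (a * t) =
      ∫ t in (-Real.pi)..Real.pi, Real.cosh (a * t) := by
    have h3 : ∀ t, Real.cosh (a * t) = (Real.exp (a * t) + Real.exp (a * (-t))) / 2 := by
      intro t; rw [Real.cosh_eq]; ring_nf
    simp_rw [h3]
    rw [intervalIntegral.integral_div, intervalIntegral.integral_add, h1]
    · ring
    · exact (by fun_prop : Continuous fun t => Real.exp (a * t)).intervalIntegrable _ _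
    · exact (by fun_prop : Continuous fun t => Real.exp (a * (-t))).intervalIntegrable _ _
  rw [h2]
  have hpi : -Real.pi ≤ Real.pi := by linarith [Real.pi_pos]
  have h4 : ∫ t in (-Real.pi)..Real.pi, Real.cosh (a * t) ≤
      ∫ t in (-Real.pi)..Real.pi, Real.exp (Real.pi ^ 2 / 2 * a ^ 2) := by
    refine intervalIntegral.integral_mono_on hpi ?_ ?_ fun t ht => ?_
    · exact (Real.continuous_cosh.comp (continuous_const.mul continuous_id)).intervalIntegrable _ _
    · exact continuous_const.intervalIntegrable _ _
    · refine (Real.cosh_le_exp_half_sq _).trans (Real.exp_le_exp.2 ?_)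
      have : t ^ 2 ≤ Real.pi ^ 2 := sq_le_sq' ht.1 ht.2
      nlinarith [sq_nonneg a]
  refine h4.trans (le_of_eq ?_)
  rw [intervalIntegral.integral_const]
  simp; ring

lemma arg_int (a α : ℝ) : ∫ t in (-Real.pi)..Real.pi,
      Real.exp (a * (Complex.exp (Complex.I * (t + α : ℝ))).arg) =
    ∫ t in (-Real.pi)..Real.pi, Real.exp (a * t) := by
  set g : ℝ → ℝ := fun t => Real.exp (a * (Complex.exp (Complex.I * (t : ℝ))).arg) with hg
  have hper : Function.Periodic g (2 * Real.pi) := by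
    intro t
    simp only [hg]
    rw [show Complex.I * ((t + 2 * Real.pi : ℝ) : ℂ) = Complex.I * t + 2 * Real.pi * Complex.I by
      push_cast; ring, Complex.exp_periodic]
  have h1 : ∫ t in (-Real.pi)..Real.pi, g (t + α) = ∫ t in (-Real.pi)..Real.pi, g t := by
    rw [intervalIntegral.integral_comp_add_right]
    have := hper.intervalIntegral_add_eq (-Real.pi + α) (-Real.pi)
    rw [show -Real.pi + α + 2 * Real.pi = Real.pi + α by ring,
      show -Real.pi + 2 * Real.pi = Real.pi by ring] at this
    exact this
  refine h1.trans ?_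
  have hpi : -Real.pi ≤ Real.pi := by linarith [Real.pi_pos]
  rw [intervalIntegral.integral_of_le hpi, intervalIntegral.integral_of_le hpi]
  refine setIntegral_congr_fun measurableSet_Ioc fun t ht => ?_
  simp only [hg]
  rw [mul_comm Complex.I, Complex.arg_exp_mul_I, toIocMod_eq_self _ |>.2]
  constructor
  · exact ht.1
  · have := ht.2; linarith

lemma mgf_single (o : n) (a : ℝ) : ∫ u, Real.exp (a * ad u) ∂μ ≤ Real.exp (Real.pi ^ 2 / 2 * a ^ 2) := by
  have hc : (Fintype.card n : ℝ) ≠ 0 := by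
    have : Nonempty n := ⟨o⟩
    exact_mod_cast Fintype.card_ne_zero
  set g : Matrix.unitaryGroup n ℂ → ℝ → ℝ := fun u t =>
    Real.exp (a * (Complex.exp (Complex.I * t) * (u : Matrix n n ℂ).det).arg) with hg
  have h1 : ∀ t : ℝ, ∫ u, g u t ∂μ = ∫ u, Real.exp (a * ad u) ∂μ := by
    intro t
    rw [← integral_mul_left_eq_self (fun u => Real.exp (a * ad u)) (dg fun _ => t / Fintype.card n)]
    refine integral_congr_ae (Filter.Eventually.of_forall fun u => ?_)
    simp only [hg, ad]
    rw [Matrix.UnitaryGroup.mul_val, Matrix.det_mul, det_dg]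
    have : ∑ _p : n, t / (Fintype.card n : ℝ) = t := by
      simp
      field_simp
    rw [this]
  have h2 : ∀ u, ∫ t in (-Real.pi)..Real.pi, g u t = ∫ t in (-Real.pi)..Real.pi, Real.exp (a * t) := by
    intro u
    rw [← arg_int a (ad u)]
    refine intervalIntegral.integral_congr fun t _ => ?_
    simp only [hg]
    rw [← exp_ad, ← Complex.exp_add]
    congr 4
    push_cast; ring
  have hpi : -Real.pi ≤ Real.pi := by linarith [Real.pi_pos]
  have hm : Measurable (Function.uncurry g) := by
    have h5 : Measurable fun x : Matrix.unitaryGroup n ℂ × ℝ => (x.1 : Matrix n n ℂ).det :=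
      ad_cont_det.measurable.comp measurable_fst
    have h6 : Measurable fun x : Matrix.unitaryGroup n ℂ × ℝ => Complex.exp (Complex.I * x.2) :=
      (by fun_prop : Continuous fun t : ℝ => Complex.exp (Complex.I * t)).measurable.comp measurable_snd
    exact Real.measurable_exp.comp ((Complex.measurable_arg.comp (h6.mul h5)).const_mul a)
  have hi : Integrable (Function.uncurry g) (μ.prod (volume.restrict (Set.Ioc (-Real.pi) Real.pi))) := by
    refine Integrable.of_bound hm.aestronglyMeasurable (Real.exp (|a| * Real.pi))
      (Filter.Eventually.of_forall fun x => ?_)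
    simp only [Function.uncurry, hg, Real.norm_eq_abs, Real.abs_exp]
    apply Real.exp_le_exp.2
    refine (le_abs_self _).trans ?_
    rw [abs_mul]
    exact mul_le_mul_of_nonneg_left (Complex.abs_arg_le_pi _) (abs_nonneg _)
  have hsw := integral_integral_swap hi
  have hL : ∫ u, (∫ t in Set.Ioc (-Real.pi) Real.pi, g u t) ∂μ = ∫ t in (-Real.pi)..Real.pi, Real.exp (a * t) := by
    have : ∀ u, ∫ t in Set.Ioc (-Real.pi) Real.pi, g u t = ∫ t in (-Real.pi)..Real.pi, Real.exp (a * t) := by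
      intro u
      rw [← h2 u, intervalIntegral.integral_of_le hpi]
    simp_rw [this]
    simp
  rw [hL] at hsw
  simp_rw [h1] at hsw
  rw [← intervalIntegral.integral_of_le hpi, intervalIntegral.integral_const] at hsw
  have h3 := exp_int a
  rw [hsw] at h3
  simp only [smul_eq_mul] at h3
  have : (Real.pi - -Real.pi) = 2 * Real.pi := by ring
  rw [this] at h3
  exact le_of_mul_le_mul_left h3 (by positivity)

end Cen
end HaarConc
end

section
set_option linter.unusedSectionVars false

namespace HaarConc
section Fin1
variable {k : ℕ} {N : Fin k → ℕ}

/-- central part -/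
noncomputable def Tc (N : Fin k → ℕ) (b : Fin k → ℝ) : ∀ i, Matrix.unitaryGroup (Fin (N i)) ℂ :=
  fun i => dg fun _ => b i / (Fintype.card (Fin (N i)) : ℝ)

lemma Tc_cont : Continuous (Tc N) := by
  refine continuous_pi fun i => ?_
  refine Continuous.subtype_mk ?_ _
  refine Continuous.matrix_diagonal ?_
  refine continuous_pi fun p => ?_
  fun_prop

/-- central generator -/
noncomputable def Zc (N : Fin k → ℕ) : (Fin k → ℝ) →ₗ[ℝ] Amb N where
  toFun b := fun i => Matrix.diagonal fun _ => Complex.I * ((b i / (Fintype.card (Fin (N i)) : ℝ) : ℝ) : ℂ)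
  map_add' b c := by
    funext i
    change (Matrix.diagonal (fun _ : Fin (N i) => Complex.I * (((b i + c i) / (Fintype.card (Fin (N i)) : ℝ) : ℝ) : ℂ)) : Matrix (Fin (N i)) (Fin (N i)) ℂ) =
      (Matrix.diagonal (fun _ : Fin (N i) => Complex.I * (((b i) / (Fintype.card (Fin (N i)) : ℝ) : ℝ) : ℂ)) : Matrix (Fin (N i)) (Fin (N i)) ℂ) +
      (Matrix.diagonal (fun _ : Fin (N i) => Complex.I * (((c i) / (Fintype.card (Fin (N i)) : ℝ) : ℝ) : ℂ)) : Matrix (Fin (N i)) (Fin (N i)) ℂ)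
    rw [Matrix.diagonal_add]
    refine congrArg Matrix.diagonal ?_
    funext p
    push_cast
    ring
  map_smul' r b := by
    funext i
    change (Matrix.diagonal (fun _ : Fin (N i) => Complex.I * (((r * b i) / (Fintype.card (Fin (N i)) : ℝ) : ℝ) : ℂ)) : Matrix (Fin (N i)) (Fin (N i)) ℂ) =
      r • (Matrix.diagonal (fun _ : Fin (N i) => Complex.I * (((b i) / (Fintype.card (Fin (N i)) : ℝ) : ℝ) : ℂ)) : Matrix (Fin (N i)) (Fin (N i)) ℂ)
    rw [← Matrix.diagonal_smul]
    refine congrArg Matrix.diagonal ?_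
    funext p
    simp only [Pi.smul_apply, Complex.real_smul]
    push_cast
    ring

lemma Zc_eq (b : Fin k → ℝ) : Zc N b = pgen 1 fun i _ => b i / (Fintype.card (Fin (N i)) : ℝ) := by
  funext i
  change Matrix.diagonal (fun _ : Fin (N i) => _) = gen 1 (fun _ : Fin (N i) => _)
  simp [gen]

lemma Tc_eq (b : Fin k → ℝ) (s : ℝ) :
    Tc N (s • b) = pcurve 1 (fun i _ => b i / (Fintype.card (Fin (N i)) : ℝ)) s := by
  funext i
  unfold Tc pcurve curve
  simp only [Pi.one_apply, one_mul, inv_one, mul_one]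
  congr 1
  funext p
  simp
  ring

variable [∀ i, MeasurableSpace (Matrix.unitaryGroup (Fin (N i)) ℂ)]
  [∀ i, BorelSpace (Matrix.unitaryGroup (Fin (N i)) ℂ)]

/-- the concrete center -/
noncomputable def mkCenter (o : ∀ i, Fin (N i)) (m : ℝ) (hm : 0 < m) (hmN : ∀ i, m ≤ N i) :
    (mkSetup o).Center (Fin k) where
  T := Tc N
  contT := Tc_cont
  T0 := by
    funext i
    have : (fun _ : Fin (N i) => (0 : Fin k → ℝ) i / (Fintype.card (Fin (N i)) : ℝ)) = 0 := by
      funext p; simp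
    rw [Tc, this, dg_zero]; rfl
  Z := Zc N
  hT b s := by
    have h := pcurve_deriv (N := N) 1 (fun i _ => b i / (Fintype.card (Fin (N i)) : ℝ)) s
    rw [← Zc_eq] at h
    simp_rw [← Tc_eq] at h
    exact h
  φ u i := ad (u i)
  hφ := measurable_pi_lambda _ fun i => ad_meas.comp (measurable_pi_apply i)
  bφ u i := Complex.abs_arg_le_pi _
  B := Real.sqrt (∑ i, Fintype.card (Fin (N i)) * (Real.pi + Fintype.card (Fin (N i)) * Real.pi) ^ 2)
  reach x u := by
    choose z θ h1 h2 h3 using fun i => reach_single (o i) (x i) (u i)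
    refine ⟨pgen z θ, pgen_mem z θ h1, ?_, pcurve z θ, pcurve_zero _ _, pcurve_deriv z θ, ?_⟩
    · apply Real.le_sqrt_of_sq_le
      rw [amb_normSq]
      exact Finset.sum_le_sum fun i _ => h2 i
    · funext i
      exact h3 i
  n := m
  hn := hm
  hZ b := by
    rw [Zc_eq, amb_normSq, Finset.sum_div]
    refine Finset.sum_le_sum fun i _ => ?_
    have hN0 : (0 : ℝ) < N i := hm.trans_le (hmN i)
    have e : fsq (pgen (N := N) 1 (fun i _ => b i / (Fintype.card (Fin (N i)) : ℝ)) i) = b i ^ 2 / N i := by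
      refine (fsq_gen _ _).trans ?_
      simp
      field_simp
    rw [e]
    exact div_le_div_of_nonneg_left (sq_nonneg _) hm (hmN i)

variable (ν : ∀ i, Measure (Matrix.unitaryGroup (Fin (N i)) ℂ))
  [∀ i, IsProbabilityMeasure (ν i)] [∀ i, (ν i).IsMulLeftInvariant]

lemma hmgf_conc (o : ∀ i, Fin (N i)) (a : Fin k → ℝ) :
    ∫ u, Real.exp (∑ i, a i * ad (u i)) ∂(Measure.pi ν) ≤
      Real.exp (Real.pi ^ 2 / 2 * ∑ i, a i ^ 2) := by
  simp_rw [Real.exp_sum]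
  rw [integral_fintype_prod_eq_prod (𝕜 := ℝ) (μ := ν) (f := fun i u => Real.exp (a i * ad u)),
    Finset.mul_sum, Real.exp_sum]
  exact Finset.prod_le_prod (fun i _ => integral_nonneg fun u => (Real.exp_pos _).le)
    fun i _ => mgf_single (ν i) (o i) (a i)

lemma main_conc (o : ∀ i, Fin (N i)) (m : ℝ) (hm : 0 < m) (hmN : ∀ i, m ≤ N i)
    {L : ℝ} (hL : 0 < L) (f : (∀ i, Matrix.unitaryGroup (Fin (N i)) ℂ) → ℝ)
    (hf : ∀ U V, |f U - f V| ≤ L * ‖cHom N U - cHom N V‖) (t : ℝ) (ht : 0 < t) :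
    Measure.pi ν {U | (∫ V, f V ∂(Measure.pi ν)) + t ≤ f U} ≤
      ENNReal.ofReal (Real.exp (-(m * t ^ 2) / (24 * L ^ 2))) := by
  set se := ∑ i, eta (Fin (N i))
  have hη : ∀ i, 0 ≤ eta (Fin (N i)) := fun i => Real.sqrt_nonneg _
  have hs0 : 0 ≤ se := Finset.sum_nonneg fun i _ => hη i
  have hle : ∀ i, eta (Fin (N i)) ≤ se := fun i =>
    Finset.single_le_sum (f := fun i => eta (Fin (N i))) (fun i _ => hη i) (Finset.mem_univ i)
  refine Setup.tail (R := mkCenter o m hm hmN) (ν := Measure.pi ν) (κ := 0.95 * m / 2)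
    (ε₀ := 1 / (2 * (1 + se))) hL (by positivity) (by positivity) hm ?_ hf
    (hiso_conc ν o) ?_ (hmgf_conc ν o) t ht
  · change 1 / (0.95 * m / 2) + Real.pi ^ 2 / m ≤ 12 / m
    have h1 : 1 / (0.95 * m / 2) = (2 / 0.95) / m := by field_simp
    rw [h1, ← add_div]
    refine div_le_div_of_nonneg_right ?_ hm.le
    have h2 := Real.pi_lt_d4
    have h3 := Real.pi_pos
    norm_num
    nlinarith
  · intro ε hε hε0 A hA
    refine hcontr_conc ν o (fun i => ?_) A hA
    refine le_trans ?_ (cos_est (N i) ?_)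
    · have := hmN i
      have h4 : 0.95 * m / 2 ≤ 0.95 * (N i : ℝ) / 2 := by linarith
      exact mul_le_mul_of_nonneg_right h4 (sq_nonneg _)
    · rw [abs_of_nonneg (mul_nonneg hε.le (hη i))]
      rw [lt_div_iff₀ (by positivity)] at hε0
      have := mul_le_mul_of_nonneg_left (hle i) hε.le
      nlinarith

end Fin1
end HaarConc
end

/-- concentration of the Haar measure, Theorem 3.1 / \cite{Mec19}.
Let `k ≥ 1` and `N_1, …, N_k` be positive integers, `X = U(N_1) × ⋯ × U(N_k)` with
`ν = μ_{N_1} × ⋯ × μ_{N_k}` the product of the Haar probability measures (each formalized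
as a left-invariant Borel probability measure, which on the compact group `U(N_i)` is
unique, hence Haar).  If `f : X → ℝ` is `L`-Lipschitz with respect to the ℓ²-combined
Frobenius metric, then for every `t > 0`,
`ν {U : f U ≥ E_ν[f] + t} ≤ exp(−(N−2)·t²/(24·L²))` where `N = min_i N_i`. -/
theorem stmt_0 (k : ℕ) (hk : 1 ≤ k) (N : Fin k → ℕ) (hN : ∀ i, 0 < N i)
    [∀ i, MeasurableSpace (Matrix.unitaryGroup (Fin (N i)) ℂ)]
    [∀ i, BorelSpace (Matrix.unitaryGroup (Fin (N i)) ℂ)]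
    (ν : ∀ i, Measure (Matrix.unitaryGroup (Fin (N i)) ℂ))
    [∀ i, IsProbabilityMeasure (ν i)]
    (hHaar : ∀ (i : Fin k) (g : Matrix.unitaryGroup (Fin (N i)) ℂ),
      MeasurePreserving (fun x => g * x) (ν i) (ν i))
    (L : ℝ) (hL : 0 < L)
    (f : (∀ i, Matrix.unitaryGroup (Fin (N i)) ℂ) → ℝ)
    (hf : ∀ U V : ∀ i, Matrix.unitaryGroup (Fin (N i)) ℂ,
      |f U - f V| ≤ L * Real.sqrt (∑ i,
        frobNorm ((U i : Matrix (Fin (N i)) (Fin (N i)) ℂ)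
          - (V i : Matrix (Fin (N i)) (Fin (N i)) ℂ)) ^ 2))
    (t : ℝ) (ht : 0 < t) :
    Measure.pi ν {U | (∫ V, f V ∂(Measure.pi ν)) + t ≤ f U} ≤
      ENNReal.ofReal
        (Real.exp (-(((sInf (Set.range fun i => N i) : ℕ) - 2 : ℝ) * t ^ 2) / (24 * L ^ 2))) := by
  have hinv : ∀ i, (ν i).IsMulLeftInvariant := fun i => ⟨fun g => (hHaar i g).map_eq⟩
  have hne : (Set.range fun i => N i).Nonempty := ⟨N ⟨0, hk⟩, ⟨⟨0, hk⟩, rfl⟩⟩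
  have hmpos : 0 < sInf (Set.range fun i => N i) := by
    obtain ⟨i, hi⟩ := Nat.sInf_mem hne
    rw [← hi]
    exact hN i
  have hmle : ∀ i, sInf (Set.range fun i => N i) ≤ N i := fun i => Nat.sInf_le ⟨i, rfl⟩
  have hnorm : ∀ U V : ∀ i, Matrix.unitaryGroup (Fin (N i)) ℂ,
      ‖HaarConc.cHom N U - HaarConc.cHom N V‖ = Real.sqrt (∑ i,
        frobNorm ((U i : Matrix (Fin (N i)) (Fin (N i)) ℂ)
          - (V i : Matrix (Fin (N i)) (Fin (N i)) ℂ)) ^ 2) := by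
    intro U V
    rw [← Real.sqrt_sq (norm_nonneg (HaarConc.cHom N U - HaarConc.cHom N V)),
      HaarConc.amb_normSq]
    congr 1
    refine Finset.sum_congr rfl fun i _ => ?_
    unfold frobNorm
    rw [Real.sq_sqrt (Finset.sum_nonneg fun p _ => Finset.sum_nonneg fun q _ => sq_nonneg _)]
    rfl
  refine (HaarConc.main_conc ν (fun i => ⟨0, hN i⟩) ((sInf (Set.range fun i => N i) : ℕ) : ℝ)
    (by exact_mod_cast hmpos) (fun i => by exact_mod_cast hmle i) hL f
    (fun U V => by rw [hnorm]; exact hf U V) t ht).trans ?_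
  refine ENNReal.ofReal_le_ofReal (Real.exp_le_exp.2 ?_)
  refine div_le_div_of_nonneg_right ?_ (by positivity)
  nlinarith [sq_nonneg t]
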